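/- Let δ̄ > 0 and ε > 0. Then there is a constant h₀ > 0, depending only on ε and δ̄, such that for every pair (u, v) ∈ S(δ̄) there exists some h ∈ [h₀, 1/2] with η_u(h) ≤ h^{−ε}. -/

import Mathlib

noncomputable section

open MeasureTheory Metric Set
open scoped RealInnerProductSpace

abbrev R2 : Type := EuclideanSpace ℝ (Fin 2)

/-- `p` is a subgradient of `f` at `x`. -/
def SubgradAt (f : R2 → ℝ) (x p : R2) : Prop :=
  ∀ y : R2, f x + ⟪p, y - x⟫ ≤ f y

/-- `ψ` is a (canonically extended) potential of the optimal transport between `U₁` and `U₂`: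
it is convex on `ℝ²`, all its subgradients lie in `closure U₂`, and its gradient map pushes
the Lebesgue measure restricted to `U₁` forward to the Lebesgue measure restricted to `U₂`. -/
def IsOTPotential (U₁ U₂ : Set R2) (ψ : R2 → ℝ) : Prop :=
  ConvexOn ℝ Set.univ ψ ∧
  (∀ x p : R2, SubgradAt ψ x p → p ∈ closure U₂) ∧
  MeasureTheory.Measure.map (fun x => gradient ψ x) (MeasureTheory.volume.restrict U₁) =
    MeasureTheory.volume.restrict U₂

/-- `S` is a centred section of `w` at `x₀` of height `h`:
`S = {w < w x₀ + p · (· - x₀) + h}` for a slope `p` chosen so that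
the centre of mass of `S` is `x₀`. -/
def IsCentredSection (w : R2 → ℝ) (x₀ : R2) (h : ℝ) (S : Set R2) : Prop :=
  ∃ p : R2, S = {x : R2 | w x < w x₀ + ⟪p, x - x₀⟫ + h} ∧
    (∫ x in S, (x - x₀) ∂(MeasureTheory.volume)) = 0

/-- Dilation of `S` about `x₀` by factor `t`. -/
def dilate (x₀ : R2) (t : ℝ) (S : Set R2) : Set R2 :=
  (fun x => x₀ + t • (x - x₀)) '' S

/-- The (closed) ellipse centred at `0` with half-axis `A` in unit direction `e` and
half-axis `B` in the orthogonal unit direction `f`. -/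
def ellipse (e f : R2) (A B : ℝ) : Set R2 :=
  {x : R2 | (⟪x, e⟫ / A) ^ 2 + (⟪x, f⟫ / B) ^ 2 ≤ 1}

/-- `w` is an Alexandrov solution of `det D² w = χ_Ω` in `ℝ²`: the Lebesgue measure of the
subdifferential image of any Borel set `E` equals the Lebesgue measure of `E ∩ Ω`. -/
def AlexandrovSol (w : R2 → ℝ) (Ω : Set R2) : Prop :=
  ∀ E : Set R2, MeasurableSet E →
    MeasureTheory.volume (⋃ x ∈ E, {p : R2 | SubgradAt w x p}) =
      MeasureTheory.volume (E ∩ Ω)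

/-- Membership of the pair `(u, v)` in the normalized family `S(δ̄)`, together with the
associated data: the domains `Ω₁, Ω₂`, and, for each height `h ∈ (0,1]`, the ellipse
`E_h = ellipse (e h) (f h) (L h) (l h)` centred at `0` (long half-axis `L h` in unit
direction `e h`, short half-axis `l h` in the orthogonal unit direction `f h`, area `hπ`,
so `L h * l h = h`), whose perpendicular ellipse is
`E_h^⊥ = ellipse (f h) (e h) (L h) (l h)`.  The eccentricity is `η_u(h) = L h / l h`. -/
def InSFamily (δb : ℝ) (u v : R2 → ℝ) (Ω₁ Ω₂ : Set R2)
    (L l : ℝ → ℝ) (e f : ℝ → R2) : Prop :=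
  ConvexOn ℝ Set.univ u ∧ ConvexOn ℝ Set.univ v ∧
  Convex ℝ Ω₁ ∧ Convex ℝ Ω₂ ∧
  (interior Ω₁).Nonempty ∧ (interior Ω₂).Nonempty ∧
  (0 : R2) ∈ frontier Ω₁ ∧ (0 : R2) ∈ frontier Ω₂ ∧
  (fun x => gradient u x) '' Ω₁ = Ω₂ ∧ (fun y => gradient v y) '' Ω₂ = Ω₁ ∧
  AlexandrovSol u Ω₁ ∧ u 0 = 0 ∧ SubgradAt u 0 0 ∧
  AlexandrovSol v Ω₂ ∧ v 0 = 0 ∧ SubgradAt v 0 0 ∧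
  (∀ y ∈ Ω₂, v y = ⨆ x : R2, (⟪x, y⟫ - u x)) ∧
  L 1 = 1 ∧ l 1 = 1 ∧
  (∀ h : ℝ, h ∈ Set.Ioc (0 : ℝ) 1 →
    ‖e h‖ = 1 ∧ ‖f h‖ = 1 ∧ ⟪e h, f h⟫ = 0 ∧
    0 < l h ∧ l h ≤ L h ∧ L h * l h = h ∧
    (∃ S : Set R2, IsCentredSection u 0 h S ∧
      (∃ xh : R2, (fun z => xh + δb • z) '' ellipse (e h) (f h) (L h) (l h) ⊆ Ω₁ ∩ S) ∧
      S ⊆ (fun z => δb⁻¹ • z) '' ellipse (e h) (f h) (L h) (l h)) ∧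
    (∃ S : Set R2, IsCentredSection v 0 h S ∧
      (∃ yh : R2, (fun z => yh + δb • z) '' ellipse (f h) (e h) (L h) (l h) ⊆ Ω₂ ∩ S) ∧
      S ⊆ (fun z => δb⁻¹ • z) '' ellipse (f h) (e h) (L h) (l h)))

/-- `z ↦ t • x` cone over `Ω` with vertex `0` (closed): the tangent cone of `Ω` at `0`. -/
def tangentConeZero (Ω : Set R2) : Set R2 :=
  closure {y : R2 | ∃ t : ℝ, 0 ≤ t ∧ ∃ x ∈ Ω, y = t • x}

/-- The planar cross product (determinant) of two vectors. -/
def det2 (a b : R2) : ℝ := a 0 * b 1 - a 1 * b 0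

/-- `r` is the unit direction of the right tangent ray of `∂Ω` at `0`:
it lies in the tangent cone of `Ω` at `0` and the whole tangent cone lies
(weakly) counterclockwise from it. -/
def IsRightTangent (Ω : Set R2) (r : R2) : Prop :=
  ‖r‖ = 1 ∧ r ∈ tangentConeZero Ω ∧ ∀ x ∈ tangentConeZero Ω, 0 ≤ det2 r x

/-- `l` is the unit direction of the left tangent ray of `∂Ω` at `0`:
it lies in the tangent cone of `Ω` at `0` and the whole tangent cone lies
(weakly) clockwise from it. -/
def IsLeftTangent (Ω : Set R2) (l : R2) : Prop :=
  ‖l‖ = 1 ∧ l ∈ tangentConeZero Ω ∧ ∀ x ∈ tangentConeZero Ω, det2 l x ≤ 0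

/-- The open cone of direction `e` and opening angle `θ`. -/
def cone2 (e : R2) (θ : ℝ) : Set R2 :=
  {y : R2 | ∃ lam : ℝ, 0 < lam ∧ ∃ w : R2, ‖w‖ = 1 ∧
    InnerProductGeometry.angle w e < θ ∧ y = lam • w}

open scoped Pointwise

theorem ConvexOn.continuous_of_univ {E : Type*} [NormedAddCommGroup E] [NormedSpace ℝ E]
    [FiniteDimensional ℝ E] {u : E → ℝ} (hu : ConvexOn ℝ univ u) : Continuous u :=
  continuousOn_univ.1 (hu.continuousOn isOpen_univ)

theorem ConvexOn.measure_not_differentiableAt {u : R2 → ℝ} (hu : ConvexOn ℝ univ u) :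
    volume {x | ¬ DifferentiableAt ℝ u x} = 0 := by
  apply MeasureTheory.measure_null_of_locally_null
  intro x _
  obtain ⟨K, t, ht, hK⟩ := hu.locallyLipschitz x
  refine ⟨{x | ¬ DifferentiableAt ℝ u x} ∩ interior t,
    Filter.inter_mem self_mem_nhdsWithin (mem_nhdsWithin_of_mem_nhds (interior_mem_nhds.2 ht)), ?_⟩
  have := hK.ae_differentiableWithinAt_of_mem (μ := volume)
  refine measure_mono_null ?_ (ae_iff.1 this)
  rintro y ⟨h1, h2⟩ h3
  exact h1 ((h3 (interior_subset h2)).differentiableAt (mem_interior_iff_mem_nhds.1 h2))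

theorem exists_subgradAt {u : R2 → ℝ} (hu : ConvexOn ℝ univ u) (x : R2) :
    ∃ p, SubgradAt u x p := by
  have hc : Continuous u := hu.continuous_of_univ
  have hconv : Convex ℝ {z : R2 × ℝ | u z.1 < z.2} := by
    have := hu.convex_strict_epigraph
    simpa using this
  have hopen : IsOpen {z : R2 × ℝ | u z.1 < z.2} :=
    isOpen_lt (hc.comp continuous_fst) continuous_snd
  obtain ⟨f, hf⟩ := geometric_hahn_banach_point_open (x := ((x, u x) : R2 × ℝ)) hconv hopen (by simp)
  have hfe : ∀ z t, f (z, t) = f (z, 0) + t * f (0, 1) := by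
    intro z t
    have : ((z, t) : R2 × ℝ) = (z, 0) + t • (0, 1) := by simp
    rw [this, map_add, map_smul]; simp
  set c := f (0, 1) with hcdef
  have hcpos : 0 < c := by
    have := hf (x, u x + 1) (by simp)
    rw [hfe x, hfe x (u x + 1)] at this
    linarith
  have hle : ∀ z, f (x, 0) + u x * c ≤ f (z, 0) + u z * c := by
    intro z
    apply le_of_forall_pos_lt_add
    intro ε hε
    have := hf (z, u z + ε / c) (by simp; positivity)
    rw [hfe x, hfe z] at this
    have h2 : ε / c * c = ε := by field_simp
    nlinarith
  let g : R2 →L[ℝ] ℝ := f.comp (ContinuousLinearMap.inl ℝ R2 ℝ)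
  have hg : ∀ z, g z = f (z, 0) := fun z => rfl
  refine ⟨(InnerProductSpace.toDual ℝ R2).symm (-(c⁻¹) • g), fun y => ?_⟩
  rw [InnerProductSpace.toDual_symm_apply]
  have := hle y
  simp only [smul_apply, smul_eq_mul, map_sub, hg]
  have h3 : u y - u x ≥ -c⁻¹ * (f (y, 0) - f (x, 0)) := by
    have : (u y - u x) * c ≥ - (f (y, 0) - f (x, 0)) := by linarith
    calc -c⁻¹ * (f (y, 0) - f (x, 0)) = c⁻¹ * (- (f (y, 0) - f (x, 0))) := by ring
      _ ≤ c⁻¹ * ((u y - u x) * c) := by gcongr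
      _ = u y - u x := by field_simp
  linarith

theorem subgradAt_gradient {u : R2 → ℝ} {x : R2}
    (hd : DifferentiableAt ℝ u x) {p : R2} (hp : SubgradAt u x p) : p = gradient u x := by
  have h1 : IsLocalMin (fun y => u y - ⟪p, y⟫) x := by
    refine Filter.Eventually.of_forall fun y => ?_
    have := hp y
    rw [inner_sub_right] at this
    simp only; linarith
  have h2 : HasGradientAt u (gradient u x) x := hd.hasGradientAt
  have h3 : HasFDerivAt (fun y => u y - ⟪p, y⟫)
      (InnerProductSpace.toDual ℝ R2 (gradient u x) - innerSL ℝ p) x :=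
    h2.hasFDerivAt.sub (innerSL ℝ p).hasFDerivAt
  have h4 := h1.hasFDerivAt_eq_zero h3
  apply ext_inner_right ℝ
  intro w
  have := congrArg (fun φ => φ w) h4
  simp only [sub_apply, InnerProductSpace.toDual_apply_apply, innerSL_apply_apply, zero_apply] at this
  linarith

theorem subgradAt_gradient_self {u : R2 → ℝ} (hu : ConvexOn ℝ univ u) {x : R2}
    (hd : DifferentiableAt ℝ u x) : SubgradAt u x (gradient u x) := by
  obtain ⟨p, hp⟩ := exists_subgradAt hu x
  rwa [← subgradAt_gradient hd hp]

/-- The hypotheses on a pair of potentials used to derive one half of Legendre duality. -/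
structure HalfPair (u v : R2 → ℝ) (Ω₁ Ω₂ : Set R2) : Prop where
  cu : ConvexOn ℝ univ u
  cv : ConvexOn ℝ univ v
  o1 : Convex ℝ Ω₁
  o2 : Convex ℝ Ω₂
  i1 : (interior Ω₁).Nonempty
  i2 : (interior Ω₂).Nonempty
  z1 : (0 : R2) ∈ closure Ω₁
  z2 : (0 : R2) ∈ closure Ω₂
  gu : (fun x => gradient u x) '' Ω₁ = Ω₂
  gv : (fun y => gradient v y) '' Ω₂ = Ω₁
  al : AlexandrovSol u Ω₁
  u0 : u 0 = 0
  su : SubgradAt u 0 0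
  v0 : v 0 = 0
  sv : SubgradAt v 0 0
  leg : ∀ y ∈ Ω₂, v y = ⨆ x : R2, (⟪x, y⟫ - u x)

namespace HalfPair
variable {u v : R2 → ℝ} {Ω₁ Ω₂ : Set R2}

theorem u_nonneg (H : HalfPair u v Ω₁ Ω₂) (x : R2) : 0 ≤ u x := by
  have := H.su x; simp [H.u0] at this; exact this

theorem v_nonneg (H : HalfPair u v Ω₁ Ω₂) (x : R2) : 0 ≤ v x := by
  have := H.sv x; simp [H.v0] at this; exact this

theorem bdd (H : HalfPair u v Ω₁ Ω₂) {y : R2} (hy : y ∈ Ω₂) :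
    BddAbove (range fun x : R2 => ⟪x, y⟫ - u x) := by
  rw [← H.gu] at hy
  obtain ⟨x0, -, rfl⟩ := hy
  by_cases hd : DifferentiableAt ℝ u x0
  · have hs := subgradAt_gradient_self H.cu hd
    refine ⟨⟪x0, gradient u x0⟫ - u x0, ?_⟩
    rintro _ ⟨x, rfl⟩
    have := hs x
    rw [inner_sub_right, real_inner_comm, real_inner_comm x0] at this
    simp only; linarith
  · have : gradient u x0 = 0 := by
      simp [gradient, fderiv_zero_of_not_differentiableAt hd]
    refine ⟨0, ?_⟩
    rintro _ ⟨x, rfl⟩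
    simp [this, H.u_nonneg x]

theorem fenchel (H : HalfPair u v Ω₁ Ω₂) (x : R2) {y : R2} (hy : y ∈ closure Ω₂) :
    ⟪x, y⟫ ≤ u x + v y := by
  have hcl : IsClosed {y : R2 | ⟪x, y⟫ ≤ u x + v y} :=
    isClosed_le (by fun_prop) (continuous_const.add H.cv.continuous_of_univ)
  refine closure_minimal (fun y hy => ?_) hcl hy
  have := le_ciSup (H.bdd hy) x
  rw [← H.leg y hy] at this
  simp only [mem_ofPred_eq] at *; linarith

theorem fenchel' (H : HalfPair u v Ω₁ Ω₂) {x : R2} (hx : x ∈ Ω₁) (y : R2) :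
    ⟪x, y⟫ ≤ u x + v y := by
  have hx' := hx
  rw [← H.gv] at hx'
  obtain ⟨y', hy', hxy⟩ := hx'
  simp only at hxy
  by_cases hd : DifferentiableAt ℝ v y'
  · have hs := subgradAt_gradient_self H.cv hd y
    have h2 := H.fenchel x (subset_closure hy')
    rw [hxy, inner_sub_right] at hs
    linarith
  · have : x = 0 := by
      rw [← hxy]; simp [gradient, fderiv_zero_of_not_differentiableAt hd]
    rw [this]; simp [H.u0, H.v_nonneg y]

theorem eq_of_subgradAt (H : HalfPair u v Ω₁ Ω₂) {x y : R2} (hs : SubgradAt u x y)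
    (hy : y ∈ closure Ω₂) : u x + v y = ⟪x, y⟫ := by
  refine le_antisymm ?_ (H.fenchel x hy)
  obtain ⟨c, hc⟩ := H.i2
  have hmem : ∀ t ∈ Ioc (0 : ℝ) 1, y + t • (c - y) ∈ Ω₂ := fun t ht =>
    interior_subset (H.o2.add_smul_sub_mem_interior' hy hc ht)
  have hle : ∀ t ∈ Ioc (0 : ℝ) 1, v (y + t • (c - y)) ≤ (1 - t) * (⟪x, y⟫ - u x) + t * v c := by
    intro t ht
    rw [H.leg _ (hmem t ht)]
    apply ciSup_le
    intro z
    have h1 := hs z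
    have h2 := H.fenchel z (subset_closure (interior_subset hc))
    rw [inner_sub_right, real_inner_comm, real_inner_comm x] at h1
    rw [inner_add_right, inner_smul_right, inner_sub_right]
    have a1 : (1 - t) * ⟪z, y⟫ ≤ (1 - t) * (u z - u x + ⟪x, y⟫) :=
      mul_le_mul_of_nonneg_left (by linarith) (by linarith [ht.2])
    have a2 : t * ⟪z, c⟫ ≤ t * (u z + v c) := mul_le_mul_of_nonneg_left (by linarith) (by linarith [ht.1])
    nlinarith
  have hv := H.cv.continuous_of_univ
  have ht1 : Filter.Tendsto (fun t : ℝ => v (y + t • (c - y))) (nhdsWithin 0 (Ioi 0)) (nhds (v y)) := by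
    have : Continuous (fun t : ℝ => v (y + t • (c - y))) := by fun_prop
    simpa using (this.tendsto 0).mono_left nhdsWithin_le_nhds
  have ht2 : Filter.Tendsto (fun t : ℝ => (1 - t) * (⟪x, y⟫ - u x) + t * v c) (nhdsWithin 0 (Ioi 0))
      (nhds (⟪x, y⟫ - u x)) := by
    have : Continuous (fun t : ℝ => (1 - t) * (⟪x, y⟫ - u x) + t * v c) := by fun_prop
    simpa using (this.tendsto 0).mono_left nhdsWithin_le_nhds
  have := le_of_tendsto_of_tendsto ht1 ht2
    (Filter.mem_of_superset (Ioc_mem_nhdsGT one_pos) (fun t ht => hle t ht))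
  linarith

theorem exists_subgradAt_combo (H : HalfPair u v Ω₁ Ω₂) {x y0 c : R2} {ρ t : ℝ}
    (hs : SubgradAt u x y0) (hρ : 0 < ρ) (hb : closedBall c (2 * ρ) ⊆ Ω₂) (ht : 0 < t) (ht1 : t < 1)
    {w : R2} (hw : w ∈ closedBall c ρ) :
    ∃ z, SubgradAt u z ((1 - t) • y0 + t • w) := by
  obtain ⟨M, hM⟩ : ∃ M, ∀ y ∈ closedBall c (2 * ρ), v y ≤ M := by
    obtain ⟨y, -, hy⟩ := (isCompact_closedBall c (2 * ρ)).exists_isMaxOn ⟨c, by simp [hρ.le]⟩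
      H.cv.continuous_of_univ.continuousOn
    exact ⟨v y, fun z hz => hy hz⟩
  set y := (1 - t) • y0 + t • w with hy
  have hcoer : ∀ z : R2, t * ρ * ‖z‖ - (t * M + (1 - t) * (⟪x, y0⟫ - u x)) ≤ u z - ⟪z, y⟫ := by
    intro z
    have h1 := hs z
    rw [inner_sub_right, real_inner_comm, real_inner_comm x] at h1
    have h2 : ⟪z, w⟫ + ρ * ‖z‖ ≤ u z + M := by
      rcases eq_or_ne z 0 with rfl | hz
      · have := hM c (by simp [hρ.le]); simp [H.u0]; linarith [H.v_nonneg c]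
      have hz' : 0 < ‖z‖ := norm_pos_iff.2 hz
      have hm : w + (ρ / ‖z‖) • z ∈ closedBall c (2 * ρ) := by
        rw [mem_closedBall, dist_eq_norm] at *
        calc ‖w + (ρ / ‖z‖) • z - c‖ = ‖(w - c) + (ρ / ‖z‖) • z‖ := by congr 1; abel
          _ ≤ ‖w - c‖ + ‖(ρ / ‖z‖) • z‖ := norm_add_le _ _
          _ ≤ ρ + ρ := by
            gcongr
            rw [norm_smul, Real.norm_of_nonneg (by positivity)]
            field_simp; exact le_refl _
          _ = 2 * ρ := by ring
      have h3 := H.fenchel z (subset_closure (hb hm))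
      have h4 := hM _ hm
      rw [inner_add_right, inner_smul_right, real_inner_self_eq_norm_sq] at h3
      have : ρ / ‖z‖ * ‖z‖ ^ 2 = ρ * ‖z‖ := by field_simp
      linarith
    rw [hy, inner_add_right, inner_smul_right, inner_smul_right]
    have a1 : (1 - t) * ⟪z, y0⟫ ≤ (1 - t) * (u z - u x + ⟪x, y0⟫) :=
      mul_le_mul_of_nonneg_left (by linarith) (by linarith)
    have a2 := mul_le_mul_of_nonneg_left h2 ht.le
    nlinarith
  have hcont : Continuous (fun z : R2 => u z - ⟪z, y⟫) := by
    have := H.cu.continuous_of_univ; fun_prop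
  obtain ⟨z, hz⟩ := hcont.exists_forall_le (by
    refine Filter.tendsto_atTop_mono hcoer ?_
    exact Filter.tendsto_atTop_add_const_right _ _
      ((tendsto_norm_cocompact_atTop (E := R2)).const_mul_atTop (mul_pos ht hρ)))
  refine ⟨z, fun a => ?_⟩
  have := hz a
  rw [inner_sub_right, real_inner_comm, real_inner_comm z]
  linarith

theorem subgradAt_mem (H : HalfPair u v Ω₁ Ω₂) {x y0 : R2} (hs : SubgradAt u x y0) :
    y0 ∈ closure Ω₂ := by
  by_contra hy0
  obtain ⟨c, hc⟩ := H.i2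
  obtain ⟨ρ', hρ', hb'⟩ := Metric.isOpen_iff.1 isOpen_interior c hc
  obtain ⟨r, hr, hrb⟩ := Metric.isOpen_iff.1 isClosed_closure.isOpen_compl y0 hy0
  set ρ := ρ' / 4 with hρdef
  have hρ : 0 < ρ := by positivity
  have hb : closedBall c (2 * ρ) ⊆ Ω₂ := fun z hz => interior_subset (hb' (by
    rw [mem_closedBall] at hz; rw [mem_ball]; linarith))
  set R := ‖c - y0‖ + ρ + 1 with hR
  have hRpos : 0 < R := by positivity
  have hR1 : 1 ≤ R := by have := norm_nonneg (c - y0); linarith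
  obtain ⟨t, ht0, ht1, htR⟩ : ∃ t : ℝ, 0 < t ∧ t < 1 ∧ t * R < r := by
    refine ⟨min (1 / 2) (r / (2 * R)), by positivity, ?_, ?_⟩
    · exact (min_le_left _ _).trans_lt (by norm_num)
    · calc _ ≤ r / (2 * R) * R := by gcongr; exact min_le_right _ _
        _ = r / 2 := by field_simp
        _ < r := by linarith
  set g : R2 → R2 := fun w => (1 - t) • y0 + t • w with hg
  set E : Set R2 := {x | ¬ DifferentiableAt ℝ u x} ∪ (interior Ω₁)ᶜ with hE
  have hEm : MeasurableSet E :=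
    (measurableSet_of_differentiableAt ℝ u).compl.union isOpen_interior.measurableSet.compl
  have hE0 : volume (E ∩ Ω₁) = 0 := by
    have : E ∩ Ω₁ ⊆ {x | ¬ DifferentiableAt ℝ u x} ∪ frontier Ω₁ := by
      rintro z ⟨h1 | h1, h2⟩
      · exact Or.inl h1
      · exact Or.inr ⟨subset_closure h2, h1⟩
    exact measure_mono_null this (measure_union_null H.cu.measure_not_differentiableAt
      (H.o1.addHaar_frontier volume))
  have hsub : g '' closedBall c ρ ⊆ ⋃ x ∈ E, {p : R2 | SubgradAt u x p} := by
    rintro _ ⟨w, hw, rfl⟩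
    obtain ⟨z, hz⟩ := H.exists_subgradAt_combo hs hρ hb ht0 ht1 hw
    simp only [mem_iUnion, mem_ofPred_eq, exists_prop]
    refine ⟨z, ?_, hz⟩
    by_contra hzE
    simp only [hE, mem_union, mem_ofPred_eq, mem_compl_iff, not_or, not_not] at hzE
    have h1 := subgradAt_gradient hzE.1 hz
    have h2 : g w ∈ Ω₂ := by
      rw [← H.gu]; exact ⟨z, interior_subset hzE.2, h1.symm⟩
    have h3 : g w ∈ ball y0 r := by
      rw [mem_ball, dist_eq_norm]
      have : g w - y0 = t • ((w - c) + (c - y0)) := by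
        simp only [hg, sub_smul, one_smul, smul_add, smul_sub]; abel
      rw [this, norm_smul, Real.norm_of_nonneg ht0.le]
      rw [mem_closedBall, dist_eq_norm] at hw
      refine lt_of_le_of_lt ?_ htR
      gcongr
      linarith [norm_add_le (w - c) (c - y0)]
    exact hrb h3 (subset_closure h2)
  have hzero : volume (g '' closedBall c ρ) = 0 := by
    refine measure_mono_null hsub ?_
    rw [H.al E hEm, hE0]
  have himg : g '' closedBall c ρ = (fun z => (1 - t) • y0 + z) '' (t • closedBall c ρ) := by
    rw [← image_smul, image_image]
  rw [himg, image_add_left, measure_preimage_add, Measure.addHaar_smul] at hzero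
  have hb0 : volume (closedBall c ρ) ≠ 0 := (measure_closedBall_pos volume c hρ).ne'
  simp only [mul_eq_zero, hb0, or_false, ENNReal.ofReal_eq_zero] at hzero
  exact absurd hzero (not_le.2 (abs_pos.2 (pow_ne_zero _ ht0.ne')))

theorem exists_eq (H : HalfPair u v Ω₁ Ω₂) (x : R2) : ∃ y ∈ closure Ω₂, u x + v y = ⟪x, y⟫ := by
  obtain ⟨p, hp⟩ := exists_subgradAt H.cu x
  exact ⟨p, H.subgradAt_mem hp, H.eq_of_subgradAt hp (H.subgradAt_mem hp)⟩

theorem leg' (H : HalfPair u v Ω₁ Ω₂) (x : R2) (hx : x ∈ Ω₁) : u x = ⨆ y : R2, (⟪y, x⟫ - v y) := by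
  obtain ⟨y, hy, he⟩ := H.exists_eq x
  have hle : ∀ y : R2, ⟪y, x⟫ - v y ≤ u x := fun y => by
    have := H.fenchel' hx y; rw [real_inner_comm] at this; linarith
  apply le_antisymm
  · refine le_trans ?_ (le_ciSup ⟨u x, by rintro _ ⟨y, rfl⟩; exact hle y⟩ y)
    rw [real_inner_comm] at he; linarith
  · exact ciSup_le hle

theorem swap (H : HalfPair u v Ω₁ Ω₂) (hv : AlexandrovSol v Ω₂) : HalfPair v u Ω₂ Ω₁ :=
  ⟨H.cv, H.cu, H.o2, H.o1, H.i2, H.i1, H.z2, H.z1, H.gv, H.gu, hv, H.v0, H.sv, H.u0, H.su, H.leg'⟩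

end HalfPair

abbrev Pl : Type := ℝ × ℝ

/-- The Euclidean dot product on `ℝ × ℝ`. -/
def dot (x y : Pl) : ℝ := x.1 * y.1 + x.2 * y.2

/-- The subdifferential of `w` at `x` with respect to the pairing `dt`. -/
def subdiff {E : Type*} [AddCommGroup E] (dt : E → E → ℝ) (w : E → ℝ) (x : E) : Set E :=
  {p | ∀ y, w x + dt p (y - x) ≤ w y}

/-- A pair of Legendre dual Alexandrov solutions, with respect to the pairing `dt`. -/
structure Core {E : Type*} [NormedAddCommGroup E] [NormedSpace ℝ E] [MeasureSpace E]
    (dt : E → E → ℝ) (u v : E → ℝ) (Ω₁ Ω₂ : Set E) : Prop where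
  cu : ConvexOn ℝ univ u
  cv : ConvexOn ℝ univ v
  un : ∀ x, 0 ≤ u x
  vn : ∀ x, 0 ≤ v x
  u0 : u 0 = 0
  v0 : v 0 = 0
  o1 : Convex ℝ Ω₁
  o2 : Convex ℝ Ω₂
  i1 : (interior Ω₁).Nonempty
  i2 : (interior Ω₂).Nonempty
  z1 : (0 : E) ∈ closure Ω₁
  z2 : (0 : E) ∈ closure Ω₂
  n1 : (0 : E) ∉ interior Ω₁
  n2 : (0 : E) ∉ interior Ω₂
  fenA : ∀ x, ∀ y ∈ closure Ω₂, dt x y ≤ u x + v y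
  fenB : ∀ x ∈ closure Ω₁, ∀ y, dt x y ≤ u x + v y
  subA : ∀ x, ∃ y ∈ closure Ω₂, u x + v y = dt x y
  subB : ∀ y, ∃ x ∈ closure Ω₁, u x + v y = dt x y
  alA : ∀ G : Set E, IsOpen G → volume (⋃ x ∈ G, subdiff dt u x) = volume (G ∩ Ω₁)
  alB : ∀ G : Set E, IsOpen G → volume (⋃ x ∈ G, subdiff dt v x) = volume (G ∩ Ω₂)

theorem HalfPair.toCore {u v : R2 → ℝ} {Ω₁ Ω₂ : Set R2} (H : HalfPair u v Ω₁ Ω₂)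
    (hv : AlexandrovSol v Ω₂) (h1 : (0 : R2) ∉ interior Ω₁) (h2 : (0 : R2) ∉ interior Ω₂) :
    Core (fun x y : R2 => ⟪x, y⟫) u v Ω₁ Ω₂ where
  cu := H.cu
  cv := H.cv
  un := H.u_nonneg
  vn := H.v_nonneg
  u0 := H.u0
  v0 := H.v0
  o1 := H.o1
  o2 := H.o2
  i1 := H.i1
  i2 := H.i2
  z1 := H.z1
  z2 := H.z2
  n1 := h1
  n2 := h2
  fenA := fun x y hy => H.fenchel x hy
  fenB := fun x hx y => by
    have := (H.swap hv).fenchel y hx; rw [real_inner_comm] at this; linarith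
  subA := H.exists_eq
  subB := fun y => by
    obtain ⟨x, hx, he⟩ := (H.swap hv).exists_eq y
    exact ⟨x, hx, by rw [real_inner_comm] at he; linarith⟩
  alA := fun G hG => H.al G hG.measurableSet
  alB := fun G hG => hv G hG.measurableSet

namespace Core
variable {E : Type*} [NormedAddCommGroup E] [NormedSpace ℝ E] [MeasureSpace E]
variable {dt : E → E → ℝ} {u v : E → ℝ} {Ω₁ Ω₂ : Set E}

theorem swap (H : Core dt u v Ω₁ Ω₂) (hs : ∀ x y, dt x y = dt y x) : Core dt v u Ω₂ Ω₁ where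
  cu := H.cv
  cv := H.cu
  un := H.vn
  vn := H.un
  u0 := H.v0
  v0 := H.u0
  o1 := H.o2
  o2 := H.o1
  i1 := H.i2
  i2 := H.i1
  z1 := H.z2
  z2 := H.z1
  n1 := H.n2
  n2 := H.n1
  fenA := fun x y hy => by rw [hs, add_comm]; exact H.fenB y hy x
  fenB := fun x hx y => by rw [hs, add_comm]; exact H.fenA y x hx
  subA := fun x => by simp_rw [hs x, add_comm (v x)]; exact H.subB x
  subB := fun x => by simp_rw [fun z => hs z x, fun z => add_comm (v z)]; exact H.subA x
  alA := H.alB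
  alB := H.alA

theorem alexandrov_pullback {F : Type*} [NormedAddCommGroup F] [NormedSpace ℝ F] [MeasureSpace F]
    {dF : F → F → ℝ} {w : E → ℝ} {Ω : Set E} {T T' : F ≃L[ℝ] E} {t : ℝ} (ht : 0 < t)
    (hd : ∀ X Y, dt (T' Y) (T X) = t * dF Y X)
    (hT : ∀ s, volume (T '' s) = ENNReal.ofReal t * volume s)
    (hT' : ∀ s, volume (T' '' s) = ENNReal.ofReal t * volume s)
    (al : ∀ G : Set E, IsOpen G → volume (⋃ x ∈ G, subdiff dt w x) = volume (G ∩ Ω))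
    (G : Set F) (hG : IsOpen G) :
    volume (⋃ x ∈ G, subdiff dF (fun X => w (T X) / t) x) = volume (G ∩ T ⁻¹' Ω) := by
  have h1 : T' '' (⋃ x ∈ G, subdiff dF (fun X => w (T X) / t) x) =
      ⋃ x ∈ T '' G, subdiff dt w x := by
    ext p
    obtain ⟨q, rfl⟩ := T'.surjective p
    rw [T'.injective.mem_set_image]
    simp only [mem_iUnion, exists_prop, mem_image, exists_exists_and_eq_and]
    refine exists_congr fun X => and_congr_right fun _ => ?_
    simp only [subdiff, mem_ofPred_eq]
    rw [T.surjective.forall (p := fun y => w (T X) + dt (T' q) (y - T X) ≤ w y)]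
    refine forall_congr' fun Y => ?_
    rw [← map_sub, hd]
    rw [div_add' _ _ _ ht.ne', div_le_div_iff_of_pos_right ht, mul_comm]
  have h2 : T '' (G ∩ T ⁻¹' Ω) = T '' G ∩ Ω := by rw [image_inter_preimage]
  have h3 := al (T '' G) (T.toHomeomorph.isOpenMap G hG)
  rw [← h1, ← h2, hT, hT'] at h3
  exact (ENNReal.mul_right_inj (by simpa using ht) ENNReal.ofReal_ne_top).1 h3

theorem pullback {F : Type*} [NormedAddCommGroup F] [NormedSpace ℝ F] [MeasureSpace F]
    {dF : F → F → ℝ} (H : Core dt u v Ω₁ Ω₂) {T T' : F ≃L[ℝ] E} {t : ℝ} (ht : 0 < t)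
    (hs : ∀ x y, dt x y = dt y x) (hsF : ∀ x y, dF x y = dF y x)
    (hd : ∀ X Y, dt (T X) (T' Y) = t * dF X Y)
    (hT : ∀ s, volume (T '' s) = ENNReal.ofReal t * volume s)
    (hT' : ∀ s, volume (T' '' s) = ENNReal.ofReal t * volume s) :
    Core dF (fun X => u (T X) / t) (fun Y => v (T' Y) / t) (T ⁻¹' Ω₁) (T' ⁻¹' Ω₂) where
  cu := by
    have := (H.cu.comp_linearMap (T : F →ₗ[ℝ] E)).smul (inv_pos.2 ht).le
    simpa [Function.comp_def, div_eq_inv_mul] using this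
  cv := by
    have := (H.cv.comp_linearMap (T' : F →ₗ[ℝ] E)).smul (inv_pos.2 ht).le
    simpa [Function.comp_def, div_eq_inv_mul] using this
  un := fun x => div_nonneg (H.un _) ht.le
  vn := fun x => div_nonneg (H.vn _) ht.le
  u0 := by simp [H.u0]
  v0 := by simp [H.v0]
  o1 := H.o1.is_linear_preimage (T : F →ₗ[ℝ] E).isLinear
  o2 := H.o2.is_linear_preimage (T' : F →ₗ[ℝ] E).isLinear
  i1 := by
    rw [← T.coe_toHomeomorph, ← T.toHomeomorph.preimage_interior]
    exact H.i1.preimage T.surjective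
  i2 := by
    rw [← T'.coe_toHomeomorph, ← T'.toHomeomorph.preimage_interior]
    exact H.i2.preimage T'.surjective
  z1 := by
    rw [← T.coe_toHomeomorph, ← T.toHomeomorph.preimage_closure]; simpa using H.z1
  z2 := by
    rw [← T'.coe_toHomeomorph, ← T'.toHomeomorph.preimage_closure]; simpa using H.z2
  n1 := by
    rw [← T.coe_toHomeomorph, ← T.toHomeomorph.preimage_interior]; simpa using H.n1
  n2 := by
    rw [← T'.coe_toHomeomorph, ← T'.toHomeomorph.preimage_interior]; simpa using H.n2
  fenA := fun x y hy => by
    rw [← T'.coe_toHomeomorph, ← T'.toHomeomorph.preimage_closure] at hy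
    have := H.fenA (T x) (T' y) hy
    rw [hd] at this
    rw [← add_div, le_div_iff₀ ht]; linarith
  fenB := fun x hx y => by
    rw [← T.coe_toHomeomorph, ← T.toHomeomorph.preimage_closure] at hx
    have := H.fenB (T x) hx (T' y)
    rw [hd] at this
    rw [← add_div, le_div_iff₀ ht]; linarith
  subA := fun x => by
    obtain ⟨y, hy, he⟩ := H.subA (T x)
    obtain ⟨y, rfl⟩ := T'.surjective y
    refine ⟨y, ?_, ?_⟩
    · rw [← T'.coe_toHomeomorph, ← T'.toHomeomorph.preimage_closure]; exact hy
    · rw [hd] at he; rw [← add_div, div_eq_iff ht.ne']; linarith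
  subB := fun y => by
    obtain ⟨x, hx, he⟩ := H.subB (T' y)
    obtain ⟨x, rfl⟩ := T.surjective x
    refine ⟨x, ?_, ?_⟩
    · rw [← T.coe_toHomeomorph, ← T.toHomeomorph.preimage_closure]; exact hx
    · rw [hd] at he; rw [← add_div, div_eq_iff ht.ne']; linarith
  alA := alexandrov_pullback ht (fun X Y => by rw [hs, hd, hsF]) hT hT' H.alA
  alB := alexandrov_pullback ht (fun X Y => hd Y X) hT' hT H.alB

end Core

/-- The linear automorphism of the plane with matrix `!![a, b; c, d]`. -/
def matEquiv (a b c d : ℝ) (h : a * d - b * c ≠ 0) : Pl ≃L[ℝ] Pl :=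
  LinearEquiv.toContinuousLinearEquiv
  { toFun := fun x => (a * x.1 + b * x.2, c * x.1 + d * x.2)
    map_add' := fun x y => by ext <;> simp <;> ring
    map_smul' := fun r x => by ext <;> simp <;> ring
    invFun := fun x => ((d * x.1 - b * x.2) / (a * d - b * c), (a * x.2 - c * x.1) / (a * d - b * c))
    left_inv := fun x => by
      ext <;> simp only [] <;> rw [div_eq_iff h] <;> ring
    right_inv := fun x => by
      ext <;> simp only [mul_div_assoc', ← add_div] <;> rw [div_eq_iff h] <;> ring }

@[simp] theorem matEquiv_apply {a b c d : ℝ} (h : a * d - b * c ≠ 0) (x : Pl) :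
    matEquiv a b c d h x = (a * x.1 + b * x.2, c * x.1 + d * x.2) := rfl

theorem volume_matEquiv_image {a b c d : ℝ} (h : a * d - b * c ≠ 0) (s : Set Pl) :
    volume (matEquiv a b c d h '' s) = ENNReal.ofReal |a * d - b * c| * volume s := by
  have h1 := Measure.addHaar_image_linearMap (volume : Measure Pl)
    (Matrix.toLin (Module.Basis.finTwoProd ℝ) (Module.Basis.finTwoProd ℝ) !![a, b; c, d]) s
  rw [LinearMap.det_toLin, Matrix.det_fin_two_of] at h1
  rw [← h1]
  congr 1
  apply image_congr
  intro x _
  rw [Matrix.toLin_finTwoProd_apply]; rfl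

/-- The coordinate identification of `ℝ × ℝ` with the Euclidean plane. -/
def toR2 : Pl ≃L[ℝ] R2 :=
  (ContinuousLinearEquiv.finTwoArrow ℝ ℝ).symm.trans (EuclideanSpace.equiv (Fin 2) ℝ).symm

theorem toR2_apply (x : Pl) : toR2 x = !₂[x.1, x.2] := rfl

theorem volume_toR2_image (s : Set Pl) : volume (toR2 '' s) = volume s := by
  have h1 : MeasurePreserving (toR2 : Pl → R2) volume volume := by
    have ha := (volume_preserving_finTwoArrow ℝ).symm
    have hb := (EuclideanSpace.volume_preserving_symm_measurableEquiv_toLp (Fin 2)).symm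
    exact hb.comp ha
  have h2 : MeasurableEmbedding (toR2 : Pl → R2) := toR2.toHomeomorph.measurableEmbedding
  rw [← h1.measure_preimage_emb h2, preimage_image_eq _ toR2.injective]

/-- The linear map `X ↦ X₁ p + X₂ q`. -/
def frame (p q : R2) (h : p 0 * q 1 - q 0 * p 1 ≠ 0) : Pl ≃L[ℝ] R2 :=
  (matEquiv (p 0) (q 0) (p 1) (q 1) h).trans toR2

theorem frame_apply {p q : R2} (h : p 0 * q 1 - q 0 * p 1 ≠ 0) (X : Pl) :
    frame p q h X = X.1 • p + X.2 • q := by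
  simp only [frame, ContinuousLinearEquiv.trans_apply, matEquiv_apply, toR2_apply]
  ext i
  fin_cases i <;> simp <;> ring

theorem volume_frame_image {p q : R2} (h : p 0 * q 1 - q 0 * p 1 ≠ 0) (s : Set Pl) :
    volume (frame p q h '' s) = ENNReal.ofReal |p 0 * q 1 - q 0 * p 1| * volume s := by
  have : frame p q h '' s = toR2 '' (matEquiv (p 0) (q 0) (p 1) (q 1) h '' s) := by
    rw [image_image]; rfl
  rw [this, volume_toR2_image, volume_matEquiv_image]

theorem dot_comm (x y : Pl) : dot x y = dot y x := by simp [dot]; ring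

/-- A convex body with centroid `0`: a linear functional bounded below by `-k` is at most `7 k`. -/
theorem inner_le_of_centroid {S : Set R2} (hS : Convex ℝ S) (ho : IsOpen S)
    (hb : Bornology.IsBounded S) (hc : (∫ x in S, x) = 0) {q : R2} {k : ℝ}
    (hk : ∀ x ∈ S, -k ≤ ⟪q, x⟫) {z : R2} (hz : z ∈ S) : ⟪q, z⟫ ≤ 7 * k := by
  have hSm := ho.measurableSet
  have hfin : volume S ≠ ⊤ := hb.measure_lt_top.ne
  have hpos : 0 < volume.real S :=
    ENNReal.toReal_pos (ho.measure_pos volume ⟨z, hz⟩).ne' hfin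
  have hid : IntegrableOn (fun x : R2 => x) S :=
    (continuous_id.continuousOn.integrableOn_compact hb.isCompact_closure).mono_set subset_closure
  have hl : IntegrableOn (fun x : R2 => ⟪q, x⟫) S :=
    ((by fun_prop : Continuous fun x : R2 => ⟪q, x⟫).continuousOn.integrableOn_compact
      hb.isCompact_closure).mono_set subset_closure
  have hconst : IntegrableOn (fun _ : R2 => k) S := integrableOn_const hfin
  have hSint : ∫ x in S, (⟪q, x⟫ + k) = k * volume.real S := by
    rw [integral_add hl hconst]
    have : ∫ x in S, ⟪q, x⟫ = ⟪q, ∫ x in S, x⟫ := integral_inner hid q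
    rw [this, hc, inner_zero_right, setIntegral_const, smul_eq_mul]; ring
  set S' := (fun x : R2 => (1 / 2 : ℝ) • z + x) '' ((1 / 2 : ℝ) • S) with hS'
  have hvol : volume.real S' = volume.real S / 4 := by
    simp only [Measure.real, hS', image_add_left, measure_preimage_add, Measure.addHaar_smul]
    rw [ENNReal.toReal_mul, ENNReal.toReal_ofReal (by positivity)]
    norm_num
    ring
  have hsub : S' ⊆ S := by
    rintro _ ⟨_, ⟨x, hx, rfl⟩, rfl⟩
    exact hS hz hx (by norm_num) (by norm_num) (by norm_num)
  have hS'm : MeasurableSet S' := by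
    rw [hS', image_add_left]
    exact (measurable_const_add _) (hSm.const_smul₀ _)
  have h1 : ∫ x in S', (⟪q, x⟫ + k) ≤ ∫ x in S, (⟪q, x⟫ + k) :=
    setIntegral_mono_set (hl.add hconst)
      ((ae_restrict_iff' hSm).2 (Filter.Eventually.of_forall fun x hx => by
        have := hk x hx; simp only [Pi.zero_apply]; linarith))
      hsub.eventuallyLE
  have h2 : (⟪q, z⟫ + k) / 2 * volume.real S' ≤ ∫ x in S', (⟪q, x⟫ + k) := by
    have : ∫ _ in S', (⟪q, z⟫ + k) / 2 = (⟪q, z⟫ + k) / 2 * volume.real S' := by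
      rw [setIntegral_const, smul_eq_mul]; ring
    rw [← this]
    refine setIntegral_mono_on (integrableOn_const ((measure_mono hsub).trans_lt hb.measure_lt_top).ne)
      ((hl.add hconst).mono_set hsub) hS'm ?_
    rintro _ ⟨_, ⟨x, hx, rfl⟩, rfl⟩
    have := hk x hx
    simp only [inner_add_right, inner_smul_right]
    linarith
  rw [hvol] at h2
  rw [hSint] at h1
  have h3 : ((⟪q, z⟫ + k) / 8) * volume.real S ≤ k * volume.real S := by linarith
  have := le_of_mul_le_mul_right h3 hpos
  linarith

/-- The `ℓ¹`-type gauge adapted to the axes of an ellipse. -/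
def gauge2 (e f : R2) (A B : ℝ) (x : R2) : ℝ := |⟪x, e⟫| / A + |⟪x, f⟫| / B

/-- The size information carried by a centred section of height `h` comparable to an ellipse. -/
structure HalfSec (δ h : ℝ) (u : R2 → ℝ) (Ω : Set R2) (e f : R2) (A B : ℝ) : Prop where
  e1 : ∀ x, gauge2 e f A B x ≤ δ / 4 → u x ≤ 8 * h
  e2 : ∃ c, gauge2 e f A B c ≤ 2 / δ ∧
    ∀ z, gauge2 e f A B z ≤ 1 → c + δ • z ∈ Ω ∧ u (c + δ • z) ≤ 8 * h

theorem abs_le_of_mem_ellipse {e f x : R2} {A B : ℝ} (hA : 0 < A) (hB : 0 < B)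
    (hx : x ∈ ellipse e f A B) : |⟪x, e⟫| ≤ A ∧ |⟪x, f⟫| ≤ B := by
  have hx : (⟪x, e⟫ / A) ^ 2 + (⟪x, f⟫ / B) ^ 2 ≤ 1 := hx
  have h1 : |⟪x, e⟫ / A| ≤ 1 := abs_le_one_iff_mul_self_le_one.2 (by nlinarith [sq_nonneg (⟪x, f⟫ / B)])
  have h2 : |⟪x, f⟫ / B| ≤ 1 := abs_le_one_iff_mul_self_le_one.2 (by nlinarith [sq_nonneg (⟪x, e⟫ / A)])
  rw [abs_div, abs_of_pos hA, div_le_one hA] at h1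
  rw [abs_div, abs_of_pos hB, div_le_one hB] at h2
  exact ⟨h1, h2⟩

theorem mem_ellipse_of_gauge2 {e f x : R2} {A B : ℝ} (hA : 0 < A) (hB : 0 < B)
    (hx : gauge2 e f A B x ≤ 1) : x ∈ ellipse e f A B := by
  change (⟪x, e⟫ / A) ^ 2 + (⟪x, f⟫ / B) ^ 2 ≤ 1
  unfold gauge2 at hx
  rw [← sq_abs (⟪x, e⟫ / A), ← sq_abs (⟪x, f⟫ / B), abs_div, abs_div, abs_of_pos hA, abs_of_pos hB]
  have h1 : 0 ≤ |⟪x, e⟫| / A := by positivity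
  have h2 : 0 ≤ |⟪x, f⟫| / B := by positivity
  nlinarith

theorem gauge2_smul {e f : R2} {A B : ℝ} (t : ℝ) (x : R2) :
    gauge2 e f A B (t • x) = |t| * gauge2 e f A B x := by
  simp only [gauge2, inner_smul_left, RCLike.conj_to_real, abs_mul]; ring

theorem HalfSec.of_centred {δ h : ℝ} {u : R2 → ℝ} {Ω S : Set R2} {e f : R2} {A B : ℝ}
    (hδ : 0 < δ) (hA : 0 < A) (hB : 0 < B) (hu : ConvexOn ℝ univ u)
    (hn : ∀ x, 0 ≤ u x) (u0 : u 0 = 0) (hc : IsCentredSection u 0 h S)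
    (hin : ∃ c : R2, (fun z => c + δ • z) '' ellipse e f A B ⊆ Ω ∩ S)
    (hout : S ⊆ (fun z => δ⁻¹ • z) '' ellipse e f A B) (hbd : Bornology.IsBounded S) :
    HalfSec δ h u Ω e f A B := by
  obtain ⟨p, hS, hcent⟩ := hc
  simp only [sub_zero, u0, zero_add] at hS hcent
  have hcu := hu.continuous_of_univ
  have ho : IsOpen S := by rw [hS]; exact isOpen_lt hcu (by fun_prop)
  have hconv : Convex ℝ S := by
    have h2 : ConvexOn ℝ univ (fun x => u x + (-(innerSL ℝ p)) x) :=
      hu.add ((-(innerSL ℝ p)).toLinearMap.convexOn convex_univ)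
    have : S = {x ∈ univ | u x + (-(innerSL ℝ p)) x < h} := by
      rw [hS]; ext x
      have : (-(innerSL ℝ p)) x = -⟪p, x⟫ := by rw [neg_apply, innerSL_apply_apply]
      simp only [mem_ofPred_eq, this, mem_univ, true_and]
      constructor <;> intro <;> linarith
    rw [this]; exact h2.convex_lt h
  have hu8 : ∀ x ∈ S, u x ≤ 8 * h := by
    intro x hx
    have h1 : ⟪p, x⟫ ≤ 7 * h := inner_le_of_centroid hconv ho hbd hcent (fun y hy => by
      rw [hS] at hy; have h3 : u y < ⟪p, y⟫ + h := hy; linarith [hn y]) hx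
    rw [hS] at hx; have h3 : u x < ⟪p, x⟫ + h := hx
    linarith
  have hneg : ∀ z ∈ S, (-(1 / 7 : ℝ)) • z ∈ closure S := by
    intro z hz
    by_contra hcon
    obtain ⟨g, s, hg1, hg2⟩ := geometric_hahn_banach_point_closed hconv.closure isClosed_closure hcon
    set q := (InnerProductSpace.toDual ℝ R2).symm g with hq
    have hgq : ∀ x, g x = ⟪q, x⟫ := fun x => by rw [hq, InnerProductSpace.toDual_symm_apply]
    have := inner_le_of_centroid hconv ho hbd hcent (q := q) (k := -s) (fun y hy => by
      have := hg2 y (subset_closure hy); rw [hgq] at this; linarith) hz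
    rw [hgq, inner_smul_right] at hg1
    linarith
  obtain ⟨c, hc⟩ := hin
  have hcS : ∀ z ∈ ellipse e f A B, c + δ • z ∈ Ω ∩ S := fun z hz => hc ⟨z, hz, rfl⟩
  have hsymm : ∀ z ∈ ellipse e f A B, -z ∈ ellipse e f A B := fun z hz => by
    have hz' : (⟪z, e⟫ / A) ^ 2 + (⟪z, f⟫ / B) ^ 2 ≤ 1 := hz
    change (⟪-z, e⟫ / A) ^ 2 + (⟪-z, f⟫ / B) ^ 2 ≤ 1
    simpa [inner_neg_left, neg_div] using hz'
  refine ⟨fun x hx => ?_, c, ?_, fun z hz => ?_⟩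
  · have hz : (4 / δ) • x ∈ ellipse e f A B := by
      apply mem_ellipse_of_gauge2 hA hB
      rw [gauge2_smul, abs_of_pos (by positivity)]
      calc 4 / δ * gauge2 e f A B x ≤ 4 / δ * (δ / 4) := by gcongr
        _ = 1 := by field_simp
    have h1 := (hcS _ hz).2
    have h2 := hneg _ (hcS _ (hsymm _ hz)).2
    have h3 : x ∈ closure S := by
      have := hconv.closure (subset_closure h1) h2 (a := 1 / 8) (b := 7 / 8)
        (by norm_num) (by norm_num) (by norm_num)
      convert this using 1
      simp only [smul_add, smul_neg, smul_smul]
      match_scalars <;> field_simp <;> norm_num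
    exact closure_minimal hu8 (isClosed_le hcu continuous_const) h3
  · have h0 : (0 : R2) ∈ ellipse e f A B := by
      change (⟪(0 : R2), e⟫ / A) ^ 2 + (⟪(0 : R2), f⟫ / B) ^ 2 ≤ 1; simp
    obtain ⟨z, hz, hzc⟩ := hout (hcS 0 h0).2
    simp only [smul_zero, add_zero] at hzc
    obtain ⟨a1, a2⟩ := abs_le_of_mem_ellipse hA hB hz
    rw [← hzc, gauge2_smul, abs_of_pos (by positivity)]
    have : gauge2 e f A B z ≤ 2 := by
      unfold gauge2
      have := (div_le_one hA).2 a1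
      have := (div_le_one hB).2 a2
      linarith
    calc δ⁻¹ * gauge2 e f A B z ≤ δ⁻¹ * 2 := by gcongr
      _ = 2 / δ := by ring
  · have := hcS z (mem_ellipse_of_gauge2 hA hB hz)
    exact ⟨this.1, hu8 _ this.2⟩

/-- The consequences of membership in the family that the argument uses. -/
structure Fam (δ : ℝ) (u v : R2 → ℝ) (Ω₁ Ω₂ : Set R2) (L l : ℝ → ℝ) (e f : ℝ → R2) : Prop where
  core : Core (fun x y : R2 => ⟪x, y⟫) u v Ω₁ Ω₂
  pos : 0 < δ
  le_one : δ ≤ 1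
  L1 : L 1 = 1
  l1 : l 1 = 1
  ne : ∀ h ∈ Ioc (0 : ℝ) 1, ‖e h‖ = 1
  nf : ∀ h ∈ Ioc (0 : ℝ) 1, ‖f h‖ = 1
  ef : ∀ h ∈ Ioc (0 : ℝ) 1, ⟪e h, f h⟫ = 0
  lpos : ∀ h ∈ Ioc (0 : ℝ) 1, 0 < l h
  lL : ∀ h ∈ Ioc (0 : ℝ) 1, l h ≤ L h
  Ll : ∀ h ∈ Ioc (0 : ℝ) 1, L h * l h = h
  s1 : ∀ h ∈ Ioc (0 : ℝ) 1, HalfSec δ h u Ω₁ (e h) (f h) (L h) (l h)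
  s2 : ∀ h ∈ Ioc (0 : ℝ) 1, HalfSec δ h v Ω₂ (f h) (e h) (L h) (l h)

/-- Expansion of the Euclidean norm in an orthonormal frame. -/
theorem frame_expansion {e f : R2} (he : ‖e‖ = 1) (hf : ‖f‖ = 1) (hef : ⟪e, f⟫ = 0) (x : R2) :
    x = ⟪x, e⟫ • e + ⟪x, f⟫ • f := by
  have ho : Orthonormal ℝ ![e, f] := by
    rw [orthonormal_iff_ite]
    intro i j
    fin_cases i <;> fin_cases j <;> simp [he, hf, hef, real_inner_comm]
  have hcard : Fintype.card (Fin 2) = Module.finrank ℝ R2 := by simp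
  let b := (basisOfOrthonormalOfCardEqFinrank ho hcard).toOrthonormalBasis (by simpa using ho)
  have := (b.sum_repr' x).symm
  simpa [b, Fin.sum_univ_two, real_inner_comm] using this

theorem isBounded_ellipse {e f : R2} {A B : ℝ} (hA : 0 < A) (hB : 0 < B) (he : ‖e‖ = 1)
    (hf : ‖f‖ = 1) (hef : ⟪e, f⟫ = 0) : Bornology.IsBounded (ellipse e f A B) := by
  rw [isBounded_iff_forall_norm_le]
  refine ⟨A + B, fun x hx => ?_⟩
  obtain ⟨h1, h2⟩ := abs_le_of_mem_ellipse hA hB hx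
  rw [frame_expansion he hf hef x]
  refine (norm_add_le _ _).trans ?_
  rw [norm_smul, norm_smul, he, hf, mul_one, mul_one]
  exact add_le_add h1 h2

theorem InSFamily.toFam {δ : ℝ} {u v : R2 → ℝ} {Ω₁ Ω₂ : Set R2} {L l : ℝ → ℝ} {e f : ℝ → R2}
    (hδ : 0 < δ) (H : InSFamily δ u v Ω₁ Ω₂ L l e f) : Fam δ u v Ω₁ Ω₂ L l e f := by
  obtain ⟨cu, cv, o1, o2, i1, i2, z1, z2, gu, gv, alu, u0, su, alv, v0, sv, leg, L1, l1, hh⟩ := H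
  have HP : HalfPair u v Ω₁ Ω₂ := ⟨cu, cv, o1, o2, i1, i2, z1.1, z2.1, gu, gv, alu, u0, su, v0, sv, leg⟩
  refine ⟨HP.toCore alv z1.2 z2.2, hδ, ?_, L1, l1, fun h hm => (hh h hm).1, fun h hm => (hh h hm).2.1,
    fun h hm => (hh h hm).2.2.1, fun h hm => (hh h hm).2.2.2.1, fun h hm => (hh h hm).2.2.2.2.1,
    fun h hm => (hh h hm).2.2.2.2.2.1, fun h hm => ?_, fun h hm => ?_⟩
  · obtain ⟨h1, h2, h3, h4, h5, h6, ⟨S, hS, ⟨c, hc⟩, hout⟩, -⟩ := hh 1 (by simp)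
    rw [L1, l1] at hc hout
    have key : ∀ s : ℝ, s ^ 2 = 1 → |⟪c, e 1⟫ + δ * s| ≤ δ⁻¹ := by
      intro s hs
      have hm : s • e 1 ∈ ellipse (e 1) (f 1) 1 1 := by
        change (⟪s • e 1, e 1⟫ / 1) ^ 2 + (⟪s • e 1, f 1⟫ / 1) ^ 2 ≤ 1
        simp [inner_smul_left, h1, h3, hs]
      obtain ⟨z, hz, he⟩ := hout (hc ⟨_, hm, rfl⟩).2
      have h7 := (abs_le_of_mem_ellipse one_pos one_pos hz).1
      have h8 : ⟪c, e 1⟫ + δ * s = δ⁻¹ * ⟪z, e 1⟫ := by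
        have := congrArg (fun x => ⟪x, e 1⟫) he
        simp [inner_smul_left, inner_add_left, h1] at this
        linarith
      rw [h8, abs_mul, abs_of_pos (by positivity)]
      calc δ⁻¹ * |⟪z, e 1⟫| ≤ δ⁻¹ * 1 := by gcongr
        _ = δ⁻¹ := by ring
    have k1 := (abs_le.1 (key 1 (by norm_num))).2
    have k2 := (abs_le.1 (key (-1) (by norm_num))).1
    have k3 : δ ≤ δ⁻¹ := by linarith
    have k4 : δ * δ ≤ 1 := by
      calc δ * δ ≤ δ * δ⁻¹ := by gcongr
        _ = 1 := by field_simp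
    nlinarith
  · obtain ⟨h1, h2, h3, h4, h5, h6, ⟨S, hS, hin, hout⟩, -⟩ := hh h hm
    have hL : 0 < L h := h4.trans_le h5
    exact HalfSec.of_centred hδ hL h4 cu HP.u_nonneg u0 hS hin hout
      (((isBounded_ellipse hL h4 h1 h2 h3).smul₀ δ⁻¹).subset (by rwa [← image_smul]))
  · obtain ⟨h1, h2, h3, h4, h5, h6, -, ⟨S, hS, hin, hout⟩⟩ := hh h hm
    have hL : 0 < L h := h4.trans_le h5
    exact HalfSec.of_centred hδ hL h4 cv HP.v_nonneg v0 hS hin hout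
      (((isBounded_ellipse hL h4 h2 h1 (by rw [real_inner_comm]; exact h3)).smul₀ δ⁻¹).subset
        (by rwa [← image_smul]))

namespace Fam
variable {δ : ℝ} {u v : R2 → ℝ} {Ω₁ Ω₂ : Set R2} {L l : ℝ → ℝ} {e f : ℝ → R2}

theorem Lpos (F : Fam δ u v Ω₁ Ω₂ L l e f) {h : ℝ} (hh : h ∈ Ioc (0 : ℝ) 1) : 0 < L h :=
  (F.lpos h hh).trans_le (F.lL h hh)

theorem swap (F : Fam δ u v Ω₁ Ω₂ L l e f) : Fam δ v u Ω₂ Ω₁ L l f e where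
  core := F.core.swap fun x y => real_inner_comm y x
  pos := F.pos
  le_one := F.le_one
  L1 := F.L1
  l1 := F.l1
  ne := F.nf
  nf := F.ne
  ef := fun h hh => by rw [real_inner_comm]; exact F.ef h hh
  lpos := F.lpos
  lL := F.lL
  Ll := F.Ll
  s1 := F.s2
  s2 := F.s1

theorem gauge2_nonneg (F : Fam δ u v Ω₁ Ω₂ L l e f) {h : ℝ} (hh : h ∈ Ioc (0 : ℝ) 1) (x : R2) :
    0 ≤ gauge2 (e h) (f h) (L h) (l h) x := by
  have := F.lpos h hh
  have := F.Lpos hh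
  unfold gauge2; positivity

theorem engulf_aux (F : Fam δ u v Ω₁ Ω₂ L l e f) {h h' : ℝ} (hh : h ∈ Ioc (0 : ℝ) 1)
    (hh' : h' ∈ Ioc (0 : ℝ) 1) {x w : R2} (hx : gauge2 (e h) (f h) (L h) (l h) x ≤ δ / 4)
    (hw : gauge2 (f h') (e h') (L h') (l h') w ≤ 1) : |⟪x, w⟫| ≤ 8 * (h + h') / δ := by
  obtain ⟨c, -, hc⟩ := (F.s2 h' hh').e2
  have hneg : ∀ (e f : R2) (A B : ℝ) (z : R2), gauge2 e f A B (-z) = gauge2 e f A B z := by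
    intro e f A B z; simp [gauge2, inner_neg_left]
  have key : ∀ z : R2, gauge2 (e h) (f h) (L h) (l h) z ≤ δ / 4 → ⟪z, w⟫ ≤ 8 * (h + h') / δ := by
    intro z hz
    have a1 := (F.s1 h hh).e1 z hz
    have a2 := (F.s1 h hh).e1 (-z) (by rwa [hneg])
    have b1 := hc w hw
    have b2 := hc (-w) (by rwa [hneg])
    have c1 := F.core.fenA z _ (subset_closure b1.1)
    have c2 := F.core.fenA (-z) _ (subset_closure b2.1)
    simp only [inner_add_right, inner_smul_right, inner_neg_left, inner_neg_right, smul_neg] at c1 c2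
    rw [le_div_iff₀ F.pos]
    linarith [b1.2, smul_neg δ w ▸ b2.2]
  rw [abs_le']
  refine ⟨key x hx, ?_⟩
  have := key (-x) (by rwa [hneg])
  rwa [inner_neg_left] at this

/-- Comparison of the gauges of two sections. -/
theorem engulf (F : Fam δ u v Ω₁ Ω₂ L l e f) {h h' : ℝ} (hh : h ∈ Ioc (0 : ℝ) 1)
    (hh' : h' ∈ Ioc (0 : ℝ) 1) (x : R2) :
    gauge2 (e h') (f h') (L h') (l h') x ≤
      64 / δ ^ 2 * (1 + h / h') * gauge2 (e h) (f h) (L h) (l h) x := by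
  have hδ := F.pos
  have hL := F.Lpos hh
  have hl := F.lpos h hh
  have hL' := F.Lpos hh'
  have hl' := F.lpos h' hh'
  have hLl' := F.Ll h' hh'
  have h0 := hh.1
  have h0' := hh'.1
  have main : ∀ z : R2, gauge2 (e h) (f h) (L h) (l h) z ≤ δ / 4 →
      gauge2 (e h') (f h') (L h') (l h') z ≤ 16 / δ * (1 + h / h') := by
    intro z hz
    have a1 := F.engulf_aux hh hh' hz (w := L h' • f h') (by
      simp [gauge2, inner_smul_left, F.nf h' hh', real_inner_comm, F.ef h' hh',
        abs_of_pos hL', hL'.ne'])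
    have a2 := F.engulf_aux hh hh' hz (w := l h' • e h') (by
      simp [gauge2, inner_smul_left, F.ne h' hh', F.ef h' hh',
        abs_of_pos hl', hl'.ne'])
    rw [inner_smul_right, abs_mul, abs_of_pos (by assumption)] at a1 a2
    have b1 : |⟪z, f h'⟫| / l h' ≤ 8 / δ * (1 + h / h') := by
      have : 8 / δ * (1 + h / h') = (8 * (h + h') / δ) / (L h' * l h') := by
        rw [hLl']; field_simp; ring
      rw [this, le_div_iff₀ (by positivity)]
      calc |⟪z, f h'⟫| / l h' * (L h' * l h') = L h' * |⟪z, f h'⟫| := by field_simp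
        _ ≤ _ := a1
    have b2 : |⟪z, e h'⟫| / L h' ≤ 8 / δ * (1 + h / h') := by
      have : 8 / δ * (1 + h / h') = (8 * (h + h') / δ) / (L h' * l h') := by
        rw [hLl']; field_simp; ring
      rw [this, le_div_iff₀ (by positivity)]
      calc |⟪z, e h'⟫| / L h' * (L h' * l h') = l h' * |⟪z, e h'⟫| := by field_simp
        _ ≤ _ := a2
    unfold gauge2
    calc _ ≤ 8 / δ * (1 + h / h') + 8 / δ * (1 + h / h') := add_le_add b2 b1
      _ = _ := by ring
  set g := gauge2 (e h) (f h) (L h) (l h) x with hg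
  have hg0 : 0 ≤ g := F.gauge2_nonneg hh x
  rcases hg0.eq_or_lt with h1 | h1
  · have a0 : 0 ≤ |⟪x, e h⟫| / L h := by positivity
    have b0 : 0 ≤ |⟪x, f h⟫| / l h := by positivity
    have hsum : |⟪x, e h⟫| / L h + |⟪x, f h⟫| / l h = 0 := by rw [hg] at h1; exact h1.symm
    have ha : |⟪x, e h⟫| / L h = 0 := by linarith
    have hb : |⟪x, f h⟫| / l h = 0 := by linarith
    have ha' : ⟪x, e h⟫ = 0 := by simpa [hL.ne'] using ha
    have hb' : ⟪x, f h⟫ = 0 := by simpa [hl.ne'] using hb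
    have hx0 : x = 0 := by
      rw [frame_expansion (F.ne h hh) (F.nf h hh) (F.ef h hh) x, ha', hb']; simp
    rw [← h1, hx0]; simp [gauge2]
  · have := main ((δ / 4 / g) • x) (by
      rw [gauge2_smul, abs_of_pos (by positivity), ← hg]; field_simp; exact le_refl _)
    rw [gauge2_smul, abs_of_pos (by positivity)] at this
    calc gauge2 (e h') (f h') (L h') (l h') x
        = (4 * g / δ) * (δ / 4 / g * gauge2 (e h') (f h') (L h') (l h') x) := by field_simp
      _ ≤ (4 * g / δ) * (16 / δ * (1 + h / h')) := by gcongr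
      _ = _ := by field_simp; ring

end Fam

open Filter
open scoped Topology

theorem second_order_necessary {f f' : ℝ → ℝ} {c : ℝ} (hf : ∀ᶠ τ in 𝓝 (0 : ℝ), HasDerivAt f (f' τ) τ)
    (hc : HasDerivAt f' c 0) (hmin : IsLocalMin f 0) : f' 0 = 0 ∧ 0 ≤ c := by
  have h0 : f' 0 = 0 := hmin.hasDerivAt_eq_zero hf.self_of_nhds
  refine ⟨h0, ?_⟩
  by_contra hneg
  push Not at hneg
  have hd : deriv f =ᶠ[𝓝 0] f' := hf.mono fun τ h => h.deriv
  have hdd : deriv (deriv f) 0 = c := by rw [hd.deriv_eq, hc.deriv]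
  have hmax := isLocalMax_of_deriv_deriv_neg (by rwa [hdd]) (by rw [hd.self_of_nhds, h0])
    hf.self_of_nhds.continuousAt
  have heq : f =ᶠ[𝓝 0] fun _ => f 0 := by
    filter_upwards [hmin, hmax] with τ h1 h2 using le_antisymm h2 h1
  have : deriv (deriv f) 0 = 0 := by
    rw [heq.deriv.deriv_eq]; simp
  linarith

/-- The barrier with Hessian determinant `1 / 2 - 4 k ^ 2 * z₁ ^ 2`. -/
def barrier (N k η s c : ℝ) (z : Pl) : ℝ :=
  N * z.2 + k * (z.2 + η) * z.1 ^ 2 +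
    1 / (4 * k) * ((z.2 + η) * (Real.log (z.2 + η) - c) - (z.2 + η)) + s

/-- The gradient of `barrier`. -/
def barrierGrad (N k η c : ℝ) (z : Pl) : Pl :=
  (2 * k * (z.2 + η) * z.1, N + k * z.1 ^ 2 + 1 / (4 * k) * (Real.log (z.2 + η) - c))

theorem barrier_critical {N k η s c : ℝ} (hk : 0 < k) {z y : Pl} (hz : 0 < z.2 + η)
    (hmin : IsLocalMin (fun x => barrier N k η s c x - dot y x) z) :
    y = barrierGrad N k η c z ∧ 0 ≤ 1 / 2 - 4 * k ^ 2 * z.1 ^ 2 := by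
  have key : ∀ d : Pl,
      N * d.2 + k * d.2 * z.1 ^ 2 + 2 * k * (z.2 + η) * z.1 * d.1
        + 1 / (4 * k) * (d.2 * (Real.log (z.2 + η) - c)) - dot y d = 0 ∧
      0 ≤ 4 * k * d.2 * d.1 * z.1 + 2 * k * (z.2 + η) * d.1 ^ 2 + 1 / (4 * k) * (d.2 ^ 2 / (z.2 + η)) := by
    intro d
    have hcont : Continuous fun τ : ℝ => z + τ • d := by fun_prop
    have hloc : IsLocalMin ((fun x => barrier N k η s c x - dot y x) ∘ fun τ : ℝ => z + τ • d) 0 := by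
      apply IsLocalMin.comp_continuous (b := (0 : ℝ))
      · simpa using hmin
      · exact hcont.continuousAt
    have hev : ∀ᶠ τ in 𝓝 (0 : ℝ), 0 < z.2 + τ * d.2 + η := by
      have : Continuous fun τ : ℝ => z.2 + τ * d.2 + η := by fun_prop
      exact this.continuousAt.eventually (lt_mem_nhds (by simpa using hz))
    have hlin : ∀ (a b τ : ℝ), HasDerivAt (fun τ : ℝ => a + τ * b) b τ := fun a b τ => by
      simpa using ((hasDerivAt_id τ).mul_const b).const_add a
    have h := second_order_necessary
      (f' := fun τ => N * d.2 + (k * d.2 * (z.1 + τ * d.1) ^ 2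
        + k * (z.2 + τ * d.2 + η) * (2 * (z.1 + τ * d.1) * d.1))
        + 1 / (4 * k) * (d.2 * (Real.log (z.2 + τ * d.2 + η) - c)) - dot y d)
      (c := 4 * k * d.2 * d.1 * z.1 + 2 * k * (z.2 + η) * d.1 ^ 2 + 1 / (4 * k) * (d.2 ^ 2 / (z.2 + η)))
      (hev.mono fun τ hτ => ?_) ?_ hloc
    · simp only [zero_mul, add_zero] at h
      refine ⟨?_, h.2⟩
      rw [← h.1]; ring
    · have h2 := (hlin z.2 d.2 τ).add_const η
      have h1 := hlin z.1 d.1 τ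
      have hlog := h2.log hτ.ne'
      have t1 := (hlin z.2 d.2 τ).const_mul N
      have t2 := (h2.const_mul k).mul (h1.pow 2)
      have t3 := ((h2.mul (hlog.sub_const c)).sub h2).const_mul (1 / (4 * k))
      have t4 := hlin (dot y z) (dot y d) τ
      have := ((t1.add t2).add t3).add_const s |>.sub t4
      refine (this.congr_of_eventuallyEq (Eventually.of_forall fun τ => ?_)).congr_deriv ?_
      · simp [barrier, dot]; ring
      · have hne := hτ.ne'
        have hcancel : (z.2 + τ * d.2 + η) * (d.2 / (z.2 + τ * d.2 + η)) = d.2 := by field_simp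
        rw [hcancel]
        simp only [Pi.pow_apply]
        push_cast
        ring
    · have h2 := (hlin z.2 d.2 0).add_const η
      have h1 := hlin z.1 d.1 0
      have hlog := h2.log (by simpa using hz.ne')
      have t2 := ((h1.pow 2).const_mul (k * d.2))
      have t3 := (h2.const_mul k).mul ((h1.const_mul 2).mul_const d.1)
      have t4 := ((hlog.sub_const c).const_mul d.2).const_mul (1 / (4 * k))
      have := (((t2.add t3).const_add (N * d.2)).add t4).sub_const (dot y d)
      refine (this.congr_of_eventuallyEq (Eventually.of_forall fun τ => ?_)).congr_deriv ?_
      · simp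
      · simp; field_simp; ring
  constructor
  · have k1 := (key (1, 0)).1
    have k2 := (key (0, 1)).1
    simp [dot] at k1 k2
    ext
    · simp [barrierGrad]; linarith
    · simp only [barrierGrad]; field_simp at k2 ⊢; linarith
  · have k3 := (key (-(z.1 / (z.2 + η)), 1)).2
    have : 4 * k * (1 : ℝ) * -(z.1 / (z.2 + η)) * z.1 + 2 * k * (z.2 + η) * (-(z.1 / (z.2 + η))) ^ 2
        + 1 / (4 * k) * (1 ^ 2 / (z.2 + η)) = (1 / 2 - 4 * k ^ 2 * z.1 ^ 2) / (2 * k * (z.2 + η)) := by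
      field_simp; ring
    rw [this] at k3
    by_contra hcon
    push Not at hcon
    exact absurd k3 (not_le.2 (div_neg_of_neg_of_pos hcon (by positivity)))

theorem barrierGrad_hasFDerivAt {N k η c : ℝ} {z : Pl} (hz : 0 < z.2 + η) :
    ∃ D : Pl →L[ℝ] Pl, HasFDerivAt (barrierGrad N k η c) D z ∧
      (k ≠ 0 → D.det = 1 / 2 - 4 * k ^ 2 * z.1 ^ 2) := by
  have h1 : HasFDerivAt (fun z : Pl => z.1) (ContinuousLinearMap.fst ℝ ℝ ℝ) z := hasFDerivAt_fst
  have h2 : HasFDerivAt (fun z : Pl => z.2 + η) (ContinuousLinearMap.snd ℝ ℝ ℝ) z :=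
    hasFDerivAt_snd.add_const η
  have hlog := h2.log hz.ne'
  have a := ((h2.const_mul (2 * k)).mul h1)
  have b := (((h1.pow 2).const_mul k).const_add N).add ((hlog.sub_const c).const_mul (1 / (4 * k)))
  refine ⟨_, a.prodMk b, fun hk => ?_⟩
  rw [ContinuousLinearMap.det, ← LinearMap.det_toMatrix (Module.Basis.finTwoProd ℝ),
    Matrix.det_fin_two]
  simp [LinearMap.toMatrix_apply]
  field_simp; ring

/-- A point of the plane lies in a convex set containing a triangle, with a bound on a convex
function there. -/
theorem triangle_bound {C δ ρ₀ σ : ℝ} (hC : 0 < C) (hδ : 0 < δ) (hρ : 0 < ρ₀) (hσ : 0 ≤ σ) {w : Pl → ℝ}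
    {Ω : Set Pl} (hw : ConvexOn ℝ univ w) (hΩ : Convex ℝ Ω) {i A : Pl}
    (hp : (i.1 + ρ₀, i.2) ∈ Ω) (hm : (i.1 - ρ₀, i.2) ∈ Ω) (wp : w (i.1 + ρ₀, i.2) ≤ σ)
    (wm : w (i.1 - ρ₀, i.2) ≤ σ) (hA : A ∈ Ω) (wA : w A ≤ C) (hA2 : δ ≤ A.2 - i.2)
    (hA1 : |A.1 - i.1| ≤ C) {z : Pl} (hz1 : |z.1| ≤ ρ₀ / 2) (hz2 : 0 ≤ z.2)
    (hz3 : z.2 ≤ δ * ρ₀ / (2 * (C + ρ₀))) :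
    i + z ∈ Ω ∧ w (i + z) ≤ σ + C / δ * z.2 := by
  set a := A.2 - i.2 with ha
  have ha0 : 0 < a := hδ.trans_le hA2
  set t := z.2 / a with ht
  have ht0 : 0 ≤ t := by positivity
  have htδ : t ≤ z.2 / δ := by rw [ht]; gcongr
  have ht1 : t * (C + ρ₀) ≤ ρ₀ / 2 := by
    calc t * (C + ρ₀) ≤ (δ * ρ₀ / (2 * (C + ρ₀))) / δ * (C + ρ₀) := by
          gcongr; exact htδ.trans (by gcongr)
      _ = ρ₀ / 2 := by field_simp
  have htC : t * |A.1 - i.1| ≤ t * C := by gcongr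
  have hthalf : t ≤ 1 / 2 := by nlinarith
  obtain ⟨z1a, z1b⟩ := abs_le.1 hz1
  obtain ⟨b1, b2⟩ := abs_le.1 hA1
  set r := z.1 - t * (A.1 - i.1) with hr
  have hr1 : |r| ≤ (1 - t) * ρ₀ := by
    rw [abs_le]; constructor <;> nlinarith
  obtain ⟨r1, r2⟩ := abs_le.1 hr1
  set α := (1 - t + r / ρ₀) / 2 with hα
  set β := (1 - t - r / ρ₀) / 2 with hβ
  have q1 : r / ρ₀ ≤ 1 - t := by rw [div_le_iff₀ hρ]; exact r2
  have q2 : -(1 - t) ≤ r / ρ₀ := by rw [le_div_iff₀ hρ]; linarith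
  have hα0 : 0 ≤ α := by rw [hα]; linarith
  have hβ0 : 0 ≤ β := by rw [hβ]; linarith
  have hsum : α + β + t = 1 := by rw [hα, hβ]; ring
  have hαρ : (α - β) * ρ₀ = r := by rw [hα, hβ]; field_simp; ring
  have hta : t * a = z.2 := by rw [ht]; field_simp
  have hcomb : i + z = α • (i.1 + ρ₀, i.2) + β • (i.1 - ρ₀, i.2) + t • A := by
    ext
    · simp only [Prod.fst_add, Prod.smul_fst, smul_eq_mul]
      linear_combination (-i.1) * hsum - hαρ - hr
    · simp only [Prod.snd_add, Prod.smul_snd, smul_eq_mul]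
      linear_combination (-i.2) * hsum - hta + t * ha
  have hΩ' : ∀ {s : Set Pl}, Convex ℝ s → ∀ {x y p : Pl}, x ∈ s → y ∈ s → p ∈ s →
      α • x + β • y + t • p ∈ s := by
    intro s hs x y p hx hy hp
    have := hs.sum_mem (t := Finset.univ) (w := ![α, β, t]) (z := ![x, y, p])
      (by intro j _; fin_cases j <;> simp [hα0, hβ0, ht0])
      (by simp [Fin.sum_univ_three, hsum]) (by intro j _; fin_cases j <;> simp [hx, hy, hp])
    simpa [Fin.sum_univ_three] using this
  refine ⟨by rw [hcomb]; exact hΩ' hΩ hp hm hA, ?_⟩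
  have := hw.map_sum_le (t := Finset.univ) (w := ![α, β, t])
      (p := ![(i.1 + ρ₀, i.2), (i.1 - ρ₀, i.2), A])
      (by intro j _; fin_cases j <;> simp [hα0, hβ0, ht0])
      (by simp [Fin.sum_univ_three, hsum]) (by simp)
  simp only [Fin.sum_univ_three] at this
  have h3 : w (i + z) ≤ α * w (i.1 + ρ₀, i.2) + β * w (i.1 - ρ₀, i.2) + t * w A := by
    rw [hcomb]; simpa using this
  have h4 : t * w A ≤ C / δ * z.2 := by
    calc t * w A ≤ t * C := by gcongr
      _ ≤ z.2 / δ * C := by gcongr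
      _ = _ := by ring
  have h5 : α * w (i.1 + ρ₀, i.2) ≤ α * σ := by gcongr
  have h6 : β * w (i.1 - ρ₀, i.2) ≤ β * σ := by gcongr
  nlinarith

theorem exists_barrier {ρ x₀ C : ℝ} (hρ : 0 < ρ) (hx : 0 < x₀) (hC : 0 < C) :
    ∃ N k η s c σ : ℝ, 0 < k ∧ 0 < η ∧ 0 < σ ∧
      (∀ z : Pl, z.2 = 0 → σ + C * z.2 ≤ barrier N k η s c z) ∧
      (∀ z : Pl, |z.1| = ρ → 0 ≤ z.2 → σ + C * z.2 ≤ barrier N k η s c z) ∧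
      (∀ z : Pl, z.2 = x₀ → σ + C * z.2 ≤ barrier N k η s c z) ∧
      η < x₀ ∧ barrier N k η s c (0, η) < 0 := by
  set N := C + 1 with hN
  set m := 4 * (N + 1) / ρ + 1 + ρ with hm
  have hm1 : 1 ≤ m := by
    have : 0 ≤ 4 * (N + 1) / ρ := by positivity
    linarith
  have hmρ : 4 * (N + 1) ≤ m * ρ := by
    have : 4 * (N + 1) = 4 * (N + 1) / ρ * ρ := by field_simp
    rw [hm]; nlinarith
  set k := m / ρ with hk
  have hkm : k * ρ = m := by rw [hk]; field_simp
  have hk1 : 1 ≤ k := by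
    rw [hk, le_div_iff₀ hρ]
    have : 0 ≤ 4 * (N + 1) / ρ := by positivity
    linarith
  have hexp : 2 < Real.exp (m ^ 2) := by
    have := Real.add_one_lt_exp (x := m ^ 2) (by positivity)
    nlinarith
  set η := x₀ / (Real.exp (m ^ 2) - 1) with hη
  have hη0 : 0 < η := div_pos hx (by linarith)
  have hηx : η < x₀ := by rw [hη, div_lt_iff₀ (by linarith)]; nlinarith
  have hZ : x₀ + η = η * Real.exp (m ^ 2) := by
    have : η * (Real.exp (m ^ 2) - 1) = x₀ := by rw [hη]; field_simp [show Real.exp (m ^ 2) - 1 ≠ 0 by linarith]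
    linarith
  set c := Real.log η + m ^ 2 with hc
  have hlogZ : Real.log (x₀ + η) = c := by
    rw [hZ, Real.log_mul hη0.ne' (Real.exp_pos _).ne', Real.log_exp]
  set s := η / 2 - 1 / (4 * k) * (η * (Real.log η - c) - η) with hs
  have hq : 0 < 1 / (4 * k) := by positivity
  have hq4 : 1 / (4 * k) ≤ 1 / 4 := by
    apply div_le_div_of_nonneg_left <;> linarith
  refine ⟨N, k, η, s, c, η / 2, by linarith, hη0, by positivity, ?_, ?_, ?_, hηx, ?_⟩
  · intro z hz
    simp only [barrier, hz, hs]
    have : 0 ≤ k * (0 + η) * z.1 ^ 2 := by positivity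
    simp only [zero_add] at this ⊢
    linarith
  · intro z hz1 hz2
    have hsq : z.1 ^ 2 = ρ ^ 2 := by rw [← sq_abs, hz1]
    have hz : 0 < z.2 + η := by linarith
    have hlog : (z.2 + η) * (Real.log η - Real.log (z.2 + η)) ≤ -z.2 := by
      rw [← Real.log_div hη0.ne' hz.ne']
      have := Real.log_le_sub_one_of_pos (div_pos hη0 hz)
      calc _ ≤ (z.2 + η) * (η / (z.2 + η) - 1) := by gcongr
        _ = -z.2 := by field_simp; ring
    have hF : -m ^ 2 * z.2 ≤ ((z.2 + η) * (Real.log (z.2 + η) - c) - (z.2 + η))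
        - (η * (Real.log η - c) - η) := by
      rw [hc]; nlinarith
    have hF' := mul_le_mul_of_nonneg_left hF hq.le
    have hkr : k * ρ ^ 2 = m * ρ := by rw [← hkm]; ring
    have hmk : 1 / (4 * k) * m ^ 2 = m * ρ / 4 := by
      rw [← hkm]; field_simp
    simp only [barrier, hsq, hs]
    have e1 : k * (z.2 + η) * ρ ^ 2 = m * ρ * z.2 + m * ρ * η := by rw [← hkm]; ring
    have e2 : 1 / (4 * k) * (-m ^ 2 * z.2) = -(m * ρ / 4 * z.2) := by rw [← hmk]; ring
    have e3 : 0 ≤ m * ρ * z.2 := by positivity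
    have e4 : 0 ≤ m * ρ * η := by positivity
    rw [e1]; rw [e2] at hF'
    nlinarith
  · intro z hz
    simp only [barrier, hz, hs, hlogZ]
    have : 0 ≤ k * (x₀ + η) * z.1 ^ 2 := by positivity
    have h1 : -x₀ ≤ ((x₀ + η) * (c - c) - (x₀ + η)) - (η * (Real.log η - c) - η) := by
      rw [hc]; nlinarith [mul_nonneg hη0.le (sq_nonneg m)]
    have h1' := mul_le_mul_of_nonneg_left h1 hq.le
    nlinarith
  · have h2 : Real.log (η + η) = Real.log 2 + Real.log η := by
      rw [← two_mul, Real.log_mul (by norm_num) hη0.ne']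
    have hl2 := Real.log_two_lt_d9
    have hmk : 1 / (4 * k) * m ^ 2 = m * ρ / 4 := by
      rw [← hkm]; field_simp
    simp only [barrier, hs, h2]
    have e : N * η + k * (η + η) * 0 ^ 2 + 1 / (4 * k) * ((η + η) * (Real.log 2 + Real.log η - c) - (η + η))
        + (η / 2 - 1 / (4 * k) * (η * (Real.log η - c) - η))
        = η * (N + 1 / (4 * k) * (2 * Real.log 2 - 1) - 1 / (4 * k) * m ^ 2 + 1 / 2) := by
      rw [hc]; ring
    rw [e, hmk]
    have : 1 / (4 * k) * (2 * Real.log 2 - 1) ≤ 1 / 4 * 1 := by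
      apply mul_le_mul hq4 (by linarith) _ (by norm_num)
      have := Real.log_two_gt_d9; linarith
    apply mul_neg_of_pos_of_neg hη0
    linarith

theorem continuousOn_barrier {N k η s c : ℝ} (hη : 0 < η) :
    ContinuousOn (barrier N k η s c) {z | 0 ≤ z.2} := by
  unfold barrier
  have h : ContinuousOn (fun z : Pl => Real.log (z.2 + η)) {z | 0 ≤ z.2} :=
    ContinuousOn.log (by fun_prop) fun z (hz : 0 ≤ z.2) => by positivity
  fun_prop

theorem volume_barrierGrad_image_le {N k η c : ℝ} (hk : 0 < k) {V : Set Pl} (hV : MeasurableSet V)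
    (hpos : ∀ z ∈ V, 0 < z.2 + η) (hdet : ∀ z ∈ V, 0 ≤ 1 / 2 - 4 * k ^ 2 * z.1 ^ 2) :
    volume (barrierGrad N k η c '' V) ≤ ENNReal.ofReal (1 / 2) * volume V := by
  choose! D hD hDdet using fun z (hz : z ∈ V) => barrierGrad_hasFDerivAt (N := N) (k := k) (c := c) (hpos z hz)
  refine (addHaar_image_le_lintegral_abs_det_fderiv volume hV
    fun z hz => (hD z hz).hasFDerivWithinAt).trans ?_
  calc _ ≤ ∫⁻ _ in V, ENNReal.ofReal (1 / 2) := by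
        apply setLIntegral_mono measurable_const
        intro z hz
        apply ENNReal.ofReal_le_ofReal
        rw [hDdet z hz hk.ne', abs_of_nonneg (hdet z hz)]
        have : 0 ≤ 4 * k ^ 2 * z.1 ^ 2 := by positivity
        linarith
    _ = _ := by simp

/-- A quantitative strict convexity statement: a solution of the Monge-Ampère equation cannot be
almost flat along a segment of the domain. -/
theorem no_flat_segment {C δ ρ₀ : ℝ} (hC : 0 < C) (hδ : 0 < δ) (hρ : 0 < ρ₀) :
    ∃ σ > 0, ∀ (w : Pl → ℝ) (Ω : Set Pl), ConvexOn ℝ univ w → (∀ x, 0 ≤ w x) → Convex ℝ Ω →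
      (∀ G : Set Pl, IsOpen G → volume (⋃ x ∈ G, subdiff dot w x) = volume (G ∩ Ω)) →
      ∀ i A : Pl, (i.1 + ρ₀, i.2) ∈ Ω → (i.1 - ρ₀, i.2) ∈ Ω → w (i.1 + ρ₀, i.2) ≤ σ →
        w (i.1 - ρ₀, i.2) ≤ σ → A ∈ Ω → w A ≤ C → δ ≤ A.2 - i.2 → |A.1 - i.1| ≤ C → False := by
  obtain ⟨N, k, η, s, c, σ, hk, hη, hσ, b0, b1, b2, hηx, bneg⟩ :=
    exists_barrier (ρ := ρ₀ / 2) (x₀ := δ * ρ₀ / (2 * (C + ρ₀))) (C := C / δ)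
      (by positivity) (by positivity) (by positivity)
  refine ⟨σ, hσ, fun w Ω hw w0 hΩ hal i A hp hm wp wm hA wA hA2 hA1 => ?_⟩
  set x₀ := δ * ρ₀ / (2 * (C + ρ₀)) with hx₀
  have tri := fun z => triangle_bound hC hδ hρ hσ.le hw hΩ hp hm wp wm hA wA hA2 hA1 (z := z)
  set O : Set Pl := Ioo (-(ρ₀ / 2)) (ρ₀ / 2) ×ˢ Ioo 0 x₀ with hO
  set K : Set Pl := Icc (-(ρ₀ / 2)) (ρ₀ / 2) ×ˢ Icc 0 x₀ with hK
  have hOK : O ⊆ K := prod_mono Ioo_subset_Icc_self Ioo_subset_Icc_self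
  have hOopen : IsOpen O := isOpen_Ioo.prod isOpen_Ioo
  have hKc : IsCompact K := isCompact_Icc.prod isCompact_Icc
  have hbc := continuousOn_barrier (N := N) (k := k) (s := s) (c := c) hη
  have hKpos : K ⊆ {z | 0 ≤ z.2} := fun z hz => hz.2.1
  have hwc : Continuous w := hw.continuous_of_univ
  have hwic : Continuous fun z => w (i + z) := hwc.comp (by fun_prop)
  set V : Set Pl := {z ∈ O | barrier N k η s c z < w (i + z)} with hV
  have hVopen : IsOpen V := by
    have h1 : ContinuousOn (fun z => w (i + z) - barrier N k η s c z) O :=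
      hwic.continuousOn.sub (hbc.mono (hOK.trans hKpos))
    have := h1.isOpen_inter_preimage hOopen (isOpen_Ioi (a := (0 : ℝ)))
    convert this using 1
    ext z; simp [V]
  have hbd : ∀ z ∈ K, z ∉ O → w (i + z) ≤ barrier N k η s c z := by
    intro z hz hzO
    have h1 : |z.1| ≤ ρ₀ / 2 := abs_le.2 hz.1
    refine (tri z h1 hz.2.1 hz.2.2).2.trans ?_
    by_cases e0 : z.2 = 0
    · exact b0 z e0
    by_cases e1 : z.2 = x₀
    · exact b2 z e1
    apply b1 z _ hz.2.1
    by_contra hne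
    apply hzO
    have := abs_lt.1 (lt_of_le_of_ne h1 hne)
    exact ⟨this, lt_of_le_of_ne hz.2.1 (Ne.symm e0), lt_of_le_of_ne hz.2.2 e1⟩
  set G : Set Pl := (fun x => x + -i) ⁻¹' V with hG
  have hGopen : IsOpen G := hVopen.preimage (by fun_prop)
  have hGΩ : G ⊆ Ω := by
    intro x hx
    have hxV : x + -i ∈ O := hx.1
    have := (tri (x + -i) (abs_le.2 (hOK hxV).1) (hOK hxV).2.1 (hOK hxV).2.2).1
    simpa using this
  have hvolG : volume G = volume V := measure_preimage_add_right volume (-i) V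
  set V' : Set Pl := {z ∈ V | 0 ≤ 1 / 2 - 4 * k ^ 2 * z.1 ^ 2} with hV'
  have hV'm : MeasurableSet V' := hVopen.measurableSet.inter
    (measurableSet_le (f := fun _ : Pl => (0 : ℝ)) (g := fun z : Pl => 1 / 2 - 4 * k ^ 2 * z.1 ^ 2)
      measurable_const (by fun_prop))
  have hsub : (⋃ x ∈ G, subdiff dot w x) ⊆ barrierGrad N k η c '' V' := by
    intro y hy
    simp only [mem_iUnion] at hy
    obtain ⟨x, hx, hy⟩ := hy
    have hxV : x + -i ∈ V := hx
    have hlin : Continuous fun z : Pl => dot y z := by unfold dot; fun_prop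
    obtain ⟨z, hzK, hz⟩ := hKc.exists_isMinOn ⟨_, hOK hxV.1⟩
      ((hbc.mono hKpos).sub hlin.continuousOn)
    have hzx := hz (hOK hxV.1)
    simp only [mem_ofPred_eq, Pi.sub_apply] at hzx
    have hsubg := hy (i + z)
    have hzV : barrier N k η s c z < w (i + z) := by
      have h1 := hxV.2
      have h2 : i + (x + -i) = x := by abel
      rw [h2] at h1
      have h3 : dot y (i + z - x) = dot y z - dot y (x + -i) := by simp [dot]; ring
      linarith
    have hzO : z ∈ O := by
      by_contra hcon
      exact absurd (hbd z hzK hcon) (not_le.2 hzV)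
    have hloc : IsLocalMin (fun x => barrier N k η s c x - dot y x) z :=
      hz.isLocalMin (mem_of_superset (hOopen.mem_nhds hzO) hOK)
    obtain ⟨h1, h2⟩ := barrier_critical hk (by linarith [hzO.2.1]) hloc
    exact ⟨z, ⟨⟨hzO, hzV⟩, h2⟩, h1.symm⟩
  have hle : volume V ≤ ENNReal.ofReal (1 / 2) * volume V := by
    calc volume V = volume (G ∩ Ω) := by rw [inter_eq_left.2 hGΩ, hvolG]
      _ = volume (⋃ x ∈ G, subdiff dot w x) := (hal G hGopen).symm
      _ ≤ volume (barrierGrad N k η c '' V') := measure_mono hsub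
      _ ≤ ENNReal.ofReal (1 / 2) * volume V' := volume_barrierGrad_image_le hk hV'm
          (fun z hz => by linarith [hz.1.1.2.1]) fun z hz => hz.2
      _ ≤ _ := by gcongr; exact fun z hz => hz.1
  have hVne : V.Nonempty := by
    refine ⟨(0, η), ⟨⟨?_, ?_⟩, hη, hηx⟩, bneg.trans_le (w0 _)⟩ <;> simp <;> linarith
  have hVpos : 0 < volume V := hVopen.measure_pos volume hVne
  have hVfin : volume V ≠ ⊤ := ((measure_mono (fun z hz => hOK hz.1)).trans_lt
    hKc.measure_lt_top).ne
  have h1 : ENNReal.ofReal (1 / 2) * volume V < 1 * volume V := by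
    apply ENNReal.mul_lt_mul_left hVpos.ne' hVfin
    rw [ENNReal.ofReal_lt_one]; norm_num
  rw [one_mul] at h1
  exact absurd hle (not_le.2 h1)

/-- The parametrization of the plane by coordinates along the axes `e`, `f`, with units `A`, `B`. -/
def fr (e f : R2) (A B : ℝ) (X : Pl) : R2 := (A * X.1) • e + (B * X.2) • f

theorem det_sq_of_orthonormal {e f : R2} (he : ‖e‖ = 1) (hf : ‖f‖ = 1) (hef : ⟪e, f⟫ = 0) :
    (e 0 * f 1 - f 0 * e 1) ^ 2 = 1 := by
  have h1 : e 0 ^ 2 + e 1 ^ 2 = 1 := by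
    have := EuclideanSpace.real_norm_sq_eq e
    rw [he] at this; simp [Fin.sum_univ_two] at this; linarith
  have h2 : f 0 ^ 2 + f 1 ^ 2 = 1 := by
    have := EuclideanSpace.real_norm_sq_eq f
    rw [hf] at this; simp [Fin.sum_univ_two] at this; linarith
  have h3 : e 0 * f 0 + e 1 * f 1 = 0 := by
    have : ⟪e, f⟫ = f 0 * e 0 + f 1 * e 1 := by simp [PiLp.inner_apply, Fin.sum_univ_two]
    rw [hef] at this; linarith
  linear_combination h1 * (f 0 ^ 2 + f 1 ^ 2) + h2 - (e 0 * f 0 + e 1 * f 1) * h3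

theorem inner_fr_left {e f : R2} {A B : ℝ} (he : ‖e‖ = 1) (hef : ⟪e, f⟫ = 0) (X : Pl) : ⟪fr e f A B X, e⟫ = A * X.1 := by
  have : ⟪f, e⟫ = 0 := by rw [real_inner_comm]; exact hef
  simp [fr, inner_add_left, inner_smul_left, he, this]

theorem inner_fr_right {e f : R2} {A B : ℝ} (hf : ‖f‖ = 1) (hef : ⟪e, f⟫ = 0) (X : Pl) : ⟪fr e f A B X, f⟫ = B * X.2 := by
  simp [fr, inner_add_left, inner_smul_left, hf, hef]

theorem inner_fr_fr {e f : R2} {A B : ℝ} (he : ‖e‖ = 1) (hf : ‖f‖ = 1)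
    (hef : ⟪e, f⟫ = 0) (X Y : Pl) : ⟪fr e f A B X, fr e f B A Y⟫ = A * B * dot X Y := by
  rw [fr.eq_def e f B A, inner_add_right, inner_smul_right, inner_smul_right,
    inner_fr_left he hef, inner_fr_right hf hef]
  simp [dot]; ring

theorem fr_det {e f : R2} {A B : ℝ} (he : ‖e‖ = 1) (hf : ‖f‖ = 1)
    (hef : ⟪e, f⟫ = 0) (hA : 0 < A) (hB : 0 < B) :
    |(A • e) 0 * (B • f) 1 - (B • f) 0 * (A • e) 1| = A * B := by
  have h := det_sq_of_orthonormal he hf hef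
  have h1 : |e 0 * f 1 - f 0 * e 1| = 1 := by
    rw [← sq_abs] at h
    nlinarith [abs_nonneg (e 0 * f 1 - f 0 * e 1)]
  have : (A • e) 0 * (B • f) 1 - (B • f) 0 * (A • e) 1 = A * B * (e 0 * f 1 - f 0 * e 1) := by
    simp; ring
  rw [this, abs_mul, h1, abs_of_pos (by positivity), mul_one]

theorem exists_fr_equiv {e f : R2} {A B : ℝ} (he : ‖e‖ = 1) (hf : ‖f‖ = 1)
    (hef : ⟪e, f⟫ = 0) (hA : 0 < A) (hB : 0 < B) : ∃ T : Pl ≃L[ℝ] R2, (∀ X, T X = fr e f A B X) ∧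
    ∀ s, volume (T '' s) = ENNReal.ofReal (A * B) * volume s := by
  have h := fr_det he hf hef hA hB
  have hne : (A • e) 0 * (B • f) 1 - (B • f) 0 * (A • e) 1 ≠ 0 := by
    intro h0; rw [h0, abs_zero] at h; exact (mul_pos hA hB).ne h
  refine ⟨frame (A • e) (B • f) hne, fun X => ?_, fun s => ?_⟩
  · rw [frame_apply, fr, smul_smul, smul_smul, mul_comm A, mul_comm B]
  · rw [volume_frame_image, h]

theorem Core.normalize {e f : R2} {A B : ℝ} (he : ‖e‖ = 1) (hf : ‖f‖ = 1)
    (hef : ⟪e, f⟫ = 0) {u v : R2 → ℝ} {Ω₁ Ω₂ : Set R2}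
    (H : Core (fun x y : R2 => ⟪x, y⟫) u v Ω₁ Ω₂) (hA : 0 < A) (hB : 0 < B) :
    Core dot (fun X => u (fr e f A B X) / (A * B)) (fun Y => v (fr e f B A Y) / (A * B))
      (fr e f A B ⁻¹' Ω₁) (fr e f B A ⁻¹' Ω₂) := by
  obtain ⟨T, hT, hTv⟩ := exists_fr_equiv he hf hef hA hB
  obtain ⟨T', hT', hTv'⟩ := exists_fr_equiv he hf hef hB hA
  rw [mul_comm] at hTv'
  have := H.pullback (T := T) (T' := T') (mul_pos hA hB) (fun x y => real_inner_comm y x) dot_comm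
    (fun X Y => by rw [hT, hT', inner_fr_fr he hf hef]) hTv hTv'
  rw [show fr e f A B = T from funext fun X => (hT X).symm,
    show fr e f B A = T' from funext fun X => (hT' X).symm]
  exact this

theorem exists_fr_eq {e f : R2} {A B : ℝ} (he : ‖e‖ = 1) (hf : ‖f‖ = 1)
    (hef : ⟪e, f⟫ = 0) (hA : 0 < A) (hB : 0 < B) (x : R2) :
    fr e f A B (⟪x, e⟫ / A, ⟪x, f⟫ / B) = x := by
  conv_rhs => rw [frame_expansion he hf hef x]
  simp only [fr]
  congr 2 <;> field_simp

theorem gauge2_fr {e f : R2} {A B : ℝ} (he : ‖e‖ = 1) (hf : ‖f‖ = 1)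
    (hef : ⟪e, f⟫ = 0) (hA : 0 < A) (hB : 0 < B) (X : Pl) :
    gauge2 e f A B (fr e f A B X) = |X.1| + |X.2| := by
  rw [gauge2, inner_fr_left he hef, inner_fr_right hf hef, abs_mul, abs_mul, abs_of_pos hA,
    abs_of_pos hB]
  field_simp

theorem fr_add (e f : R2) (A B : ℝ) (X Y : Pl) : fr e f A B (X + Y) = fr e f A B X + fr e f A B Y := by
  simp only [fr, Prod.fst_add, Prod.snd_add]; module

theorem fr_smul (e f : R2) (A B r : ℝ) (X : Pl) : fr e f A B (r • X) = r • fr e f A B X := by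
  simp only [fr, Prod.smul_fst, Prod.smul_snd, smul_eq_mul]; module

/-- `no_flat_segment` for a segment in an arbitrary direction `ξ`. -/
theorem no_flat_segment_dir {C δ ρ₀ : ℝ} (hC : 0 < C) (hδ : 0 < δ) (hρ : 0 < ρ₀) :
    ∃ σ > 0, ∀ (w : Pl → ℝ) (Ω : Set Pl), ConvexOn ℝ univ w → (∀ x, 0 ≤ w x) → Convex ℝ Ω →
      (∀ G : Set Pl, IsOpen G → volume (⋃ x ∈ G, subdiff dot w x) = volume (G ∩ Ω)) →
      ∀ i A ξ : Pl, ξ.1 ^ 2 + ξ.2 ^ 2 = 1 → i + ρ₀ • ξ ∈ Ω → i - ρ₀ • ξ ∈ Ω →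
        w (i + ρ₀ • ξ) ≤ σ → w (i - ρ₀ • ξ) ≤ σ → |A.1 - i.1| + |A.2 - i.2| ≤ C →
        (∀ q : Pl, |q.1| + |q.2| ≤ 2 → A + δ • q ∈ Ω ∧ w (A + δ • q) ≤ C) → False := by
  obtain ⟨σ, hσ, H⟩ := no_flat_segment hC hδ hρ
  refine ⟨σ, hσ, fun w Ω hw w0 hΩ hal i A ξ hξ hp hm wp wm hAi hA => ?_⟩
  have key : ∀ s : ℝ, s ^ 2 = 1 → 0 ≤ s * (-(A.1 - i.1) * ξ.2 + (A.2 - i.2) * ξ.1) → False := by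
    intro s hs hsgn
    have hdet : ξ.1 * (s * ξ.1) - -(s * ξ.2) * ξ.2 = s := by linear_combination s * hξ
    have hs0 : s ≠ 0 := by rintro rfl; norm_num at hs
    have habs : |s| = 1 := by
      rw [← sq_abs] at hs; nlinarith [abs_nonneg s]
    set T := matEquiv ξ.1 (-(s * ξ.2)) ξ.2 (s * ξ.1) (by rw [hdet]; exact hs0) with hT
    have hTa : ∀ X : Pl, T X = (ξ.1 * X.1 - s * ξ.2 * X.2, ξ.2 * X.1 + s * ξ.1 * X.2) := by
      intro X; rw [hT, matEquiv_apply]; ext <;> simp <;> ring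
    have hvol : ∀ S, volume (T '' S) = ENNReal.ofReal 1 * volume S := by
      intro S; rw [hT, volume_matEquiv_image, hdet, habs]
    have hal' := Core.alexandrov_pullback (T := T) (T' := T) (t := 1) (dt := dot) (dF := dot) one_pos
      (fun X Y => by
        rw [hTa, hTa]; simp only [dot]
        linear_combination (Y.1 * X.1) * hξ + (Y.2 * X.2) * (ξ.1 ^ 2 + ξ.2 ^ 2) * hs + (Y.2 * X.2) * hξ)
      hvol hvol hal
    simp only [div_one] at hal'
    have hinv : ∀ X : Pl, T (X.1 * ξ.1 + X.2 * ξ.2, s * (-X.1 * ξ.2 + X.2 * ξ.1)) = X := by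
      intro X; rw [hTa]
      ext
      · simp only
        linear_combination X.1 * hξ + (X.1 * ξ.2 ^ 2 - ξ.2 * X.2 * ξ.1) * hs
      · simp only
        linear_combination X.2 * hξ + (X.2 * ξ.1 ^ 2 - ξ.2 * X.1 * ξ.1) * hs
    set i' : Pl := (i.1 * ξ.1 + i.2 * ξ.2, s * (-i.1 * ξ.2 + i.2 * ξ.1)) with hi'
    set A' : Pl := (A.1 * ξ.1 + A.2 * ξ.2, s * (-A.1 * ξ.2 + A.2 * ξ.1) + δ) with hA'
    have hTi : ∀ r : ℝ, T (i'.1 + r, i'.2) = i + r • ξ := by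
      intro r
      have : (i'.1 + r, i'.2) = i' + r • ((1, 0) : Pl) := by ext <;> simp
      rw [this, map_add, map_smul, hi', hinv, hTa]; simp
    have hTA : T A' = A + δ • (-(s * ξ.2), s * ξ.1) := by
      have : A' = (A.1 * ξ.1 + A.2 * ξ.2, s * (-A.1 * ξ.2 + A.2 * ξ.1)) + δ • ((0, 1) : Pl) := by
        rw [hA']; ext <;> simp
      rw [this, map_add, map_smul, hinv, hTa]; simp
    have x1 : |ξ.1| ≤ 1 := by rw [← sq_le_one_iff_abs_le_one]; nlinarith [sq_nonneg ξ.2]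
    have x2 : |ξ.2| ≤ 1 := by rw [← sq_le_one_iff_abs_le_one]; nlinarith [sq_nonneg ξ.1]
    have hq := hA (-(s * ξ.2), s * ξ.1) (by simp only [abs_neg, abs_mul, habs]; linarith)
    rw [← hTA] at hq
    have hwT : ConvexOn ℝ univ fun X => w (T X) := by
      have := hw.comp_linearMap (T : Pl →ₗ[ℝ] Pl)
      simpa [Function.comp_def] using this
    refine H (fun X => w (T X)) (T ⁻¹' Ω) hwT (fun X => w0 _)
      (hΩ.is_linear_preimage (T : Pl →ₗ[ℝ] Pl).isLinear) hal' i' A' ?_ ?_ ?_ ?_ hq.1 hq.2 ?_ ?_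
    · rw [mem_preimage, hTi]; exact hp
    · rw [mem_preimage, sub_eq_add_neg, hTi, neg_smul, ← sub_eq_add_neg]; exact hm
    · rw [hTi]; exact wp
    · rw [sub_eq_add_neg, hTi, neg_smul, ← sub_eq_add_neg]; exact wm
    · rw [hA', hi']; simp only; nlinarith
    · rw [hA', hi']; simp only
      have : A.1 * ξ.1 + A.2 * ξ.2 - (i.1 * ξ.1 + i.2 * ξ.2) = (A.1 - i.1) * ξ.1 + (A.2 - i.2) * ξ.2 := by
        ring
      rw [this]
      refine (abs_add_le _ _).trans ?_
      rw [abs_mul, abs_mul]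
      nlinarith [abs_nonneg (A.1 - i.1), abs_nonneg (A.2 - i.2)]
  rcases le_total 0 (-(A.1 - i.1) * ξ.2 + (A.2 - i.2) * ξ.1) with h | h
  · exact key 1 (by norm_num) (by linarith)
  · exact key (-1) (by norm_num) (by linarith)

/-- Quantitative strict convexity: sections of much smaller height are much smaller. -/
theorem Fam.strict {δ lam : ℝ} (hδ : 0 < δ) (hlam : 0 < lam) : ∃ σ > 0, σ ≤ 1 ∧
    ∀ (u v : R2 → ℝ) (Ω₁ Ω₂ : Set R2) (L l : ℝ → ℝ) (e f : ℝ → R2),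
      Fam δ u v Ω₁ Ω₂ L l e f → ∀ t ∈ Ioc (0 : ℝ) 1, ∀ h ∈ Ioc (0 : ℝ) 1, h ≤ σ * t → ∀ x,
        gauge2 (e t) (f t) (L t) (l t) x ≤ lam * gauge2 (e h) (f h) (L h) (l h) x := by
  set C := 8 + 2 / δ + 256 / δ ^ 3 with hC
  obtain ⟨σ, hσ, H⟩ := no_flat_segment_dir (C := C) (δ := δ / 2) (ρ₀ := δ * lam / 2)
    (by positivity) (by positivity) (by positivity)
  refine ⟨min 1 (σ / 8), by positivity, min_le_left _ _, ?_⟩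
  intro u v Ω₁ Ω₂ L l e f F t ht h hh hht x
  have hht1 : h ≤ t := hht.trans (by nlinarith [ht.1, min_le_left 1 (σ / 8)])
  have hht2 : 8 * h / t ≤ σ := by
    rw [div_le_iff₀ ht.1]; nlinarith [ht.1, min_le_right 1 (σ / 8)]
  by_contra hcon
  push Not at hcon
  have hL := F.Lpos ht
  have hl := F.lpos t ht
  have he := F.ne t ht
  have hf := F.nf t ht
  have hef := F.ef t ht
  have hLl := F.Ll t ht
  set T := fr (e t) (f t) (L t) (l t) with hT
  set inv : R2 → Pl := fun x => (⟪x, e t⟫ / L t, ⟪x, f t⟫ / l t) with hinv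
  have hTinv : ∀ x, T (inv x) = x := exists_fr_eq he hf hef hL hl
  have hgT : ∀ X, gauge2 (e t) (f t) (L t) (l t) (T X) = |X.1| + |X.2| := gauge2_fr he hf hef hL hl
  have hginv : ∀ x, |(inv x).1| + |(inv x).2| = gauge2 (e t) (f t) (L t) (l t) x := by
    intro x; rw [← hgT, hTinv]
  have hcore := F.core.normalize he hf hef hL hl
  rw [hLl] at hcore
  set X := inv x with hX
  have hgh := F.gauge2_nonneg hh x
  have hX1 : lam * gauge2 (e h) (f h) (L h) (l h) x < |X.1| + |X.2| := by rwa [hX, hginv]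
  have hXpos : 0 < |X.1| + |X.2| := lt_of_le_of_lt (by positivity) hX1
  set r := Real.sqrt (X.1 ^ 2 + X.2 ^ 2) with hr
  have hrsq : r ^ 2 = X.1 ^ 2 + X.2 ^ 2 := Real.sq_sqrt (by positivity)
  have hr2 : |X.1| + |X.2| ≤ 2 * r := by
    have h1 : |X.1| ≤ r := Real.abs_le_sqrt (by nlinarith [sq_nonneg X.2])
    have h2 : |X.2| ≤ r := Real.abs_le_sqrt (by nlinarith [sq_nonneg X.1])
    linarith
  have hr0 : 0 < r := by linarith
  set ξ : Pl := (1 / r) • X with hξ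
  have hTξ : ∀ s : ℝ, T (s • ξ) = δ • ((s / (δ * r)) • x) := by
    intro s
    rw [hT, hξ, fr_smul, fr_smul, ← hT, hX, hTinv, smul_smul, smul_smul]
    congr 1; field_simp
  obtain ⟨ch, hch, Hch⟩ := (F.s1 h hh).e2
  obtain ⟨ct, hct, Hct⟩ := (F.s1 t ht).e2
  have seg : ∀ s : ℝ, |s| = δ * lam / 2 → T (inv ch + s • ξ) ∈ Ω₁ ∧ u (T (inv ch + s • ξ)) ≤ 8 * h := by
    intro s hs
    have : T (inv ch + s • ξ) = ch + δ • ((s / (δ * r)) • x) := by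
      rw [hT, fr_add, ← hT, hTinv, hTξ]
    rw [this]
    apply Hch
    rw [gauge2_smul, abs_div, hs, abs_of_pos (by positivity : 0 < δ * r)]
    rw [div_mul_eq_mul_div, div_le_one (by positivity)]
    nlinarith
  have hct' : |(inv ct).1| + |(inv ct).2| ≤ 2 / δ := by rw [hginv]; exact hct
  have hch' : |(inv ch).1| + |(inv ch).2| ≤ 256 / δ ^ 3 := by
    rw [hginv]
    refine (F.engulf hh ht ch).trans ?_
    have h1 : 1 + h / t ≤ 2 := by
      have : h / t ≤ 1 := (div_le_one ht.1).2 hht1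
      linarith
    have h0 : 0 ≤ 1 + h / t := by have := hh.1; have := ht.1; positivity
    have hg0 := F.gauge2_nonneg hh ch
    calc _ ≤ 64 / δ ^ 2 * 2 * (2 / δ) := by gcongr
      _ = 256 / δ ^ 3 := by field_simp; norm_num
  refine H _ _ hcore.cu hcore.un hcore.o1 hcore.alA (inv ch) (inv ct) ξ ?_ ?_ ?_ ?_ ?_ ?_ ?_
  · rw [hξ]; simp only [Prod.smul_fst, Prod.smul_snd, smul_eq_mul]
    field_simp; linarith
  · exact (seg (δ * lam / 2) (abs_of_pos (by positivity))).1
  · have := (seg (-(δ * lam / 2)) (by rw [abs_neg]; exact abs_of_pos (by positivity))).1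
    rwa [neg_smul, ← sub_eq_add_neg] at this
  · refine le_trans ?_ hht2
    have := ht.1
    gcongr
    exact (seg (δ * lam / 2) (abs_of_pos (by positivity))).2
  · refine le_trans ?_ hht2
    have := (seg (-(δ * lam / 2)) (by rw [abs_neg]; exact abs_of_pos (by positivity))).2
    rw [neg_smul, ← sub_eq_add_neg] at this
    have := ht.1
    gcongr
  · have a1 := abs_sub (inv ct).1 (inv ch).1
    have a2 := abs_sub (inv ct).2 (inv ch).2
    linarith
  · intro q hq
    have e1 : T (inv ct + (δ / 2) • q) = ct + δ • (T ((1 / 2 : ℝ) • q)) := by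
      rw [hT, fr_add, ← hT, hTinv, hT, fr_smul, fr_smul, smul_smul]; congr 2; ring
    have e2 := Hct (T ((1 / 2 : ℝ) • q)) (by
      rw [hgT]; simp only [Prod.smul_fst, Prod.smul_snd, smul_eq_mul, abs_mul]
      norm_num; linarith)
    rw [← e1] at e2
    refine ⟨e2.1, ?_⟩
    have := ht.1
    have h2δ : 0 < 2 / δ + 256 / δ ^ 3 := by positivity
    show u (T _) / t ≤ C
    rw [div_le_iff₀ ht.1]
    nlinarith [e2.2]

/-- A nonvanishing planar map on the plane has a continuous argument. -/
theorem exists_continuous_arg {f : Pl → Pl} (hf : Continuous f) (h0 : ∀ z, f z ≠ 0) :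
    ∃ φ : Pl → ℝ, Continuous φ ∧ ∀ z, ∃ r > 0, f z = (r * Real.cos (φ z), r * Real.sin (φ z)) := by
  let g : Pl → ℂ := fun z => ⟨(f z).1, (f z).2⟩
  have hg : Continuous g := by
    have : g = fun z => ((f z).1 : ℂ) + ((f z).2 : ℂ) * Complex.I := by
      funext z; apply Complex.ext <;> simp [g]
    rw [this]; fun_prop
  have hg0 : ∀ z, g z ≠ 0 := by
    intro z hz
    apply h0 z
    ext
    · exact congrArg Complex.re hz
    · exact congrArg Complex.im hz
  let q : Pl → Circle := fun z => ⟨g z / ‖g z‖, by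
    rw [Submonoid.unitSphere, ← SetLike.mem_coe]; simp [hg0 z]⟩
  have hq : Continuous q := by
    apply Continuous.subtype_mk
    exact hg.div (by fun_prop) (by simpa using hg0)
  let c : C(Pl, AddCircle (2 * Real.pi)) := ⟨fun z => AddCircle.homeomorphCircle'.symm (q z), by fun_prop⟩
  have hcov := AddCircle.isCoveringMap_coe (2 * Real.pi)
  obtain ⟨e₀, he₀⟩ := QuotientAddGroup.mk_surjective (c 0)
  obtain ⟨φ, ⟨-, hφ⟩, -⟩ := hcov.existsUnique_continuousMap_lifts c (0 : Pl) e₀ he₀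
  refine ⟨φ, φ.continuous, fun z => ⟨‖g z‖, norm_pos_iff.2 (hg0 z), ?_⟩⟩
  have h1 : ((φ z : ℝ) : AddCircle (2 * Real.pi)) = c z := congrFun hφ z
  have h2 : AddCircle.homeomorphCircle' ((φ z : ℝ) : AddCircle (2 * Real.pi)) = q z := by
    rw [h1]; exact AddCircle.homeomorphCircle'.apply_symm_apply (q z)
  have h3 : Complex.exp (φ z * Complex.I) = g z / ‖g z‖ := by
    have := congrArg (Subtype.val) h2
    simpa [q, AddCircle.homeomorphCircle'_apply_mk] using this
  have h4 : g z = ‖g z‖ * Complex.exp (φ z * Complex.I) := by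
    rw [h3]
    have : (‖g z‖ : ℂ) ≠ 0 := by simpa using hg0 z
    field_simp
  ext
  · have := congrArg Complex.re h4
    simpa [g, Complex.exp_ofReal_mul_I_re] using this
  · have := congrArg Complex.im h4
    simpa [g, Complex.exp_ofReal_mul_I_im] using this

theorem lt_of_cos_pos {φ : ℝ → ℝ} (hφ : Continuous φ) (hc : ∀ t, 0 < Real.cos (φ t))
    (h0 : Real.sin (φ 0) < 0) (h1 : 0 < Real.sin (φ 1)) : φ 0 < φ 1 := by
  by_contra hcon
  push Not at hcon
  have hpos : ∀ y ∈ Icc (φ 1) (φ 0), 0 < Real.cos y := by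
    intro y hy
    obtain ⟨t, -, rfl⟩ := intermediate_value_Icc' zero_le_one hφ.continuousOn hy
    exact hc t
  have hm : MonotoneOn Real.sin (Icc (φ 1) (φ 0)) := by
    apply monotoneOn_of_deriv_nonneg (convex_Icc _ _) Real.continuous_sin.continuousOn
      Real.differentiable_sin.differentiableOn
    intro y hy
    rw [Real.deriv_sin]
    exact (hpos y (interior_subset hy)).le
  have := hm (left_mem_Icc.2 hcon) (right_mem_Icc.2 hcon) hcon
  linarith

/-- A path going up and a path going from left to right must cross. -/
theorem JoinedIn.cross {A B : Set Pl} (hAB : Disjoint A B) {g₀ g₁ s₀ s₁ : Pl}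
    (hA : JoinedIn A g₀ g₁) (hB : JoinedIn B s₀ s₁) (h1 : ∀ x ∈ A, s₀.1 < x.1 ∧ x.1 < s₁.1)
    (h2 : ∀ x ∈ B, g₀.2 < x.2 ∧ x.2 < g₁.2) : False := by
  obtain ⟨γ, hγ⟩ := hA
  obtain ⟨σ, hσ⟩ := hB
  have hγA : ∀ s, γ.extend s ∈ A := fun s => hγ (projIcc 0 1 zero_le_one s)
  have hσB : ∀ s, σ.extend s ∈ B := fun s => hσ (projIcc 0 1 zero_le_one s)
  have hf : Continuous fun z : Pl => γ.extend z.1 - σ.extend z.2 := by fun_prop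
  obtain ⟨φ, hφ, H⟩ := exists_continuous_arg hf fun z hz =>
    disjoint_left.1 hAB (hγA z.1) (by rw [sub_eq_zero.1 hz]; exact hσB _)
  have hcos : ∀ s t, (0 < Real.cos (φ (s, t)) ↔ (σ.extend t).1 < (γ.extend s).1) ∧
      (Real.cos (φ (s, t)) < 0 ↔ (γ.extend s).1 < (σ.extend t).1) ∧
      (0 < Real.sin (φ (s, t)) ↔ (σ.extend t).2 < (γ.extend s).2) ∧
      (Real.sin (φ (s, t)) < 0 ↔ (γ.extend s).2 < (σ.extend t).2) := by
    intro s t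
    obtain ⟨r, hr, h⟩ := H (s, t)
    have e1 := congrArg Prod.fst h
    have e2 := congrArg Prod.snd h
    simp only [Prod.fst_sub, Prod.snd_sub] at e1 e2
    refine ⟨?_, ?_, ?_, ?_⟩
    · rw [← sub_pos (b := (σ.extend t).1), e1, mul_pos_iff_of_pos_left hr]
    · rw [← sub_neg (b := (σ.extend t).1), e1, mul_neg_iff]; simp [hr, hr.not_gt]
    · rw [← sub_pos (b := (σ.extend t).2), e2, mul_pos_iff_of_pos_left hr]
    · rw [← sub_neg (b := (σ.extend t).2), e2, mul_neg_iff]; simp [hr, hr.not_gt]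
  have hb : ∀ s, 0 < Real.cos (φ (s, 0)) := fun s => by
    rw [(hcos s 0).1, Path.extend_zero]; exact (h1 _ (hγA s)).1
  have ht : ∀ s, Real.cos (φ (s, 1)) < 0 := fun s => by
    rw [(hcos s 1).2.1, Path.extend_one]; exact (h1 _ (hγA s)).2
  have hl : ∀ t, Real.sin (φ (0, t)) < 0 := fun t => by
    rw [(hcos 0 t).2.2.2, Path.extend_zero]; exact (h2 _ (hσB t)).1
  have hr : ∀ t, 0 < Real.sin (φ (1, t)) := fun t => by
    rw [(hcos 1 t).2.2.1, Path.extend_one]; exact (h2 _ (hσB t)).2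
  have a1 := lt_of_cos_pos (φ := fun s => φ (s, 0)) (by fun_prop) hb (hl 0) (hr 0)
  have a2 := lt_of_cos_pos (φ := fun t => φ (1, t) - Real.pi / 2) (by fun_prop)
    (fun t => by rw [Real.cos_sub_pi_div_two]; exact hr t)
    (by rw [Real.sin_sub_pi_div_two]; linarith [hb 1])
    (by rw [Real.sin_sub_pi_div_two]; linarith [ht 1])
  have a3 := lt_of_cos_pos (φ := fun s => φ (1 - s, 1) - Real.pi) (by fun_prop)
    (fun s => by rw [Real.cos_sub_pi]; linarith [ht (1 - s)])
    (by rw [Real.sin_sub_pi, sub_zero]; linarith [hr 1])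
    (by rw [Real.sin_sub_pi, sub_self]; linarith [hl 1])
  have a4 := lt_of_cos_pos (φ := fun t => φ (0, 1 - t) + Real.pi / 2) (by fun_prop)
    (fun t => by rw [Real.cos_add_pi_div_two]; linarith [hl (1 - t)])
    (by rw [Real.sin_add_pi_div_two, sub_zero]; exact ht 0)
    (by rw [Real.sin_add_pi_div_two, sub_self]; exact hb 0)
  simp only [sub_zero, sub_self] at a3 a4
  linarith

theorem joinedIn_segment_vertical {S : Set Pl} {c y₀ y₁ : ℝ}
    (h : ∀ y ∈ uIcc y₀ y₁, (c, y) ∈ S) : JoinedIn S (c, y₀) (c, y₁) := by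
  refine JoinedIn.mono ?_ (U := (fun y => (c, y)) '' uIcc y₀ y₁) (by rintro _ ⟨y, hy, rfl⟩; exact h y hy)
  exact (((convex_uIcc y₀ y₁).isPathConnected ⟨y₀, left_mem_uIcc⟩).image (by fun_prop)).joinedIn _
    ⟨y₀, left_mem_uIcc, rfl⟩ _ ⟨y₁, right_mem_uIcc, rfl⟩

theorem joinedIn_segment_horizontal {S : Set Pl} {c x₀ x₁ : ℝ}
    (h : ∀ x ∈ uIcc x₀ x₁, (x, c) ∈ S) : JoinedIn S (x₀, c) (x₁, c) := by
  refine JoinedIn.mono ?_ (U := (fun x => (x, c)) '' uIcc x₀ x₁) (by rintro _ ⟨y, hy, rfl⟩; exact h y hy)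
  exact (((convex_uIcc x₀ x₁).isPathConnected ⟨x₀, left_mem_uIcc⟩).image (by fun_prop)).joinedIn _
    ⟨x₀, left_mem_uIcc, rfl⟩ _ ⟨x₁, right_mem_uIcc, rfl⟩

/-- Two curves in the upper half plane, one starting on the horizontal axis and one starting on the
vertical axis, must cross when their endpoints alternate. -/
theorem cross_of_alternating {P Q : Set Pl} {p q a b R : ℝ} (hPQ : Disjoint P Q) (hp : 0 < p) (hq : 0 < q)
    (haR : a < R)
    (hP : ∀ x ∈ P, -R ≤ x.1 ∧ x.1 ≤ a ∧ 0 ≤ x.2 ∧ x.2 ≤ b)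
    (hQ : ∀ x ∈ Q, -R ≤ x.1 ∧ x.1 ≤ R ∧ 0 ≤ x.2 ∧ x.2 < b)
    (hP0 : ∀ x ∈ P, x.1 = 0 → q < x.2) {z w : Pl}
    (hz : JoinedIn P (p, 0) z) (hw : JoinedIn Q (0, q) w)
    (hze : z.2 = b ∨ (z.1 = 0 ∧ ∀ x ∈ P ∪ Q, 0 ≤ x.1))
    (hwe : w.1 = R ∨ (w.2 = 0 ∧ p < w.1)) : False := by
  have hpP : ((p, 0) : Pl) ∈ P := hz.source_mem
  have hzP : z ∈ P := hz.target_mem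
  have hqQ : ((0, q) : Pl) ∈ Q := hw.source_mem
  have hwQ : w ∈ Q := hw.target_mem
  have hpa : p ≤ a := (hP _ hpP).2.1
  have hqb : q < b := (hQ _ hqQ).2.2.2
  set A₀ : Set Pl := {x | x.1 = p ∧ x.2 ≤ 0 ∧ -1 ≤ x.2} with hA₀
  set B₀ : Set Pl := {x | (x.1 = 0 ∧ -(1 / 2) ≤ x.2 ∧ x.2 ≤ q) ∨
    (x.1 ≤ 0 ∧ -(R + 1) ≤ x.1 ∧ x.2 = -(1 / 2))} with hB₀
  set A₁ : Set Pl := {x | (b ≤ x.2 ∧ x.1 = z.1 ∧ z.2 = b) ∨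
    (x.1 ≤ 0 ∧ -(1 / 2) ≤ x.1 ∧ z.2 = x.2 ∧ z.1 = 0 ∧ ∀ x ∈ P ∪ Q, 0 ≤ x.1) ∨
    (x.1 = -(1 / 2) ∧ z.2 ≤ x.2 ∧ z.1 = 0 ∧ ∀ x ∈ P ∪ Q, 0 ≤ x.1)} with hA₁
  set B₁ : Set Pl := {x | (R ≤ x.1 ∧ x.1 ≤ R + 1 ∧ x.2 = w.2) ∨
    (x.1 = w.1 ∧ w.2 = 0 ∧ p < w.1 ∧ x.2 ≤ 0 ∧ -(1 / 2) ≤ x.2) ∨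
    (w.1 ≤ x.1 ∧ p < w.1 ∧ x.2 = -(1 / 2))} with hB₁
  have hz1 := hP z hzP
  have hw1 := hQ w hwQ
  have jA : JoinedIn (A₀ ∪ P ∪ A₁) (p, -1) ((if z.2 = b then z.1 else -(1 / 2)), b + 1) := by
    have j0 : JoinedIn (A₀ ∪ P ∪ A₁) (p, -1) (p, 0) := by
      apply joinedIn_segment_vertical
      intro y hy
      rw [uIcc_of_le (by norm_num)] at hy
      exact Or.inl (Or.inl ⟨rfl, hy.2, hy.1⟩)
    have j1 : JoinedIn (A₀ ∪ P ∪ A₁) (p, 0) z := hz.mono fun x hx => Or.inl (Or.inr hx)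
    refine (j0.trans j1).trans ?_
    split_ifs with hzb
    · have : z = (z.1, b) := by rw [← hzb]
      rw [this]
      apply joinedIn_segment_vertical
      intro y hy
      rw [uIcc_of_le (by linarith)] at hy
      exact Or.inr (Or.inl ⟨hy.1, rfl, hzb⟩)
    · obtain ⟨hz0, hpos⟩ := hze.resolve_left hzb
      have j2 : JoinedIn (A₀ ∪ P ∪ A₁) z (-(1 / 2), z.2) := by
        have : z = (0, z.2) := by rw [← hz0]
        conv_lhs => rw [this]
        apply joinedIn_segment_horizontal
        intro x hx
        rw [uIcc_of_ge (by norm_num)] at hx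
        exact Or.inr (Or.inr (Or.inl ⟨hx.2, hx.1, rfl, hz0, hpos⟩))
      refine j2.trans (joinedIn_segment_vertical ?_)
      intro y hy
      rw [uIcc_of_le (by linarith)] at hy
      exact Or.inr (Or.inr (Or.inr ⟨rfl, hy.1, hz0, hpos⟩))
  have jB : JoinedIn (B₀ ∪ Q ∪ B₁) (-(R + 1), -(1 / 2)) (R + 1, if w.1 = R then w.2 else -(1 / 2)) := by
    have j0 : JoinedIn (B₀ ∪ Q ∪ B₁) (-(R + 1), -(1 / 2)) (0, -(1 / 2)) := by
      apply joinedIn_segment_horizontal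
      intro y hy
      rw [uIcc_of_le (by linarith)] at hy
      exact Or.inl (Or.inl (Or.inr ⟨hy.2, hy.1, rfl⟩))
    have j1 : JoinedIn (B₀ ∪ Q ∪ B₁) (0, -(1 / 2)) (0, q) := by
      apply joinedIn_segment_vertical
      intro y hy
      rw [uIcc_of_le (by linarith)] at hy
      exact Or.inl (Or.inl (Or.inl ⟨rfl, hy.1, hy.2⟩))
    have j2 : JoinedIn (B₀ ∪ Q ∪ B₁) (0, q) w := hw.mono fun x hx => Or.inl (Or.inr hx)
    refine ((j0.trans j1).trans j2).trans ?_
    split_ifs with hwR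
    · have : w = (R, w.2) := by rw [← hwR]
      conv_lhs => rw [this]
      apply joinedIn_segment_horizontal
      intro y hy
      rw [uIcc_of_le (by linarith)] at hy
      exact Or.inr (Or.inl ⟨hy.1, hy.2, rfl⟩)
    · obtain ⟨hw0, hpw⟩ := hwe.resolve_left hwR
      have j3 : JoinedIn (B₀ ∪ Q ∪ B₁) w (w.1, -(1 / 2)) := by
        have : w = (w.1, 0) := by rw [← hw0]
        conv_lhs => rw [this]
        apply joinedIn_segment_vertical
        intro x hx
        rw [uIcc_of_ge (by norm_num)] at hx
        exact Or.inr (Or.inr (Or.inl ⟨rfl, hw0, hpw, hx.2, hx.1⟩))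
      refine j3.trans (joinedIn_segment_horizontal ?_)
      intro y hy
      rw [uIcc_of_le (by linarith)] at hy
      exact Or.inr (Or.inr (Or.inr ⟨hy.1, hpw, rfl⟩))
  have hdis : ∀ x ∈ P, x ∉ Q := fun x h1 h2 => disjoint_left.1 hPQ h1 h2
  have hz0 : z.1 = 0 → q < z.2 := hP0 z hzP
  have hR : 0 < R := by linarith
  refine JoinedIn.cross ?_ jA jB ?_ ?_
  · rw [disjoint_left]
    rintro x ((⟨hx1, hx2, hx3⟩ | hx) | (⟨hx1, hx2, hx3⟩ | ⟨hx1, hx2, hx3, hx4, hx5⟩ |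
        ⟨hx1, hx2, hx4, hx5⟩))
      (((⟨hy1, hy2, hy3⟩ | ⟨hy1, hy2, hy3⟩) | hy) | (⟨hy1, hy2, hy3⟩ |
        ⟨hy1, hy2, hy3, hy4, hy5⟩ | ⟨hy1, hy2, hy3⟩))
    any_goals linarith
    any_goals linarith [hP x hx]
    any_goals linarith [hQ x hy]
    · have hx0 : x = (p, 0) := Prod.ext hx1 (le_antisymm hx2 (hQ x hy).2.2.1)
      exact hdis _ hpP (hx0 ▸ hy)
    · linarith [hP0 x hx hy1]
    · exact hdis x hx hy
    · have hx0 : x = w := Prod.ext hy1 (by linarith [(hP x hx).2.2.1])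
      exact hdis x hx (hx0 ▸ hwQ)
    · linarith [hz0 hx4]
    · have hx0 : x = z := Prod.ext (by linarith [hx5 x (Or.inr hy)]) hx3.symm
      exact hdis x (hx0 ▸ hzP) hy
    · linarith [hx5 x (Or.inr hy)]
  · rintro x ((⟨hx1, hx2, hx3⟩ | hx) | (⟨hx1, hx2, hx3⟩ | ⟨hx1, hx2, hx3, hx4, hx5⟩ | ⟨hx1, hx2, hx4, hx5⟩))
    · simp only; constructor <;> linarith
    · have := hP x hx; simp only; constructor <;> linarith
    all_goals simp only; constructor <;> linarith
  · rintro x (((⟨hy1, hy2, hy3⟩ | ⟨hy1, hy2, hy3⟩) | hy) | (⟨hy1, hy2, hy3⟩ | ⟨hy1, hy2, hy3, hy4, hy5⟩ | ⟨hy1, hy2, hy3⟩))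
    · simp only; constructor <;> linarith
    · simp only; constructor <;> linarith
    · have := hQ x hy; simp only; constructor <;> linarith
    all_goals simp only; constructor <;> linarith

theorem Core.continuous_left {u v : Pl → ℝ} {Ω₁ Ω₂ : Set Pl} (H : Core dot u v Ω₁ Ω₂) :
    Continuous u := H.cu.continuous_of_univ

/-- A component of `{u < W}` in a box cannot be compactly contained in it when the gradient map of
`W` expands areas more than `∇u` does. -/
theorem Core.exists_exit {u v : Pl → ℝ} {Ω₁ Ω₂ : Set Pl} (H : Core dot u v Ω₁ Ω₂) {O Hs : Set Pl}
    (hO : IsOpen O) (hOc : Convex ℝ O) (hOb : Bornology.IsBounded O) {W : Pl → ℝ} (hW : Continuous W)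
    {m₁ m₂ γ : ℝ} (hm : 1 < m₁ * m₂) (hHs : IsOpen Hs)
    (hWs : ∀ x₀ ∈ Hs, x₀ ∈ O → ∀ x ∈ closure O, W x₀ + dot (m₁ * x₀.1, m₂ * x₀.2 + γ) (x - x₀) ≤ W x)
    (hΩ : Ω₁ ∩ O ⊆ Hs) {p : Pl} (hp : p ∈ O) (hpH : p ∈ Hs) (hup : u p < W p) :
    ∃ z ∈ closure O \ O, JoinedIn {x | x ∈ closure O ∧ u x < W x} p z := by
  have hu := H.continuous_left
  by_contra hcon
  push Not at hcon
  set U : Set Pl := {x | x ∈ O ∧ u x < W x} with hU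
  have hUo : IsOpen U := hO.inter (isOpen_lt hu hW)
  have hpU : p ∈ U := ⟨hp, hup⟩
  set G := connectedComponentIn U p with hG
  have hGo : IsOpen G := hUo.connectedComponentIn
  have hGU : G ⊆ U := connectedComponentIn_subset U p
  have hpG : p ∈ G := mem_connectedComponentIn hpU
  have hGc : IsConnected G := isConnected_connectedComponentIn_iff.2 hpU
  have hGp : IsPathConnected G := hGo.isConnected_iff_isPathConnected.1 hGc
  have hGO : closure G ⊆ closure O := closure_mono fun x hx => (hGU hx).1
  have hbd : ∀ z ∈ closure G, z ∉ G → W z ≤ u z := by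
    intro z hz hzG
    by_contra hlt
    push Not at hlt
    by_cases hzO : z ∈ O
    · apply hzG
      have h1 : IsPreconnected (insert z G) :=
        hGc.isPreconnected.subset_closure (subset_insert _ _)
          (insert_subset hz subset_closure)
      exact h1.subset_connectedComponentIn (mem_insert_of_mem _ hpG)
        (insert_subset (show z ∈ U from ⟨hzO, hlt⟩) hGU) (mem_insert _ _)
    · obtain ⟨r, hr, hball⟩ := Metric.isOpen_iff.1 (isOpen_lt hu hW) z hlt
      obtain ⟨g, hgG, hgz⟩ := Metric.mem_closure_iff.1 hz r hr
      have hgb : g ∈ ball z r := by rwa [mem_ball, dist_comm]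
      have hcv : Convex ℝ (closure O ∩ ball z r) := hOc.closure.inter (convex_ball z r)
      have hj1 : JoinedIn {x | x ∈ closure O ∧ u x < W x} p g :=
        (hGp.joinedIn p hpG g hgG).mono fun x hx => ⟨subset_closure (hGU hx).1, (hGU hx).2⟩
      have hgm : g ∈ closure O ∩ ball z r := ⟨hGO (subset_closure hgG), hgb⟩
      have hzm : z ∈ closure O ∩ ball z r := ⟨hGO hz, mem_ball_self hr⟩
      have hj2 : JoinedIn {x | x ∈ closure O ∧ u x < W x} g z :=
        ((hcv.isPathConnected ⟨z, hzm⟩).joinedIn g hgm z hzm).mono fun x hx => ⟨hx.1, hball hx.2⟩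
      exact hcon z ⟨hGO hz, hzO⟩ (hj1.trans hj2)
  have hGcpt : IsCompact (closure G) :=
    (hOb.subset fun x hx => (hGU hx).1).isCompact_closure
  have hm0 : m₁ * m₂ - 0 * 0 ≠ 0 := by linarith
  let T := matEquiv m₁ 0 0 m₂ hm0
  have hsub : (fun x => ((0, γ) : Pl) + x) '' (T '' (G ∩ Hs)) ⊆ ⋃ x ∈ G, subdiff dot u x := by
    rintro _ ⟨_, ⟨x₀, ⟨hx₀, hx₀H⟩, rfl⟩, rfl⟩
    set y : Pl := (0, γ) + T x₀ with hy
    have hyy : y = (m₁ * x₀.1, m₂ * x₀.2 + γ) := by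
      rw [hy]; ext <;> simp [T]; ring
    have hlin : Continuous fun x : Pl => u x - dot y x := by
      unfold dot; fun_prop
    obtain ⟨z, hz, hmin⟩ := hGcpt.exists_isMinOn ⟨x₀, subset_closure hx₀⟩ hlin.continuousOn
    have hsd : ∀ x x' : Pl, dot y (x - x') = dot y x - dot y x' := by
      intro x x'; simp [dot]; ring
    have hzG : z ∈ G := by
      by_contra hzG
      have h1 := hbd z hz hzG
      have h2 := hWs x₀ hx₀H (hGU hx₀).1 z (hGO hz)
      have h3 : u z - dot y z ≤ u x₀ - dot y x₀ := hmin (subset_closure hx₀)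
      have h4 := (hGU hx₀).2
      rw [← hyy, hsd] at h2
      linarith
    have hconv : ConvexOn ℝ univ fun x : Pl => u x - dot y x := by
      refine H.cu.sub ⟨convex_univ, ?_⟩
      intro a _ b _ s t _ _ _
      simp [dot]; apply le_of_eq; ring
    have hglob : IsMinOn (fun x : Pl => u x - dot y x) univ z := by
      apply IsMinOn.of_isLocalMinOn_of_convexOn (mem_univ z) _ hconv
      have : IsLocalMin (fun x : Pl => u x - dot y x) z :=
        (hmin.on_subset subset_closure).isLocalMin (hGo.mem_nhds hzG)
      exact this.on univ
    refine mem_iUnion₂.2 ⟨z, hzG, fun x => ?_⟩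
    have := hglob (mem_univ x)
    simp only [mem_ofPred_eq] at this
    rw [hsd]; linarith
  have hv := measure_mono (μ := volume) hsub
  rw [H.alA G hGo, image_add_left, measure_preimage_add, volume_matEquiv_image] at hv
  have hv2 : volume (G ∩ Ω₁) ≤ volume (G ∩ Hs) :=
    measure_mono fun x hx => ⟨hx.1, hΩ ⟨hx.2, (hGU hx.1).1⟩⟩
  have hpos : 0 < volume (G ∩ Hs) := (hGo.inter hHs).measure_pos volume ⟨p, hpG, hpH⟩
  have hfin : volume (G ∩ Hs) ≠ ⊤ :=
    ((hOb.subset fun x hx => (hGU hx.1).1).measure_lt_top (μ := volume)).ne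
  have hlt : volume (G ∩ Hs) < ENNReal.ofReal |m₁ * m₂ - 0 * 0| * volume (G ∩ Hs) := by
    conv_lhs => rw [← one_mul (volume (G ∩ Hs))]
    rw [ENNReal.mul_lt_mul_iff_left hpos.ne' hfin]
    rw [ENNReal.one_lt_ofReal, abs_of_pos (by linarith)]; linarith
  exact absurd (hv.trans hv2) hlt.not_ge

/-- `u` is controlled by `𝒯 ρ` on the box of half-width `ρ`, up to `ρ = R`. -/
def BddBox (𝒯 : ℝ → ℝ) (R : ℝ) (u : Pl → ℝ) : Prop :=
  ∀ ρ ≤ R, ∀ x : Pl, |x.1| ≤ ρ → |x.2| ≤ ρ → u x ≤ 𝒯 ρ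

/-- `closure Ω` contains an almost vertical upward segment of height `R`. -/
def UpRay (m R : ℝ) (Ω : Set Pl) : Prop :=
  ∃ κ : ℝ, |κ| ≤ m ∧ ∀ s ∈ Icc 0 R, ((κ * s, s) : Pl) ∈ closure Ω

/-- `closure Ω` contains an almost horizontal segment of length `R` to the right. -/
def RightRay (m R : ℝ) (Ω : Set Pl) : Prop :=
  ∃ κ : ℝ, |κ| ≤ m ∧ ∀ s ∈ Icc 0 R, ((s, κ * s) : Pl) ∈ closure Ω

/-- To the right of a point of `closure Ω` the horizontal axis is close to `closure Ω`. -/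
def NearAxis (m R : ℝ) (Ω : Set Pl) : Prop :=
  ∀ y ∈ closure Ω, |y.1| ≤ R → |y.2| ≤ R → ∀ Y, y.1 ≤ Y → |Y| ≤ R →
    ∃ z ∈ closure Ω, |z.1 - Y| ≤ m ∧ |z.2| ≤ m

namespace Core
variable {u v : Pl → ℝ} {Ω₁ Ω₂ : Set Pl} {𝒯 : ℝ → ℝ} {R : ℝ}

theorem abs_le_of_eq (H : Core dot u v Ω₁ Ω₂) (hb : BddBox 𝒯 R u) {ρ : ℝ} (hρ : ρ + 1 ≤ R)
    {x y : Pl} (hx1 : |x.1| ≤ ρ) (hx2 : |x.2| ≤ ρ) (hy : y ∈ closure Ω₂) (he : u x + v y = dot x y) :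
    |y.1| ≤ 𝒯 (ρ + 1) ∧ |y.2| ≤ 𝒯 (ρ + 1) := by
  rw [abs_le] at hx1 hx2
  have key : ∀ w : Pl, |w.1| ≤ 1 → |w.2| ≤ 1 → dot w y ≤ 𝒯 (ρ + 1) := by
    intro w h1 h2
    rw [abs_le] at h1 h2
    have hf := H.fenA (x + w) y hy
    have hB := hb (ρ + 1) hρ (x + w) (by rw [abs_le]; simp only [Prod.fst_add]; constructor <;> linarith)
      (by rw [abs_le]; simp only [Prod.snd_add]; constructor <;> linarith)
    have := H.un x
    have e : dot (x + w) y = dot x y + dot w y := by simp [dot]; ring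
    linarith
  refine ⟨abs_le.2 ⟨?_, ?_⟩, abs_le.2 ⟨?_, ?_⟩⟩
  · have := key (-1, 0) (by simp) (by simp); simp [dot] at this; linarith
  · have := key (1, 0) (by simp) (by simp); simp [dot] at this; linarith
  · have := key (0, -1) (by simp) (by simp); simp [dot] at this; linarith
  · have := key (0, 1) (by simp) (by simp); simp [dot] at this; linarith

theorem lipschitz (H : Core dot u v Ω₁ Ω₂) (hb : BddBox 𝒯 R u) {ρ : ℝ} (hρ : ρ + 1 ≤ R)
    {x : Pl} (hx1 : |x.1| ≤ ρ) (hx2 : |x.2| ≤ ρ) (x' : Pl) :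
    u x - 𝒯 (ρ + 1) * (|x.1 - x'.1| + |x.2 - x'.2|) ≤ u x' := by
  obtain ⟨y, hy, he⟩ := H.subA x
  obtain ⟨h1, h2⟩ := H.abs_le_of_eq hb hρ hx1 hx2 hy he
  have hf := H.fenA x' y hy
  have e : dot x' y = dot x y - ((x.1 - x'.1) * y.1 + (x.2 - x'.2) * y.2) := by simp [dot]; ring
  have h3 : (x.1 - x'.1) * y.1 ≤ 𝒯 (ρ + 1) * |x.1 - x'.1| := by
    calc _ ≤ |(x.1 - x'.1) * y.1| := le_abs_self _
      _ = |y.1| * |x.1 - x'.1| := by rw [abs_mul, mul_comm]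
      _ ≤ _ := by gcongr
  have h4 : (x.2 - x'.2) * y.2 ≤ 𝒯 (ρ + 1) * |x.2 - x'.2| := by
    calc _ ≤ |(x.2 - x'.2) * y.2| := le_abs_self _
      _ = |y.2| * |x.2 - x'.2| := by rw [abs_mul, mul_comm]
      _ ≤ _ := by gcongr
  linarith

/-- The Fenchel inequality is almost true near an almost vertical segment in the domain. -/
theorem fen_axis (H : Core dot u v Ω₁ Ω₂) (hb : BddBox 𝒯 R u) {ρ m b Y₀ : ℝ} (hρ : ρ + 1 ≤ R)
    (hT : 0 ≤ 𝒯 (ρ + 1)) (hbρ : b ≤ ρ) (hm1 : m ≤ 1) (hU : UpRay m R Ω₁) {x y : Pl}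
    (hx1 : |x.1| ≤ m * b) (hx2 : 0 ≤ x.2) (hx2' : x.2 ≤ b)
    (hy : |y.1| ≤ Y₀) : dot x y - 2 * b * (𝒯 (ρ + 1) + Y₀) * m ≤ u x + v y := by
  obtain ⟨κ, hκ, hray⟩ := hU
  have hm0 : 0 ≤ m := (abs_nonneg _).trans hκ
  have hb0 : 0 ≤ b := hx2.trans hx2'
  have hmem := hray x.2 ⟨hx2, by linarith⟩
  have hκx : |κ * x.2| ≤ m * b := by rw [abs_mul, abs_of_nonneg hx2]; gcongr
  have hmb : m * b ≤ ρ := (mul_le_of_le_one_left hb0 hm1).trans hbρ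
  have h1 := H.lipschitz hb hρ (x := (κ * x.2, x.2)) (hκx.trans hmb)
    (by rw [abs_of_nonneg hx2]; linarith) x
  have h2 := H.fenB _ hmem y
  have hd : |κ * x.2 - x.1| ≤ 2 * (m * b) := (abs_sub _ _).trans (by linarith)
  simp only [sub_self, abs_zero, add_zero] at h1
  have e : dot (κ * x.2, x.2) y = dot x y + (κ * x.2 - x.1) * y.1 := by simp [dot]; ring
  have h3 : -((2 * (m * b)) * Y₀) ≤ (κ * x.2 - x.1) * y.1 := by
    have : |(κ * x.2 - x.1) * y.1| ≤ (2 * (m * b)) * Y₀ := by rw [abs_mul]; gcongr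
    exact (abs_le.1 this).1
  have h4 : 𝒯 (ρ + 1) * |κ * x.2 - x.1| ≤ 𝒯 (ρ + 1) * (2 * (m * b)) := by gcongr
  nlinarith

theorem exists_far (H : Core dot u v Ω₁ Ω₂) (hbu : BddBox 𝒯 R u) (hbv : BddBox 𝒯 R v)
    (h𝒯 : ∀ ρ, 1 ≤ 𝒯 ρ) {X m : ℝ} (hX : 0 < X)
    (hXR : X ≤ R) (hYR : 2 * 𝒯 X / X + 1 ≤ R) (hm1 : m ≤ 1) (hm : m * 𝒯 (2 * 𝒯 X / X + 1) ≤ X / 4)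
    (hr : RightRay m R Ω₂) :
    ∃ x ∈ closure Ω₁, X / 4 ≤ x.1 ∧ |x.1| ≤ 𝒯 (2 * 𝒯 X / X + 1) ∧ |x.2| ≤ 𝒯 (2 * 𝒯 X / X + 1) := by
  obtain ⟨κ, hκ, hray⟩ := hr
  set T := 𝒯 X with hTd
  set Y := 2 * T / X with hY
  have hT : 1 ≤ T := h𝒯 X
  have hY0 : 0 < Y := by positivity
  have hXY : X * Y = 2 * T := by rw [hY]; field_simp
  have hm0 : 0 ≤ m := (abs_nonneg _).trans hκ
  have hy := hray Y ⟨hY0.le, by linarith⟩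
  have h1 := H.fenA (X, 0) _ hy
  have h2 := hbu X hXR (X, 0) (by simp [abs_of_pos hX]) (by simp [hX.le])
  simp only [dot, zero_mul, add_zero] at h1
  obtain ⟨x, hx, he⟩ := H.subB (Y, κ * Y)
  have hκY : |κ * Y| ≤ Y := by
    rw [abs_mul, abs_of_pos hY0]; exact mul_le_of_le_one_left hY0.le (hκ.trans hm1)
  have h3 := (H.swap dot_comm).abs_le_of_eq hbv hYR (x := (Y, κ * Y)) (y := x)
    (by simp [abs_of_pos hY0]) hκY hx (by rw [dot_comm, add_comm]; exact he)
  refine ⟨x, hx, ?_, h3⟩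
  have h4 := H.un x
  simp only [dot] at he
  have h5 : T ≤ Y * (x.1 + κ * x.2) := by linarith
  have h6 : X / 2 ≤ x.1 + κ * x.2 := by
    by_contra hlt
    push Not at hlt
    have := mul_lt_mul_of_pos_left hlt hY0
    nlinarith
  have h7 : κ * x.2 ≤ X / 4 := by
    calc κ * x.2 ≤ |κ * x.2| := le_abs_self _
      _ ≤ m * 𝒯 (Y + 1) := by rw [abs_mul]; exact mul_le_mul hκ h3.2 (abs_nonneg _) hm0
      _ ≤ _ := hm
  linarith
end Core

/-- A point below the convex set `S`, which contains `0`, a far point to the right and a long upward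
segment in direction `(κ, 1)`, is separated from `S` by a line of bounded slope. -/
theorem exists_separating_slope {S : Set Pl} (hS : Convex ℝ S) (hSc : IsClosed S) (h0 : (0 : Pl) ∈ S)
    {κ a b R R₁ s : ℝ} (ha : 0 < a) (hR : 3 * (b + 2 * R₁) ≤ R) (hR₁ : 0 < R₁)
    (hray : ∀ t ∈ Icc 0 R, ((κ * t, t) : Pl) ∈ S) {xs x : Pl} (hxs : xs ∈ S)
    (hxs1 : 3 * a ≤ xs.1 - κ * xs.2) (hxs2 : |xs.2| ≤ R₁) (hX : 0 < x.1 - κ * x.2)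
    (hX' : x.1 - κ * x.2 ≤ 2 * a) (hx2 : 0 ≤ x.2) (hx2' : x.2 ≤ b) (hs : 0 ≤ s) (hs' : s ≤ R₁)
    (hx' : x + (κ * s, s) ∉ S) :
    ∃ ν, 0 ≤ ν ∧ ν ≤ R₁ / a ∧ ∀ z ∈ S,
      -ν * (x.1 + κ * s) + (1 + κ * ν) * (x.2 + s) ≤ -ν * z.1 + (1 + κ * ν) * z.2 := by
  obtain ⟨f, c, hf1, hf2⟩ := geometric_hahn_banach_point_closed hS hSc hx'
  set n₁ := f (1, 0) with hn₁
  set n₂ := f (0, 1) with hn₂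
  have hf : ∀ z : Pl, f z = z.1 * n₁ + z.2 * n₂ := by
    intro z
    have : z = z.1 • ((1, 0) : Pl) + z.2 • ((0, 1) : Pl) := by ext <;> simp
    conv_lhs => rw [this]
    rw [map_add, map_smul, map_smul, smul_eq_mul, smul_eq_mul]
  set q := f (x + (κ * s, s)) with hq
  have hlt : ∀ z ∈ S, q < f z := fun z hz => hf1.trans (hf2 z hz)
  have hq0 : q < 0 := by simpa using hlt 0 h0
  have hqs := hlt xs hxs
  have hR0 : 0 < R := by nlinarith [hx2.trans hx2']
  have hqR := hlt _ (hray R ⟨hR0.le, le_rfl⟩)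
  set X := x.1 - κ * x.2 with hXd
  set Xs := xs.1 - κ * xs.2 with hXs
  set m := κ * n₁ + n₂ with hm
  have eq1 : q = X * n₁ + (x.2 + s) * m := by rw [hq, hf, hXd, hm]; simp only [Prod.fst_add, Prod.snd_add]; ring
  have eq2 : f xs = Xs * n₁ + xs.2 * m := by rw [hf, hXs, hm]; ring
  have eq3 : f (κ * R, R) = R * m := by rw [hf, hm]; ring
  rw [eq2] at hqs
  rw [eq3] at hqR
  rw [abs_le] at hxs2
  have hmpos : 0 < m := by
    by_contra hm0
    push Not at hm0
    -- eliminate `n₁`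
    have h1 : (Xs - X) * q > (Xs * (x.2 + s) - X * xs.2) * m := by
      have : X * q < X * (Xs * n₁ + xs.2 * m) := mul_lt_mul_of_pos_left hqs hX
      nlinarith
    have h2 : a ≤ Xs - X := by linarith
    rcases hm0.lt_or_eq with hneg | hz
    · have h3 : (Xs - X) * q ≤ (Xs - X) * (R * m) := by
        apply mul_le_mul_of_nonneg_left hqR.le; linarith
      have h4 : (Xs * (x.2 + s) - X * xs.2) * m < (Xs - X) * R * m := by linarith
      have h5 : (Xs - X) * R < Xs * (x.2 + s) - X * xs.2 := by
        by_contra h6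
        push Not at h6
        have := mul_le_mul_of_nonpos_right h6 hm0
        linarith
      have h7 : Xs * (x.2 + s) ≤ Xs * (b + R₁) := by
        apply mul_le_mul_of_nonneg_left <;> linarith
      have h8 : -(X * xs.2) ≤ X * R₁ := by nlinarith
      have h9 : (Xs - X) * (3 * (b + 2 * R₁)) ≤ (Xs - X) * R := by
        apply mul_le_mul_of_nonneg_left hR; linarith
      have hb0 := hx2.trans hx2'
      have h10 : X ≤ 2 / 3 * Xs := by linarith
      have h11 : (1 / 3 * Xs) * (3 * (b + 2 * R₁)) ≤ (Xs - X) * (3 * (b + 2 * R₁)) := by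
        apply mul_le_mul_of_nonneg_right <;> linarith
      have h12 : X * R₁ ≤ 2 / 3 * Xs * R₁ := by apply mul_le_mul_of_nonneg_right h10 hR₁.le
      nlinarith
    · rw [hz, mul_zero] at h1
      have : (Xs - X) * q ≤ 0 := mul_nonpos_of_nonneg_of_nonpos (by linarith) hq0.le
      linarith
  have hkey : ∀ z : Pl, -(-n₁ / m) * z.1 + (1 + κ * (-n₁ / m)) * z.2 = f z / m := by
    intro z
    rw [hf, eq_div_iff hmpos.ne']
    have : n₁ / m * m = n₁ := div_mul_cancel₀ _ hmpos.ne'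
    have e : (-(-n₁ / m) * z.1 + (1 + κ * (-n₁ / m)) * z.2) * m =
      (n₁ / m * m) * z.1 + (m - κ * (n₁ / m * m)) * z.2 := by ring
    rw [e, this, hm]; ring
  have hn : n₁ ≤ 0 := by
    have : 0 ≤ (x.2 + s) * m := by positivity
    by_contra hn
    push Not at hn
    have := mul_pos hX hn
    linarith
  refine ⟨-n₁ / m, div_nonneg (by linarith) hmpos.le, ?_, fun z hz => ?_⟩
  · rw [div_le_div_iff₀ hmpos ha]
    have h1 : (Xs - X) * (-n₁) ≤ (xs.2 - x.2 - s) * m := by linarith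
    have h2 : a * (-n₁) ≤ (Xs - X) * (-n₁) := by
      apply mul_le_mul_of_nonneg_right <;> linarith
    have h3 : (xs.2 - x.2 - s) * m ≤ R₁ * m := by
      apply mul_le_mul_of_nonneg_right <;> linarith
    linarith
  · have e1 := hkey (x + (κ * s, s))
    have e2 := hkey z
    simp only [Prod.fst_add, Prod.snd_add] at e1
    rw [e1, e2]
    exact (div_le_div_iff_of_pos_right hmpos).2 (hlt z hz).le

namespace Core
variable {u v : Pl → ℝ} {Ω₁ Ω₂ : Set Pl} {𝒯 : ℝ → ℝ} {R : ℝ}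

/-- `u` almost decreases along an upward segment below the domain. -/
theorem le_of_notMem (H : Core dot u v Ω₁ Ω₂) (hbu : BddBox 𝒯 R u) (hbv : BddBox 𝒯 R v)
    (h𝒯 : ∀ ρ, 1 ≤ 𝒯 ρ) {κ m s ν N ρ Y₂ : ℝ} {x : Pl} (hκ : |κ| ≤ m) (hm1 : m ≤ 1)
    (hN : 0 ≤ N) (hmN : m * N ≤ 1 / 2)
    (hρ : ρ + 1 ≤ R) (hY₂ : 𝒯 (ρ + 1) + 2 * 𝒯 (ρ + 1) * N ≤ Y₂) (hY₂R : Y₂ + 2 ≤ R)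
    (hs : 0 ≤ s) (hsρ : s ≤ ρ) (hx1 : |x.1 + κ * s| ≤ ρ) (hx2 : |x.2 + s| ≤ ρ)
    (hν : 0 ≤ ν) (hνN : ν ≤ N)
    (hsep : ∀ z ∈ closure Ω₁,
      -ν * (x.1 + κ * s) + (1 + κ * ν) * (x.2 + s) ≤ -ν * z.1 + (1 + κ * ν) * z.2)
    (hZ : NearAxis m R Ω₂) :
    u (x + (κ * s, s)) - (2 * (𝒯 (Y₂ + 2) + ρ) + ρ * (Y₂ + 2)) * m ≤ u x := by
  obtain ⟨y₀, hy₀, he⟩ := H.subA (x + (κ * s, s))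
  have hm0 : 0 ≤ m := (abs_nonneg _).trans hκ
  have hρ0 : 0 ≤ ρ := hs.trans hsρ
  set T₂ := 𝒯 (ρ + 1) with hT₂
  have hT21 : 1 ≤ T₂ := h𝒯 _
  obtain ⟨hb1, hb2⟩ := H.abs_le_of_eq hbu hρ (x := x + (κ * s, s)) (by simpa using hx1)
    (by simpa using hx2) hy₀ he
  have hY₂T : T₂ ≤ Y₂ := by nlinarith [mul_nonneg (by linarith : 0 ≤ T₂) hN]
  have hT3 := h𝒯 (Y₂ + 2)
  have hC : 0 ≤ 2 * (𝒯 (Y₂ + 2) + ρ) := by positivity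
  rcases le_or_gt y₀.2 0 with hneg | hpos
  · have hf := H.fenA x y₀ hy₀
    have e : dot (x + (κ * s, s)) y₀ = dot x y₀ + s * (κ * y₀.1 + y₀.2) := by
      simp [dot]; ring
    have h1 : κ * y₀.1 ≤ m * T₂ := by
      calc _ ≤ |κ * y₀.1| := le_abs_self _
        _ ≤ _ := by rw [abs_mul]; gcongr
    have h2 : s * (κ * y₀.1 + y₀.2) ≤ ρ * (m * T₂) := by
      calc _ ≤ s * (m * T₂) := by apply mul_le_mul_of_nonneg_left _ hs; linarith
        _ ≤ _ := by gcongr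
    have h3 : ρ * (m * T₂) ≤ ρ * (Y₂ + 2) * m := by
      calc ρ * (m * T₂) = ρ * T₂ * m := by ring
        _ ≤ _ := by gcongr; linarith
    nlinarith [mul_nonneg hC hm0]
  · set d := 1 + κ * ν with hd
    have hκν : |κ * ν| ≤ 1 / 2 := by
      rw [abs_mul, abs_of_nonneg hν]
      exact (mul_le_mul hκ hνN hν hm0).trans hmN
    have hd2 : 1 / 2 ≤ d := by have := (abs_le.1 hκν).1; linarith
    set t := y₀.2 / d with ht
    have htd : t * d = y₀.2 := div_mul_cancel₀ _ (by linarith)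
    have ht0 : 0 ≤ t := by positivity
    have htT : t ≤ 2 * T₂ := by
      rw [ht, div_le_iff₀ (by linarith)]
      have := (abs_le.1 hb2).2
      nlinarith
    set Y := y₀.1 + t * ν with hY
    have htν : 0 ≤ t * ν := mul_nonneg ht0 hν
    have htν' : t * ν ≤ 2 * T₂ * N := mul_le_mul htT hνN hν (by linarith)
    have hYabs : |Y| ≤ Y₂ := by
      have := abs_le.1 hb1
      rw [abs_le]; constructor <;> linarith
    obtain ⟨z, hz, hz1, hz2⟩ := hZ y₀ hy₀ (by linarith) (by linarith) Y (by linarith) (by linarith)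
    obtain ⟨w, hw, hwe⟩ := H.subB z
    have hz1' : |z.1| ≤ Y₂ + 1 := by
      have h1 := abs_le.1 hz1; have h2 := abs_le.1 hYabs
      rw [abs_le]; constructor <;> linarith
    have hz2' : |z.2| ≤ Y₂ + 1 := by linarith
    obtain ⟨hw1, hw2⟩ := (H.swap dot_comm).abs_le_of_eq hbv (ρ := Y₂ + 1) (by linarith) (x := z) (y := w)
      hz1' hz2' hw (by rw [dot_comm, add_comm]; exact hwe)
    rw [show Y₂ + 1 + 1 = Y₂ + 2 by ring] at hw1 hw2
    have hf1 := H.fenB w hw y₀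
    have hf2 := H.fenA x z hz
    have hsw := hsep w hw
    have e1 : dot w z - dot w y₀ = t * (ν * w.1 - d * w.2) + (z.1 - Y) * w.1 + z.2 * w.2 := by
      simp only [dot, hY]; linear_combination w.2 * htd
    have e2 : dot (x + (κ * s, s)) y₀ = dot x z + s * (κ * z.1 + z.2)
        - (z.1 - Y) * (x.1 + κ * s) - z.2 * (x.2 + s)
        - t * (ν * (x.1 + κ * s) - d * (x.2 + s)) := by
      simp only [dot, hY, Prod.fst_add, Prod.snd_add]; linear_combination - (x.2 + s) * htd
    have h3 : t * (ν * w.1 - d * w.2) ≤ t * (ν * (x.1 + κ * s) - d * (x.2 + s)) := by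
      apply mul_le_mul_of_nonneg_left _ ht0; linarith
    have bd : ∀ p q A : ℝ, |p| ≤ m → |q| ≤ A → p * q ≤ m * A := fun p q A hp hq =>
      (le_abs_self _).trans (by rw [abs_mul]; exact mul_le_mul hp hq (abs_nonneg _) hm0)
    have bd' : ∀ p q A : ℝ, |p| ≤ m → |q| ≤ A → -(p * q) ≤ m * A := fun p q A hp hq =>
      (neg_le_abs _).trans (by rw [abs_mul]; exact mul_le_mul hp hq (abs_nonneg _) hm0)
    have k1 := bd _ _ _ hz1 hw1
    have k2 := bd _ _ _ hz2 hw2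
    have k3 := bd' _ _ _ hz1 hx1
    have k4 := bd' _ _ _ hz2 hx2
    have k5 : s * (κ * z.1 + z.2) ≤ ρ * (m * (Y₂ + 1) + m) := by
      have a1 := bd _ _ _ hκ hz1'
      have a2 := (le_abs_self _).trans hz2
      calc _ ≤ s * (m * (Y₂ + 1) + m) := by apply mul_le_mul_of_nonneg_left _ hs; linarith
        _ ≤ _ := by
          apply mul_le_mul_of_nonneg_right hsρ
          have : 0 ≤ Y₂ + 1 := by linarith
          positivity
    have e3 : (2 * (𝒯 (Y₂ + 2) + ρ) + ρ * (Y₂ + 2)) * m = m * 𝒯 (Y₂ + 2) + m * 𝒯 (Y₂ + 2) + m * ρ + m * ρ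
      + ρ * (m * (Y₂ + 1) + m) := by ring
    rw [e3]
    linarith
end Core

set_option maxHeartbeats 800000 in
/-- The Fenchel inequality is almost true in the first quadrant. -/
theorem fen_right {𝒯 : ℝ → ℝ} (h𝒯 : ∀ ρ, 1 ≤ 𝒯 ρ) {a b Y₀ : ℝ} (ha : 0 < a) (hb : 0 < b) (hY₀ : 0 ≤ Y₀) :
    ∃ R₀ C : ℝ, 1 ≤ C ∧ ∀ R ≥ R₀, ∀ (u v : Pl → ℝ) (Ω₁ Ω₂ : Set Pl) (m : ℝ), 0 < m → C * m ≤ 1 →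
      Core dot u v Ω₁ Ω₂ → BddBox 𝒯 R u → BddBox 𝒯 R v → UpRay m R Ω₁ → RightRay m R Ω₂ →
      NearAxis m R Ω₂ → ∀ x y : Pl, 0 ≤ x.1 → x.1 ≤ a → 0 ≤ x.2 → x.2 ≤ b → |y.1| ≤ Y₀ → 0 ≤ y.2 →
      dot x y - C * m ≤ u x + v y := by
  set X := 16 * a with hX
  set Y₁ := 2 * 𝒯 X / X with hY₁
  set R₁ := 𝒯 (Y₁ + 1) with hR₁
  set ρ := a + b + R₁ with hρ
  set N := R₁ / a with hN
  set Y₂ := 𝒯 (ρ + 1) + 2 * 𝒯 (ρ + 1) * N with hY₂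
  set C₁ := 2 * (𝒯 (Y₂ + 2) + ρ) + ρ * (Y₂ + 2) with hC₁
  have hR₁1 : 1 ≤ R₁ := h𝒯 _
  have hXp : 0 < X := by positivity
  have hT0 := h𝒯 X
  have hY₁p : 0 < Y₁ := by positivity
  have hρp : 0 < ρ := by positivity
  have hNp : 0 < N := by positivity
  have hT2 := h𝒯 (ρ + 1)
  have hY₂p : 0 < Y₂ := by positivity
  have hT3 := h𝒯 (Y₂ + 2)
  have hC₁p : 0 < C₁ := by positivity
  refine ⟨X + (Y₁ + 1) + (ρ + 1) + (Y₂ + 2) + 3 * (b + 2 * R₁),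
    1 + 2 * b * (𝒯 (ρ + 1) + Y₀) + (C₁ + 1 + R₁ * Y₀) + R₁ / a + 2 * N + b / a, ?_, ?_⟩
  · have : 0 ≤ 2 * b * (𝒯 (ρ + 1) + Y₀) + (C₁ + 1 + R₁ * Y₀) + R₁ / a + 2 * N + b / a := by positivity
    linarith
  intro R hR u v Ω₁ Ω₂ m hm0 hCm H hbu hbv hU hRr hZ x y hx1 hx1' hx2 hx2' hy1 hy2
  have p1 : 0 ≤ 2 * b * (𝒯 (ρ + 1) + Y₀) * m := by positivity
  have p2 : 0 ≤ (C₁ + 1 + R₁ * Y₀) * m := by positivity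
  have p3 : 0 ≤ R₁ / a * m := by positivity
  have p4 : 0 ≤ 2 * N * m := by positivity
  have p5 : 0 ≤ b / a * m := by positivity
  have hexp : (1 + 2 * b * (𝒯 (ρ + 1) + Y₀) + (C₁ + 1 + R₁ * Y₀) + R₁ / a + 2 * N + b / a) * m
    = m + 2 * b * (𝒯 (ρ + 1) + Y₀) * m + (C₁ + 1 + R₁ * Y₀) * m + R₁ / a * m + 2 * N * m + b / a * m := by
    ring
  rw [hexp] at hCm ⊢
  have hm1 : m ≤ 1 := by linarith
  have hmR : m * R₁ ≤ a := by
    have : R₁ / a * m ≤ 1 := by linarith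
    rw [div_mul_eq_mul_div, div_le_one ha] at this; linarith
  have hmN : m * N ≤ 1 / 2 := by linarith
  have hmb : m * b ≤ a := by
    have : b / a * m ≤ 1 := by linarith
    rw [div_mul_eq_mul_div, div_le_one ha] at this; linarith
  obtain ⟨xs, hxs, hxs1, -, hxs2⟩ := H.exists_far hbu hbv h𝒯 (X := X) (m := m) hXp (by linarith)
    (by linarith) hm1 (by rw [← hY₁, ← hR₁]; linarith) hRr
  rw [← hY₁, ← hR₁] at hxs2
  obtain ⟨κ, hκ, hray⟩ := id hU
  have hκx : |κ * x.2| ≤ m * b := by rw [abs_mul, abs_of_nonneg hx2]; gcongr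
  have hκxs : |κ * xs.2| ≤ m * R₁ := by rw [abs_mul]; gcongr
  rw [abs_le] at hκx hκxs
  rcases le_or_gt (x.1 - κ * x.2) 0 with hle | hgt
  · have := H.fen_axis hbu (ρ := ρ) (m := m) (b := b) (by linarith) (by linarith) (by linarith) hm1 hU
      (x := x) (y := y) (by rw [abs_of_nonneg hx1]; linarith) hx2 hx2' hy1
    linarith
  · have hXs : 3 * a ≤ xs.1 - κ * xs.2 := by linarith
    have hX2 : x.1 - κ * x.2 ≤ 2 * a := by linarith
    set c := fun s : ℝ => x + ((κ * s, s) : Pl) with hc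
    have hcc : Continuous c := by fun_prop
    have hcl : IsClosed (c ⁻¹' closure Ω₁ ∩ Icc 0 R₁) :=
      (isClosed_closure.preimage hcc).inter isClosed_Icc
    have hcomp : IsCompact (c ⁻¹' closure Ω₁ ∩ Icc 0 R₁) := isCompact_Icc.inter_left
      (isClosed_closure.preimage hcc)
    have hmem : R₁ ∈ c ⁻¹' closure Ω₁ ∩ Icc 0 R₁ := by
      refine ⟨?_, by linarith, le_rfl⟩
      set Xs := xs.1 - κ * xs.2 with hXsd
      set t := (x.1 - κ * x.2) / Xs with ht
      have hXsp : 0 < Xs := by linarith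
      have ht0 : 0 ≤ t := by positivity
      have ht1 : t ≤ 2 / 3 := by rw [ht, div_le_iff₀ hXsp]; linarith
      have htX : t * Xs = x.1 - κ * x.2 := div_mul_cancel₀ _ hXsp.ne'
      set σ := (x.2 + R₁ - t * xs.2) / (1 - t) with hσ
      have h1t : 0 < 1 - t := by linarith
      have hσt : σ * (1 - t) = x.2 + R₁ - t * xs.2 := div_mul_cancel₀ _ h1t.ne'
      have htx : |t * xs.2| ≤ R₁ := by
        rw [abs_mul, abs_of_nonneg ht0]
        calc t * |xs.2| ≤ 1 * R₁ := by gcongr; linarith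
          _ = R₁ := one_mul _
      rw [abs_le] at htx
      have hσ0 : 0 ≤ σ := div_nonneg (by linarith) h1t.le
      have hσR : σ ≤ R := by
        rw [hσ, div_le_iff₀ h1t]
        have : 3 * (b + 2 * R₁) * (1 / 3) ≤ R * (1 - t) := by
          apply mul_le_mul <;> linarith
        linarith
      have := H.o1.closure hxs (hray σ ⟨hσ0, hσR⟩) ht0 h1t.le (by ring)
      have e : t • xs + (1 - t) • ((κ * σ, σ) : Pl) = c R₁ := by
        ext
        · simp [hc]; linear_combination htX + κ * hσt
        · simp [hc]; linear_combination hσt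
      rw [e] at this
      exact this
    obtain ⟨s₀, ⟨hs₀m, hs₀⟩, hmin⟩ := hcomp.exists_isMinOn ⟨R₁, hmem⟩ continuousOn_id
    have hmin' : ∀ s, 0 ≤ s → s < s₀ → c s ∉ closure Ω₁ := by
      intro s hs hlt hcs
      have : s₀ ≤ s := hmin ⟨hcs, hs, by linarith [hs₀.2]⟩
      linarith
    have hcomp2 : u (c s₀) - (C₁ + 1) * m ≤ u x := by
      rcases hs₀.1.eq_or_lt with h0 | h0
      · have : c s₀ = x := by rw [← h0]; simp [hc]
        rw [this]; linarith [mul_nonneg (add_nonneg hC₁p.le zero_le_one) hm0.le]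
      · have hcont : ContinuousAt (fun s => u (c s)) s₀ :=
          (H.continuous_left.comp hcc).continuousAt
        have hev : ∀ᶠ s in 𝓝[<] s₀, u (c s₀) - m < u (c s) :=
          (hcont.eventually (lt_mem_nhds (by linarith))).filter_mono nhdsWithin_le_nhds
        have hev2 : ∀ᶠ s in 𝓝[<] s₀, s ∈ Ioo 0 s₀ := Ioo_mem_nhdsLT h0
        obtain ⟨s, hs1, hs2⟩ := (hev.and hev2).exists
        have hs0 := hs2.1.le
        have hsR : s ≤ R₁ := by linarith [hs2.2, hs₀.2]
        obtain ⟨ν, hν0, hνN, hsep⟩ := exists_separating_slope H.o1.closure isClosed_closure H.z1 ha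
          (R := R) (b := b) (R₁ := R₁) (by linarith) (by linarith) hray hxs hXs hxs2 hgt hX2 hx2 hx2' hs0 hsR
          (hmin' s hs0 hs2.2)
        have hκs : |κ * s| ≤ R₁ := by
          rw [abs_mul, abs_of_nonneg hs0]
          calc |κ| * s ≤ 1 * R₁ := by gcongr; linarith
            _ = R₁ := one_mul _
        rw [abs_le] at hκs
        have := H.le_of_notMem hbu hbv h𝒯 (N := N) (ρ := ρ) (Y₂ := Y₂) hκ hm1 hNp.le hmN (by linarith) le_rfl
          (by linarith) hs0 (by linarith) (by rw [abs_le]; constructor <;> linarith)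
          (by rw [abs_le]; constructor <;> linarith) hν0 hνN hsep hZ
        have h3 : u (c s) - C₁ * m ≤ u x := this
        linarith
    have hf := H.fenB _ hs₀m y
    have e : dot (c s₀) y = dot x y + s₀ * (κ * y.1 + y.2) := by simp [dot, hc]; ring
    have h5 : -(R₁ * Y₀ * m) ≤ s₀ * (κ * y.1 + y.2) := by
      have h6 : |s₀ * (κ * y.1)| ≤ R₁ * (m * Y₀) := by
        rw [abs_mul, abs_mul, abs_of_nonneg hs₀.1]
        gcongr; exact hs₀.2
      have := (abs_le.1 h6).1
      have := mul_nonneg hs₀.1 hy2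
      linarith
    linarith

/-- Reflection of the first coordinate. -/
def refl1 (x : Pl) : Pl := (-x.1, x.2)

@[simp] theorem refl1_fst (x : Pl) : (refl1 x).1 = -x.1 := rfl
@[simp] theorem refl1_snd (x : Pl) : (refl1 x).2 = x.2 := rfl

theorem closure_swap_preimage (Ω : Set Pl) : closure (Prod.swap ⁻¹' Ω) = Prod.swap ⁻¹' closure Ω :=
  ((Homeomorph.prodComm ℝ ℝ).preimage_closure Ω).symm

theorem closure_refl1_preimage (Ω : Set Pl) : closure (refl1 ⁻¹' Ω) = refl1 ⁻¹' closure Ω := by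
  have h : (refl1 : Pl → Pl) = (Homeomorph.neg ℝ).prodCongr (Homeomorph.refl ℝ) := rfl
  rw [h]
  exact (Homeomorph.preimage_closure _ _).symm

namespace Core
variable {u v : Pl → ℝ} {Ω₁ Ω₂ : Set Pl}

/-- Exchange both the roles of the potentials and the two coordinates. -/
theorem swapCoord (H : Core dot u v Ω₁ Ω₂) : Core dot (fun Y => v Y.swap) (fun X => u X.swap)
    (Prod.swap ⁻¹' Ω₂) (Prod.swap ⁻¹' Ω₁) := by
  have h : (0 : ℝ) * 0 - 1 * 1 ≠ 0 := by norm_num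
  have := (H.swap dot_comm).pullback (dF := dot) (T := matEquiv 0 1 1 0 h) (T' := matEquiv 0 1 1 0 h) one_pos
    dot_comm dot_comm (fun X Y => by simp [dot]; ring) (fun s => by rw [volume_matEquiv_image]; norm_num)
    (fun s => by rw [volume_matEquiv_image]; norm_num)
  have e : (matEquiv 0 1 1 0 h : Pl → Pl) = Prod.swap := by
    funext x; ext <;> simp
  simpa only [div_one, e] using this

/-- Reflect the first coordinate. -/
theorem refl1 (H : Core dot u v Ω₁ Ω₂) : Core dot (fun X => u (refl1 X)) (fun Y => v (refl1 Y))
    (_root_.refl1 ⁻¹' Ω₁) (_root_.refl1 ⁻¹' Ω₂) := by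
  have h : (-1 : ℝ) * 1 - 0 * 0 ≠ 0 := by norm_num
  have := H.pullback (dF := dot) (T := matEquiv (-1) 0 0 1 h) (T' := matEquiv (-1) 0 0 1 h) one_pos
    dot_comm dot_comm (fun X Y => by simp [dot]) (fun s => by rw [volume_matEquiv_image]; norm_num)
    (fun s => by rw [volume_matEquiv_image]; norm_num)
  have e : (matEquiv (-1) 0 0 1 h : Pl → Pl) = _root_.refl1 := by
    funext x; ext <;> simp
  simpa only [div_one, e] using this

end Core

theorem BddBox.swap {𝒯 : ℝ → ℝ} {R : ℝ} {u : Pl → ℝ} (h : BddBox 𝒯 R u) :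
    BddBox 𝒯 R fun x => u x.swap := fun ρ hρ x h1 h2 => h ρ hρ x.swap h2 h1

theorem BddBox.refl1 {𝒯 : ℝ → ℝ} {R : ℝ} {u : Pl → ℝ} (h : BddBox 𝒯 R u) :
    BddBox 𝒯 R fun x => u (refl1 x) := fun ρ hρ x h1 h2 => h ρ hρ (_root_.refl1 x) (by simpa using h1) h2

theorem RightRay.swap {m R : ℝ} {Ω : Set Pl} (h : RightRay m R Ω) : UpRay m R (Prod.swap ⁻¹' Ω) := by
  obtain ⟨κ, hκ, hr⟩ := h
  refine ⟨κ, hκ, fun s hs => ?_⟩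
  rw [closure_swap_preimage]; exact hr s hs

theorem UpRay.swap {m R : ℝ} {Ω : Set Pl} (h : UpRay m R Ω) : RightRay m R (Prod.swap ⁻¹' Ω) := by
  obtain ⟨κ, hκ, hr⟩ := h
  refine ⟨κ, hκ, fun s hs => ?_⟩
  rw [closure_swap_preimage]; exact hr s hs

theorem UpRay.refl1 {m R : ℝ} {Ω : Set Pl} (h : UpRay m R Ω) : UpRay m R (refl1 ⁻¹' Ω) := by
  obtain ⟨κ, hκ, hr⟩ := h
  refine ⟨-κ, by rwa [abs_neg], fun s hs => ?_⟩
  rw [closure_refl1_preimage]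
  have : _root_.refl1 (-κ * s, s) = (κ * s, s) := by ext <;> simp
  rw [mem_preimage, this]; exact hr s hs

theorem RightRay.mono {m m' R R' : ℝ} {Ω : Set Pl} (h : RightRay m R Ω) (hm : m ≤ m') (hR : R' ≤ R) :
    RightRay m' R' Ω := by
  obtain ⟨κ, hκ, hr⟩ := h
  exact ⟨κ, hκ.trans hm, fun s hs => hr s ⟨hs.1, hs.2.trans hR⟩⟩

theorem UpRay.mono {m m' R R' : ℝ} {Ω : Set Pl} (h : UpRay m R Ω) (hm : m ≤ m') (hR : R' ≤ R) :
    UpRay m' R' Ω := by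
  obtain ⟨κ, hκ, hr⟩ := h
  exact ⟨κ, hκ.trans hm, fun s hs => hr s ⟨hs.1, hs.2.trans hR⟩⟩

/-- The Fenchel inequality is almost true near the horizontal axis when the second domain contains
an almost horizontal segment. -/
theorem Core.fen_bottom {u v : Pl → ℝ} {Ω₁ Ω₂ : Set Pl} {𝒯 : ℝ → ℝ} {R : ℝ} (H : Core dot u v Ω₁ Ω₂)
    (hb : BddBox 𝒯 R v) {ρ m b Y₀ : ℝ} (hρ : ρ + 1 ≤ R)
    (hT : 0 ≤ 𝒯 (ρ + 1)) (hbρ : b ≤ ρ) (hm1 : m ≤ 1) (hU : RightRay m R Ω₂) {x y : Pl}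
    (hy2 : |y.2| ≤ m * b) (hy1 : 0 ≤ y.1) (hy1' : y.1 ≤ b)
    (hx : |x.2| ≤ Y₀) : dot x y - 2 * b * (𝒯 (ρ + 1) + Y₀) * m ≤ u x + v y := by
  have := H.swapCoord.fen_axis hb.swap hρ hT hbρ hm1 hU.swap (x := y.swap) (y := x.swap) hy2 hy1 hy1' hx
  simp only [Prod.swap_swap] at this
  have e : dot y.swap x.swap = dot x y := by simp [dot]; ring
  rw [e] at this; linarith

/-- The barrier used above the cut `x₂ = -s`. -/
def barW (k M s τ T : ℝ) (x : Pl) : ℝ :=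
  k / 2 * (x.1 ^ 2 / M + M * (max (x.2 + s) 0) ^ 2) + τ * x.2 - T

/-- The barrier without a cut. -/
def barV (k M T : ℝ) (x : Pl) : ℝ := k / 2 * (x.1 ^ 2 / M + M * x.2 ^ 2) - T

theorem exit_box {l₁ r₁ l₂ r₂ : ℝ} (h1 : l₁ < r₁) (h2 : l₂ < r₂) :
    closure (Ioo l₁ r₁ ×ˢ Ioo l₂ r₂) = Icc l₁ r₁ ×ˢ Icc l₂ r₂ ∧
    ∀ z ∈ closure (Ioo l₁ r₁ ×ˢ Ioo l₂ r₂) \ (Ioo l₁ r₁ ×ˢ Ioo l₂ r₂),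
      z.1 = l₁ ∨ z.1 = r₁ ∨ z.2 = l₂ ∨ z.2 = r₂ := by
  have e : closure (Ioo l₁ r₁ ×ˢ Ioo l₂ r₂) = Icc l₁ r₁ ×ˢ Icc l₂ r₂ := by
    rw [closure_prod_eq, closure_Ioo h1.ne, closure_Ioo h2.ne]
  refine ⟨e, ?_⟩
  rw [e]
  rintro z ⟨⟨⟨a1, a2⟩, a3, a4⟩, hz⟩
  by_contra hcon
  push Not at hcon
  obtain ⟨c1, c2, c3, c4⟩ := hcon
  exact hz ⟨⟨lt_of_le_of_ne a1 (Ne.symm c1), lt_of_le_of_ne a2 c2⟩, lt_of_le_of_ne a3 (Ne.symm c3),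
    lt_of_le_of_ne a4 c4⟩

theorem Core.exists_path_barW {u v : Pl → ℝ} {Ω₁ Ω₂ : Set Pl} (H : Core dot u v Ω₁ Ω₂)
    {k M s τ T l₁ r₁ l₂ r₂ : ℝ} {p : Pl} (hk : 1 < k) (hM : 0 < M)
    (hp1 : p.1 ∈ Ioo l₁ r₁) (hp2 : p.2 ∈ Ioo l₂ r₂) (hps : -s < p.2)
    (hΩ : ∀ x ∈ Ω₁, x.1 ∈ Ioo l₁ r₁ → x.2 ∈ Ioo l₂ r₂ → -s < x.2) (hup : u p < barW k M s τ T p) :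
    ∃ z, JoinedIn {x | x ∈ Icc l₁ r₁ ×ˢ Icc l₂ r₂ ∧ u x < barW k M s τ T x} p z ∧
      (z.1 = l₁ ∨ z.1 = r₁ ∨ z.2 = l₂ ∨ z.2 = r₂) := by
  obtain ⟨e, he⟩ := exit_box (hp1.1.trans hp1.2) (hp2.1.trans hp2.2)
  obtain ⟨z, hz, hj⟩ := H.exists_exit (O := Ioo l₁ r₁ ×ˢ Ioo l₂ r₂) (Hs := {x | -s < x.2})
    (W := barW k M s τ T) (m₁ := k / M) (m₂ := k * M) (γ := k * M * s + τ)
    (isOpen_Ioo.prod isOpen_Ioo) ((convex_Ioo _ _).prod (convex_Ioo _ _))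
    ((isBounded_Ioo _ _).prod (isBounded_Ioo _ _)) (by unfold barW; fun_prop)
    (by have : k / M * (k * M) = k * k := by field_simp
        rw [this]; nlinarith)
    (isOpen_lt continuous_const continuous_snd)
    (by
      intro x₀ hx₀ _ x _
      have hx₀ : -s < x₀.2 := hx₀
      have h1 : (x₀.2 + s) ^ 2 + 2 * (x₀.2 + s) * (x.2 - x₀.2) ≤ (max (x.2 + s) 0) ^ 2 := by
        rcases le_total 0 (x.2 + s) with h | h
        · rw [max_eq_left h]; nlinarith [sq_nonneg (x.2 - x₀.2)]
        · rw [max_eq_right h]; nlinarith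
      have h2 : x₀.1 ^ 2 / M + 2 * (x₀.1 / M) * (x.1 - x₀.1) ≤ x.1 ^ 2 / M := by
        have : 0 ≤ (x.1 - x₀.1) ^ 2 / M := by positivity
        have e : x.1 ^ 2 / M = x₀.1 ^ 2 / M + 2 * (x₀.1 / M) * (x.1 - x₀.1) + (x.1 - x₀.1) ^ 2 / M := by
          field_simp; ring
        linarith
      have h3 : k / 2 * ((x₀.1 ^ 2 / M + 2 * (x₀.1 / M) * (x.1 - x₀.1)) +
          M * ((x₀.2 + s) ^ 2 + 2 * (x₀.2 + s) * (x.2 - x₀.2))) ≤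
          k / 2 * (x.1 ^ 2 / M + M * (max (x.2 + s) 0) ^ 2) := by gcongr
      simp only [barW, dot, max_eq_left (by linarith : 0 ≤ x₀.2 + s), Prod.fst_sub, Prod.snd_sub]
      have e : k / M * x₀.1 = k * (x₀.1 / M) := by ring
      rw [e]
      linarith)
    (fun x hx => hΩ x hx.1 hx.2.1 hx.2.2) ⟨hp1, hp2⟩ hps hup
  rw [e] at hj
  exact ⟨z, hj, he z hz⟩

theorem Core.exists_path_barV {u v : Pl → ℝ} {Ω₁ Ω₂ : Set Pl} (H : Core dot u v Ω₁ Ω₂)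
    {k M T l₁ r₁ l₂ r₂ : ℝ} {p : Pl} (hk : 1 < k) (hM : 0 < M)
    (hp1 : p.1 ∈ Ioo l₁ r₁) (hp2 : p.2 ∈ Ioo l₂ r₂) (hup : u p < barV k M T p) :
    ∃ z, JoinedIn {x | x ∈ Icc l₁ r₁ ×ˢ Icc l₂ r₂ ∧ u x < barV k M T x} p z ∧
      (z.1 = l₁ ∨ z.1 = r₁ ∨ z.2 = l₂ ∨ z.2 = r₂) := by
  obtain ⟨e, he⟩ := exit_box (hp1.1.trans hp1.2) (hp2.1.trans hp2.2)
  obtain ⟨z, hz, hj⟩ := H.exists_exit (O := Ioo l₁ r₁ ×ˢ Ioo l₂ r₂) (Hs := univ)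
    (W := barV k M T) (m₁ := k / M) (m₂ := k * M) (γ := 0)
    (isOpen_Ioo.prod isOpen_Ioo) ((convex_Ioo _ _).prod (convex_Ioo _ _))
    ((isBounded_Ioo _ _).prod (isBounded_Ioo _ _)) (by unfold barV; fun_prop)
    (by have : k / M * (k * M) = k * k := by field_simp
        rw [this]; nlinarith)
    isOpen_univ
    (by
      intro x₀ _ _ x _
      have h1 : x₀.2 ^ 2 + 2 * x₀.2 * (x.2 - x₀.2) ≤ x.2 ^ 2 := by nlinarith [sq_nonneg (x.2 - x₀.2)]
      have h2 : x₀.1 ^ 2 / M + 2 * (x₀.1 / M) * (x.1 - x₀.1) ≤ x.1 ^ 2 / M := by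
        have : 0 ≤ (x.1 - x₀.1) ^ 2 / M := by positivity
        have e : x.1 ^ 2 / M = x₀.1 ^ 2 / M + 2 * (x₀.1 / M) * (x.1 - x₀.1) + (x.1 - x₀.1) ^ 2 / M := by
          field_simp; ring
        linarith
      have h3 : k / 2 * ((x₀.1 ^ 2 / M + 2 * (x₀.1 / M) * (x.1 - x₀.1)) +
          M * (x₀.2 ^ 2 + 2 * x₀.2 * (x.2 - x₀.2))) ≤
          k / 2 * (x.1 ^ 2 / M + M * x.2 ^ 2) := by gcongr
      simp only [barV, dot, Prod.fst_sub, Prod.snd_sub]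
      have e : k / M * x₀.1 = k * (x₀.1 / M) := by ring
      rw [e]
      linarith)
    (subset_univ _) ⟨hp1, hp2⟩ (mem_univ _) hup
  rw [e] at hj
  exact ⟨z, hj, he z hz⟩

theorem barW_le {k M s τ θ b : ℝ} {x : Pl} (hk : 1 ≤ k) (hkτ : k - 1 ≤ τ) (hM : 0 < M) (hs : 0 ≤ s)
    (hs1 : s ≤ 1) (hMs : 3 * M * s ≤ τ) (hτ : 3 * τ ≤ θ) (hb : b ≤ 1) (hτ1 : τ ≤ 1)
    (hx1 : x.1 ^ 2 / M ≤ 1 / 2) (hMb : M * b ^ 2 ≤ 1 / 2) (hb0 : 0 ≤ b) (hx2 : x.2 ≤ b) :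
    barW k M s τ (4 * θ) x ≤ (x.1 ^ 2 / M + M * (max x.2 0) ^ 2) / 2 - 3 * θ := by
  have hτ0 : 0 ≤ τ := by linarith
  set ξ := max x.2 0 with hξ
  have hξ0 : 0 ≤ ξ := le_max_right _ _
  have hξb : ξ ≤ b := max_le hx2 hb0
  have hmax : max (x.2 + s) 0 ≤ ξ + s := max_le (by linarith [le_max_left x.2 0]) (by linarith)
  have h0 : 0 ≤ max (x.2 + s) 0 := le_max_right _ _
  have h1 : (max (x.2 + s) 0) ^ 2 ≤ ξ ^ 2 + 3 * s := by nlinarith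
  have h2 : M * (max (x.2 + s) 0) ^ 2 ≤ M * ξ ^ 2 + τ := by nlinarith
  have h3 : M * ξ ^ 2 ≤ 1 / 2 := by
    have : M * ξ ^ 2 ≤ M * b ^ 2 := by gcongr
    linarith
  have h4 : 0 ≤ x.1 ^ 2 / M := by positivity
  have h5 : 0 ≤ M * (max (x.2 + s) 0) ^ 2 := by positivity
  set q := x.1 ^ 2 / M + M * (max (x.2 + s) 0) ^ 2 with hq
  have h6 : (k - 1) * q ≤ τ * 2 := by apply mul_le_mul <;> linarith
  have h7 : τ * x.2 ≤ τ := by nlinarith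
  unfold barW
  rw [← hq]
  nlinarith

theorem barV_le {k M τ θ : ℝ} {x : Pl} (hk : 1 ≤ k) (hkτ : k - 1 ≤ τ) (hM : 0 < M) (hτ : 3 * τ ≤ θ)
    (hx1 : x.1 ^ 2 / M ≤ 1 / 2) (hx2 : M * x.2 ^ 2 ≤ 1 / 2) :
    barV k M (4 * θ) x ≤ (x.1 ^ 2 / M + M * x.2 ^ 2) / 2 - 3 * θ := by
  have h4 : 0 ≤ x.1 ^ 2 / M := by positivity
  have h5 : 0 ≤ M * x.2 ^ 2 := by positivity
  have h6 : (k - 1) * (x.1 ^ 2 / M + M * x.2 ^ 2) ≤ τ * 1 := by apply mul_le_mul <;> linarith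
  unfold barV
  nlinarith

/-- Elementary relations between the geometric constants of a window. -/
structure Geo (θ c a M b k s τ B : ℝ) : Prop where
  c0 : 0 < c
  c1 : c ≤ 1
  ca : 11 ≤ c * a
  a0 : 0 < a
  M0 : 0 < M
  b0 : 0 < b
  b1 : b ≤ 1
  Mb : M * b ^ 2 ≤ 1 / 2
  aMb : a < M * b
  aM : a ^ 2 / M ≤ 1 / 2
  k1 : 1 < k
  kτ : k - 1 ≤ τ
  s0 : 0 < s
  s1 : s ≤ 1
  sM : 3 * M * s ≤ τ
  τ0 : 0 < τ
  τ1 : τ ≤ 1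
  τθ : 3 * τ ≤ θ
  B0 : 0 < B
  sB : s ≤ B
  τB : 1 ≤ τ * B

/-- A normalized pair: bounds on boxes, on the unit scale, and on a short segment of each axis. -/
structure Win (θ c p R : ℝ) (𝒯 : ℝ → ℝ) (u v : Pl → ℝ) (Ω₁ Ω₂ : Set Pl) : Prop where
  core : Core dot u v Ω₁ Ω₂
  bu : BddBox 𝒯 R u
  bv : BddBox 𝒯 R v
  u8 : ∀ x : Pl, |x.1| ≤ c → |x.2| ≤ c → u x ≤ 8
  v8 : ∀ x : Pl, |x.1| ≤ c → |x.2| ≤ c → v x ≤ 8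
  uin : ∀ s, |s| ≤ p → u (s, 0) ≤ θ
  vin : ∀ s, |s| ≤ p → v (0, s) ≤ θ

/-- Inside the box of half-width `R`, `closure Ω` lies above the height `-m`. -/
def CutLow (m R : ℝ) (Ω : Set Pl) : Prop := ∀ x ∈ closure Ω, |x.1| ≤ R → |x.2| ≤ R → -m ≤ x.2

/-- Inside the box of half-width `R`, `closure Ω` lies to the right of the abscissa `-m`. -/
def CutLeft (m R : ℝ) (Ω : Set Pl) : Prop := ∀ x ∈ closure Ω, |x.1| ≤ R → |x.2| ≤ R → -m ≤ x.1

/-- Approximate Fenchel inequalities, with error `θ`. -/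
structure Fen (θ a b Y₀ : ℝ) (u v : Pl → ℝ) : Prop where
  right : ∀ x y : Pl, 0 ≤ x.1 → x.1 ≤ a → 0 ≤ x.2 → x.2 ≤ b → |y.1| ≤ b → 0 ≤ y.2 →
    dot x y - θ ≤ u x + v y
  axis : ∀ x y : Pl, x.1 = 0 → 0 ≤ x.2 → x.2 ≤ b → |y.1| ≤ Y₀ → dot x y - θ ≤ u x + v y
  bottom : ∀ x y : Pl, y.2 = 0 → 0 ≤ y.1 → y.1 ≤ b → |x.2| ≤ Y₀ → dot x y - θ ≤ u x + v y

theorem Win.swapCoord {θ c p R : ℝ} {𝒯 : ℝ → ℝ} {u v : Pl → ℝ} {Ω₁ Ω₂ : Set Pl}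
    (W : Win θ c p R 𝒯 u v Ω₁ Ω₂) : Win θ c p R 𝒯 (fun Y => v Y.swap) (fun X => u X.swap)
    (Prod.swap ⁻¹' Ω₂) (Prod.swap ⁻¹' Ω₁) where
  core := W.core.swapCoord
  bu := W.bv.swap
  bv := W.bu.swap
  u8 := fun x h1 h2 => W.v8 x.swap h2 h1
  v8 := fun x h1 h2 => W.u8 x.swap h2 h1
  uin := fun s hs => W.vin s hs
  vin := fun s hs => W.uin s hs

theorem Win.refl1 {θ c p R : ℝ} {𝒯 : ℝ → ℝ} {u v : Pl → ℝ} {Ω₁ Ω₂ : Set Pl}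
    (W : Win θ c p R 𝒯 u v Ω₁ Ω₂) : Win θ c p R 𝒯 (fun X => u (refl1 X)) (fun Y => v (refl1 Y))
    (_root_.refl1 ⁻¹' Ω₁) (_root_.refl1 ⁻¹' Ω₂) where
  core := W.core.refl1
  bu := W.bu.refl1
  bv := W.bv.refl1
  u8 := fun x h1 h2 => W.u8 (_root_.refl1 x) (by simpa using h1) h2
  v8 := fun x h1 h2 => W.v8 (_root_.refl1 x) (by simpa using h1) h2
  uin := fun s hs => W.uin (-s) (by simpa using hs)
  vin := fun s hs => by
    have : _root_.refl1 (0, s) = (0, s) := by ext <;> simp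
    rw [this]; exact W.vin s hs

theorem CutLeft.swap {m R : ℝ} {Ω : Set Pl} (h : CutLeft m R Ω) : CutLow m R (Prod.swap ⁻¹' Ω) := by
  intro x hx h1 h2
  rw [closure_swap_preimage] at hx
  exact h x.swap hx h2 h1

theorem CutLow.swap {m R : ℝ} {Ω : Set Pl} (h : CutLow m R Ω) : CutLeft m R (Prod.swap ⁻¹' Ω) := by
  intro x hx h1 h2
  rw [closure_swap_preimage] at hx
  exact h x.swap hx h2 h1

theorem NearAxis.of_cutLeft {m R : ℝ} {Ω : Set Pl} (hR : 1 ≤ R) (hm : 0 ≤ m)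
    (h0 : (0 : Pl) ∈ closure Ω)
    (hr : RightRay (m / R) R Ω) (hc : CutLeft m R Ω) : NearAxis m R Ω := by
  intro y hy h1 h2 Y hY hYR
  rcases le_total 0 Y with h | h
  · obtain ⟨κ, hκ, hz⟩ := hr
    refine ⟨_, hz Y ⟨h, (le_abs_self _).trans hYR⟩, by simpa using hm, ?_⟩
    rw [abs_mul]
    calc |κ| * |Y| ≤ m / R * R := by gcongr
      _ = m := by field_simp
  · refine ⟨0, h0, ?_, by simpa using hm⟩
    have := hc y hy h1 h2
    simp only [Prod.fst_zero, zero_sub, abs_neg]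
    rw [abs_le]; constructor <;> linarith

theorem NearAxis.of_rays {m R : ℝ} {Ω : Set Pl} (hR : 1 ≤ R) (hm : 0 ≤ m)
    (hr : RightRay (m / R) R Ω) (hl : RightRay (m / R) R (refl1 ⁻¹' Ω)) : NearAxis m R Ω := by
  intro y hy h1 h2 Y hY hYR
  rcases le_total 0 Y with h | h
  · obtain ⟨κ, hκ, hz⟩ := hr
    refine ⟨_, hz Y ⟨h, (le_abs_self _).trans hYR⟩, by simpa using hm, ?_⟩
    rw [abs_mul]
    calc |κ| * |Y| ≤ m / R * R := by gcongr
      _ = m := by field_simp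
  · obtain ⟨κ, hκ, hz⟩ := hl
    have := hz (-Y) ⟨by linarith, by rw [abs_of_nonpos h] at hYR; exact hYR⟩
    rw [closure_refl1_preimage] at this
    refine ⟨_, this, by simpa using hm, ?_⟩
    simp only [refl1_snd, mul_neg, abs_neg]
    rw [abs_mul]
    calc |κ| * |Y| ≤ m / R * R := by gcongr
      _ = m := by field_simp

/-- The approximate Fenchel inequalities hold once the segments are long and flat enough. -/
theorem exists_fen {𝒯 : ℝ → ℝ} (h𝒯 : ∀ ρ, 1 ≤ 𝒯 ρ) {θ a b Y₀ : ℝ} (hθ : 0 < θ) (ha : 0 < a)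
    (hb : 0 < b) (hY : 0 < Y₀) : ∃ R₀ m₀, 1 ≤ R₀ ∧ 0 < m₀ ∧ ∀ R ≥ R₀, ∀ u v Ω₁ Ω₂ m, 0 < m → m ≤ m₀ →
      Core dot u v Ω₁ Ω₂ → BddBox 𝒯 R u → BddBox 𝒯 R v → UpRay (m / R) R Ω₁ →
      RightRay (m / R) R Ω₂ → NearAxis m R Ω₂ → Fen θ a b Y₀ u v := by
  obtain ⟨R₀, C, hC, key⟩ := fen_right h𝒯 ha hb hb.le
  have h1 := h𝒯 (b + 1)
  have hD : 0 < 2 * b * (𝒯 (b + 1) + Y₀) := by positivity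
  refine ⟨max R₀ (b + 1), min (min 1 (1 / C)) (min (θ / C) (θ / (2 * b * (𝒯 (b + 1) + Y₀)))),
    le_max_of_le_right (by linarith), by positivity, ?_⟩
  intro R hR u v Ω₁ Ω₂ m hm hm₀ H bu bv hU hRt hN
  have hR1 := (le_max_left _ _).trans hR
  have hR2 := (le_max_right _ _).trans hR
  have hm1 : m ≤ 1 := hm₀.trans ((min_le_left _ _).trans (min_le_left _ _))
  have hm2 : m ≤ 1 / C := hm₀.trans ((min_le_left _ _).trans (min_le_right _ _))
  have hm3 : m ≤ θ / C := hm₀.trans ((min_le_right _ _).trans (min_le_left _ _))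
  have hm4 : m ≤ θ / (2 * b * (𝒯 (b + 1) + Y₀)) :=
    hm₀.trans ((min_le_right _ _).trans (min_le_right _ _))
  rw [le_div_iff₀ (by linarith)] at hm2 hm3
  rw [le_div_iff₀ hD] at hm4
  have hmR : m / R ≤ m := div_le_self hm.le (by linarith)
  have hU' := hU.mono hmR le_rfl
  have hRt' := hRt.mono hmR le_rfl
  refine ⟨fun x y a1 a2 a3 a4 a5 a6 => ?_, fun x y a1 a2 a3 a4 => ?_, fun x y a1 a2 a3 a4 => ?_⟩
  · have := key R hR1 u v Ω₁ Ω₂ m hm (by linarith) H bu bv hU' hRt' hN x y a1 a2 a3 a4 a5 a6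
    linarith
  · have := H.fen_axis bu hR2 (by linarith) le_rfl hm1 hU' (x := x) (by rw [a1, abs_zero]; positivity) a2 a3 a4
    linarith
  · have := H.fen_bottom bv hR2 (by linarith) le_rfl hm1 hRt' (y := y) (by rw [a1, abs_zero]; positivity) a2 a3 a4
    linarith

/-- The part of the box under the barrier `barW`. -/
def setW (θ a M b k s τ B l₁ : ℝ) (u : Pl → ℝ) : Set Pl :=
  {x | x ∈ Icc l₁ a ×ˢ Icc (-B) b ∧ u x < barW k M s τ (4 * θ) x}

namespace Win
variable {θ c p R a M b k s τ B : ℝ} {𝒯 : ℝ → ℝ} {u v : Pl → ℝ} {Ω₁ Ω₂ : Set Pl}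

theorem blocked (W : Win θ c p R 𝒯 u v Ω₁ Ω₂) (G : Geo θ c a M b k s τ B) {m : ℝ} (hm : m ≤ 1)
    (hmB : (B + 1) * m ≤ 1) (hcR : c ≤ R) (hr : RightRay m R Ω₂) {x : Pl} (hx : x.1 = a)
    (hx2 : |x.2| ≤ B + 1) : 2 ≤ u x := by
  obtain ⟨κ, hκ, hz⟩ := hr
  have hc0 := G.c0
  have hB := G.B0
  have h1 := W.core.fenA x _ (hz c ⟨hc0.le, hcR⟩)
  have h2 := W.v8 (c, κ * c) (abs_of_pos hc0).le (by
    simp only [abs_mul, abs_of_pos hc0]; nlinarith)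
  have h3 : |x.2 * (κ * c)| ≤ 1 := by
    rw [abs_mul, abs_mul, abs_of_pos hc0]
    calc |x.2| * (|κ| * c) ≤ (B + 1) * (m * 1) := by
          gcongr
          · exact (abs_nonneg _).trans hκ
          · exact G.c1
      _ ≤ 1 := by linarith
  have h4 := neg_le_of_abs_le h3
  simp only [dot] at h1
  rw [hx] at h1
  have := G.ca
  linarith

theorem setW_lt (G : Geo θ c a M b k s τ B) {l₁ : ℝ} (hl : -a ≤ l₁) {x : Pl}
    (hx : x ∈ setW θ a M b k s τ B l₁ u) :
    u x < (x.1 ^ 2 / M + M * (max x.2 0) ^ 2) / 2 - 3 * θ ∧ x.1 ^ 2 / M ≤ 1 / 2 ∧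
      M * (max x.2 0) ^ 2 ≤ 1 / 2 := by
  obtain ⟨⟨⟨h1, h2⟩, h3, h4⟩, h5⟩ := hx
  have hM := G.M0
  have e1 : x.1 ^ 2 / M ≤ 1 / 2 := by
    have h6 : x.1 ^ 2 ≤ a ^ 2 := sq_le_sq' (by linarith) h2
    have : x.1 ^ 2 / M ≤ a ^ 2 / M := div_le_div_of_nonneg_right h6 hM.le
    linarith [G.aM]
  have e2 : M * (max x.2 0) ^ 2 ≤ 1 / 2 := by
    have : M * (max x.2 0) ^ 2 ≤ M * b ^ 2 := by
      gcongr
      exact max_le h4 G.b0.le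
    linarith [G.Mb]
  exact ⟨h5.trans_le (barW_le G.k1.le G.kτ hM G.s0.le G.s1 G.sM G.τθ G.b1 G.τ1 e1 G.Mb G.b0.le h4), e1, e2⟩

theorem exists_path (W : Win θ c p R 𝒯 u v Ω₁ Ω₂) (G : Geo θ c a M b k s τ B) {m l₁ : ℝ} {p₀ : ℝ}
    (hp : |p₀| = p) (hpp : 16 * M * θ ≤ p ^ 2) (hl : -a ≤ l₁) (hp₀ : p₀ ∈ Ioo l₁ a)
    (hm : m ≤ 1) (hms : m < s)
    (hmB : (B + 1) * m ≤ 1) (hcR : c ≤ R) (haR : a ≤ R) (hBR : B + 1 ≤ R) (hr : RightRay m R Ω₂)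
    (hcut : CutLow m R Ω₁) :
    ∃ z, JoinedIn (setW θ a M b k s τ B l₁ u) (p₀, 0) z ∧ (z.1 = l₁ ∨ z.2 = b) := by
  have hM := G.M0
  have hB := G.B0
  have hb := G.b0
  have hτ := G.τ0
  have hθ : 0 < θ := by linarith [G.τθ]
  have hk := G.k1
  have hb1 := G.b1
  obtain ⟨z, hz, he⟩ := W.core.exists_path_barW (k := k) (M := M) (s := s) (τ := τ) (T := 4 * θ) (l₁ := l₁)
    (r₁ := a) (l₂ := -B) (r₂ := b) (p := (p₀, 0)) hk hM hp₀ ⟨by simpa using hB, hb⟩ (by simpa using G.s0)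
    (fun x hx h1 h2 => by
      have := hcut x (subset_closure hx) (by rw [abs_le]; constructor <;> linarith [h1.1, h1.2])
        (by rw [abs_le]; constructor <;> linarith [h2.1, h2.2])
      linarith)
    (by
      have h1 := W.uin p₀ hp.le
      have h2 : 16 * θ ≤ p₀ ^ 2 / M := by
        rw [le_div_iff₀ hM, ← sq_abs, hp]; linarith
      have h3 : 0 ≤ M * max (0 + s) 0 ^ 2 := by positivity
      have h4 : 1 * (p₀ ^ 2 / M + M * max (0 + s) 0 ^ 2) ≤ k * (p₀ ^ 2 / M + M * max (0 + s) 0 ^ 2) := by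
        gcongr
      simp only [barW]
      linarith)
  refine ⟨z, hz, ?_⟩
  have hzW : z ∈ setW θ a M b k s τ B l₁ u := hz.target_mem
  obtain ⟨h1, h2, h3⟩ := setW_lt G hl hzW
  have h4 := hzW.1.2
  rcases he with h | h | h | h
  · exact Or.inl h
  · have := W.blocked G hm hmB hcR hr h (by rw [abs_le]; constructor <;> linarith [h4.1, h4.2])
    linarith
  · exfalso
    have h5 := hzW.2
    have h6 := W.core.un z
    have h7 := G.τB
    have h8 : max (-B + s) 0 = 0 := max_eq_right (by linarith [G.sB])
    simp only [barW] at h5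
    rw [h, h8] at h5
    have h9 : k ≤ 2 := by linarith [G.kτ, G.τ1]
    have h10 : k / 2 * (z.1 ^ 2 / M + M * 0 ^ 2) ≤ 2 / 2 * (1 / 2) := by
      have : z.1 ^ 2 / M + M * 0 ^ 2 ≤ 1 / 2 := by simpa using h2
      gcongr
    nlinarith
  · exact Or.inr h

theorem avoid (W : Win θ c p R 𝒯 u v Ω₁ Ω₂) (G : Geo θ c a M b k s τ B) {l₁ : ℝ} (hl : -a ≤ l₁)
    (F : ∀ x y : Pl, x.1 = 0 → 0 ≤ x.2 → x.2 ≤ b → |y.1| ≤ B + 1 → dot x y - θ ≤ u x + v y)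
    {x : Pl} (hx : x ∈ setW θ a M b k s τ B l₁ u) (hx1 : x.1 = 0) :
    p / M < max x.2 0 := by
  obtain ⟨h1, -, -⟩ := setW_lt G hl hx
  have hM := G.M0
  have hB := G.B0
  have hθ : 0 < θ := by linarith [G.τθ, G.τ0]
  rw [hx1] at h1
  by_contra! hcon
  have h0 : 0 ≤ max x.2 0 := le_max_right _ _
  rw [le_div_iff₀ hM] at hcon
  have h2 := W.vin (M * max x.2 0) (by rw [abs_of_nonneg (by positivity)]; linarith)
  rcases le_total 0 x.2 with h | h
  · have h3 := F x (0, M * max x.2 0) hx1 h hx.1.2.2 (by simp; linarith)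
    simp only [dot, max_eq_left h] at h1 h2 h3
    have h4 : 0 ≤ M * x.2 ^ 2 := by positivity
    have e : x.2 * (M * x.2) = M * x.2 ^ 2 := by ring
    have e' : (0 : ℝ) ^ 2 / M = 0 := by norm_num
    rw [e'] at h1
    rw [e, mul_zero] at h3
    linarith
  · have := W.core.un x
    rw [max_eq_right h] at h1
    norm_num at h1
    linarith
end Win

theorem Geo.mono {θ θ' c a M b k s τ B : ℝ} (G : Geo θ c a M b k s τ B) (h : θ ≤ θ') :
    Geo θ' c a M b k s τ B := { G with τθ := G.τθ.trans h }

theorem Fen.mono {θ θ' a b Y₀ : ℝ} {u v : Pl → ℝ} (F : Fen θ a b Y₀ u v) (h : θ ≤ θ') :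
    Fen θ' a b Y₀ u v where
  right := fun x y a1 a2 a3 a4 a5 a6 => by linarith [F.right x y a1 a2 a3 a4 a5 a6]
  axis := fun x y a1 a2 a3 a4 => by linarith [F.axis x y a1 a2 a3 a4]
  bottom := fun x y a1 a2 a3 a4 => by linarith [F.bottom x y a1 a2 a3 a4]

/-- Both domains are cut: contradiction. -/
theorem false_of_cut_cut {𝒯 : ℝ → ℝ} (h𝒯 : ∀ ρ, 1 ≤ 𝒯 ρ) {θ₀ c a M b k s τ B : ℝ}
    (G₀ : Geo θ₀ c a M b k s τ B) : ∃ R₀ m₀, 1 ≤ R₀ ∧ 0 < m₀ ∧ ∀ R ≥ R₀, ∀ u v Ω₁ Ω₂ m θ p, 0 < m → m ≤ m₀ →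
      θ₀ ≤ θ → 0 < p → p < a → 16 * M * θ ≤ p ^ 2 → Win θ c p R 𝒯 u v Ω₁ Ω₂ → UpRay (m / R) R Ω₁ →
      RightRay (m / R) R Ω₂ → CutLow m R Ω₁ → CutLeft m R Ω₂ → False := by
  have hB := G₀.B0
  have hM := G₀.M0
  have ha := G₀.a0
  have hb := G₀.b0
  have hθ₀ : 0 < θ₀ := by linarith [G₀.τθ, G₀.τ0]
  have hs := G₀.s0
  obtain ⟨R₀, m₀, hR₀, hm₀, key⟩ := exists_fen h𝒯 hθ₀ ha hb (by linarith : 0 < B + 1)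
  refine ⟨max R₀ (a + B + 1), min m₀ (min (s / 2) (1 / (B + 1))), le_max_of_le_left hR₀, by positivity, ?_⟩
  intro R hR u v Ω₁ Ω₂ m θ p hm hmm hθ hp hpa hpp W hU hRt hC1 hC2
  have hR1 := (le_max_left _ _).trans hR
  have hR2 := (le_max_right _ _).trans hR
  have hm1 : m ≤ m₀ := hmm.trans (min_le_left _ _)
  have hm2 : m ≤ s / 2 := hmm.trans ((min_le_right _ _).trans (min_le_left _ _))
  have hm3 : m ≤ 1 / (B + 1) := hmm.trans ((min_le_right _ _).trans (min_le_right _ _))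
  rw [le_div_iff₀ (by linarith)] at hm3
  have G := G₀.mono hθ
  have hs1 := G.s1
  have hR11 : 1 ≤ R := hR₀.trans hR1
  have hmR : m / R ≤ m := div_le_self hm.le (by linarith)
  have hU' := hU.mono hmR le_rfl
  have hRt' := hRt.mono hmR le_rfl
  have F := (key R hR1 u v Ω₁ Ω₂ m hm hm1 W.core W.bu W.bv hU hRt
    (.of_cutLeft hR11 hm.le W.core.z2 hRt hC2)).mono hθ
  have hcR : c ≤ R := G.c1.trans hR11
  have ha0 : -a ≤ 0 := by linarith
  obtain ⟨z, hz, hze⟩ := W.exists_path G (p₀ := p) (l₁ := 0) (abs_of_pos hp) hpp ha0 ⟨hp, hpa⟩ (by linarith)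
    (by linarith) (by linarith) hcR (by linarith) (by linarith) hRt' hC1
  obtain ⟨w, hw, hwe⟩ := W.swapCoord.exists_path G (p₀ := p) (l₁ := 0) (abs_of_pos hp) hpp ha0 ⟨hp, hpa⟩
    (by linarith) (by linarith) (by linarith) hcR (by linarith) (by linarith) hU'.swap hC2.swap
  have avP := fun x hx => W.avoid G (l₁ := 0) ha0 F.axis (x := x) hx
  have avQ := fun x hx => W.swapCoord.avoid G (l₁ := 0) ha0 (fun y x h1 h2 h3 h4 => by
    have := F.bottom x.swap y.swap h1 h2 h3 h4
    have e : dot x.swap y.swap = dot y x := by simp [dot]; ring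
    rw [e] at this; linarith) (x := x) hx
  set P := setW θ a M b k s τ B 0 u
  set Q := setW θ a M b k s τ B 0 fun Y => v Y.swap
  set φ : Pl → Pl := fun x => (x.1, max x.2 0)
  set ψ : Pl → Pl := fun y => (M * max y.2 0, y.1 / M)
  have hθp : 0 < θ := hθ₀.trans_le hθ
  have hφz := hz.map (f := φ) (by fun_prop)
  have hψw := hw.map (f := ψ) (by fun_prop)
  have e1 : φ (p, 0) = (p, 0) := by simp [φ]
  have e2 : ψ (p, 0) = (0, p / M) := by simp [ψ]
  rw [e1] at hφz
  rw [e2] at hψw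
  refine cross_of_alternating (P := φ '' P) (Q := ψ '' Q) (a := a) (b := b) (R := M * b) ?_ hp (div_pos hp hM) G.aMb ?_ ?_ ?_ hφz hψw ?_ ?_
  · rw [Set.disjoint_left]
    rintro _ ⟨x, hx, rfl⟩ ⟨y, hy, hxy⟩
    obtain ⟨h1, h2⟩ := Prod.ext_iff.1 hxy
    simp only [φ, ψ] at h1 h2
    obtain ⟨a1, -, -⟩ := Win.setW_lt G ha0 hx
    obtain ⟨a2, -, -⟩ := Win.setW_lt G ha0 hy
    obtain ⟨⟨⟨b1, b2⟩, b3, b4⟩, -⟩ := hx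
    obtain ⟨⟨⟨d1, d2⟩, d3, d4⟩, -⟩ := hy
    have h2' : y.1 = M * max x.2 0 := by rw [← h2]; field_simp
    have q1 : x.1 ^ 2 / M = M * (max y.2 0) ^ 2 := by rw [← h1]; field_simp
    have q2 : y.1 ^ 2 / M = M * (max x.2 0) ^ 2 := by rw [h2']; field_simp
    have fin : ¬ (M * (max y.2 0) ^ 2 + M * (max x.2 0) ^ 2 - θ ≤ u x + v y.swap) := by
      intro hh
      rw [q1] at a1
      rw [q2] at a2
      linarith
    have hb1 := G.b1
    apply fin
    rcases le_total 0 x.2 with hx2 | hx2 <;> rcases le_total 0 y.2 with hy2 | hy2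
    · have := F.right x y.swap b1 b2 hx2 b4 (by simp only [Prod.fst_swap]; rw [abs_of_nonneg hy2]; exact d4) d1
      simp only [dot, Prod.fst_swap, Prod.snd_swap] at this
      rw [max_eq_left hx2] at h2' ⊢
      rw [max_eq_left hy2] at h1 ⊢
      rw [← h1, h2'] at this
      linarith
    · have hx0 : x.1 = 0 := by rw [← h1, max_eq_right hy2, mul_zero]
      have := F.axis x y.swap hx0 hx2 b4 (by simp only [Prod.fst_swap]; rw [abs_le]; constructor <;> linarith)
      simp only [dot, Prod.fst_swap, Prod.snd_swap] at this
      rw [max_eq_left hx2] at h2' ⊢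
      rw [max_eq_right hy2]
      rw [hx0, h2'] at this
      linarith
    · have hy0 : y.1 = 0 := by rw [h2', max_eq_right hx2, mul_zero]
      have := F.bottom x y.swap hy0 hy2 d4 (by rw [abs_le]; constructor <;> linarith)
      simp only [dot, Prod.fst_swap, Prod.snd_swap] at this
      rw [max_eq_left hy2] at h1 ⊢
      rw [max_eq_right hx2]
      rw [hy0, ← h1] at this
      linarith
    · rw [max_eq_right hx2, max_eq_right hy2]
      have := W.core.un x
      have := W.core.vn y.swap
      linarith
  · rintro _ ⟨x, hx, rfl⟩
    obtain ⟨⟨⟨b1, b2⟩, b3, b4⟩, -⟩ := hx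
    have : 0 < M * b := by positivity
    exact ⟨by simp only [φ]; linarith, b2, le_max_right _ _, max_le b4 hb.le⟩
  · rintro _ ⟨y, hy, rfl⟩
    obtain ⟨⟨⟨d1, d2⟩, d3, d4⟩, -⟩ := hy
    have : 0 < M * b := by positivity
    have h0 : 0 ≤ M * max y.2 0 := mul_nonneg hM.le (le_max_right _ _)
    refine ⟨by simp only [ψ]; linarith, mul_le_mul_of_nonneg_left (max_le d4 hb.le) hM.le, div_nonneg d1 hM.le, ?_⟩
    simp only [ψ]
    rw [div_lt_iff₀ hM]
    linarith [G.aMb]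
  · rintro _ ⟨x, hx, rfl⟩ h
    exact avP x hx h
  · rcases hze with h | h
    · right
      refine ⟨h, ?_⟩
      rintro _ (⟨x, hx, rfl⟩ | ⟨y, hy, rfl⟩)
      · exact hx.1.1.1
      · exact mul_nonneg hM.le (le_max_right _ _)
    · left; simp only [φ]; rw [h, max_eq_left hb.le]
  · rcases hwe with h | h
    · right
      refine ⟨by simp only [ψ]; rw [h, zero_div], ?_⟩
      have := avQ w hw.target_mem h
      rw [div_lt_iff₀ hM] at this
      simp only [ψ]; linarith
    · left; simp only [ψ]; rw [h, max_eq_left hb.le]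

/-- The part of the box under the barrier `barV`. -/
def setV (θ a M b k : ℝ) (u : Pl → ℝ) : Set Pl :=
  {x | x ∈ Icc 0 a ×ˢ Icc (-b) b ∧ u x < barV k M (4 * θ) x}

namespace Win
variable {θ c p R a M b k s τ B : ℝ} {𝒯 : ℝ → ℝ} {u v : Pl → ℝ} {Ω₁ Ω₂ : Set Pl}

theorem setV_lt (G : Geo θ c a M b k s τ B) {x : Pl} (hx : x ∈ setV θ a M b k u) :
    u x < (x.1 ^ 2 / M + M * x.2 ^ 2) / 2 - 3 * θ ∧ x.1 ^ 2 / M ≤ 1 / 2 ∧ M * x.2 ^ 2 ≤ 1 / 2 := by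
  obtain ⟨⟨⟨h1, h2⟩, h3, h4⟩, h5⟩ := hx
  have hM := G.M0
  have h6 : x.1 ^ 2 ≤ a ^ 2 := sq_le_sq' (by linarith [G.a0]) h2
  have h7 : x.2 ^ 2 ≤ b ^ 2 := sq_le_sq' h3 h4
  have e1 : x.1 ^ 2 / M ≤ 1 / 2 := (div_le_div_of_nonneg_right h6 hM.le).trans G.aM
  have e2 : M * x.2 ^ 2 ≤ 1 / 2 := (mul_le_mul_of_nonneg_left h7 hM.le).trans G.Mb
  exact ⟨h5.trans_le (barV_le G.k1.le G.kτ hM G.τθ e1 e2), e1, e2⟩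

theorem exists_pathV (W : Win θ c p R 𝒯 u v Ω₁ Ω₂) (G : Geo θ c a M b k s τ B) {m : ℝ}
    (hp : 0 < p) (hpa : p < a) (hpp : 16 * M * θ ≤ p ^ 2) (hm : m ≤ 1)
    (hmB : (B + 1) * m ≤ 1) (hcR : c ≤ R) (hr : RightRay m R Ω₂) :
    ∃ z, JoinedIn (setV θ a M b k u) (p, 0) z ∧ (z.1 = 0 ∨ z.2 = -b ∨ z.2 = b) := by
  have hM := G.M0
  have hB := G.B0
  have hb := G.b0
  have hτ := G.τ0
  have hθ : 0 < θ := by linarith [G.τθ]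
  have hk := G.k1
  have hb1 := G.b1
  obtain ⟨z, hz, he⟩ := W.core.exists_path_barV (k := k) (M := M) (T := 4 * θ) (l₁ := 0)
    (r₁ := a) (l₂ := -b) (r₂ := b) (p := (p, 0)) hk hM ⟨hp, hpa⟩ ⟨by simpa using hb, hb⟩
    (by
      have h1 := W.uin p (abs_of_pos hp).le
      have h2 : 16 * θ ≤ p ^ 2 / M := by
        rw [le_div_iff₀ hM]; linarith
      have h4 : 1 * (p ^ 2 / M) ≤ k * (p ^ 2 / M) := by gcongr
      simp only [barV]
      norm_num
      linarith)
  refine ⟨z, hz, ?_⟩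
  have hzW : z ∈ setV θ a M b k u := hz.target_mem
  obtain ⟨h1, h2, h3⟩ := setV_lt G hzW
  have h4 := hzW.1.2
  rcases he with h | h | h | h
  · exact Or.inl h
  · have := W.blocked G hm hmB hcR hr h (by rw [abs_le]; constructor <;> linarith [h4.1, h4.2])
    linarith
  · exact Or.inr (Or.inl h)
  · exact Or.inr (Or.inr h)

end Win

theorem refl1_refl1 (x : Pl) : refl1 (refl1 x) = x := by ext <;> simp

theorem refl1_preimage_preimage (Ω : Set Pl) : refl1 ⁻¹' (refl1 ⁻¹' Ω) = Ω := by
  ext x; simp [refl1_refl1]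

/-- The first domain is cut and the second one is spread along the horizontal axis: contradiction. -/
theorem false_of_cut_spread {𝒯 : ℝ → ℝ} (h𝒯 : ∀ ρ, 1 ≤ 𝒯 ρ) {θ₀ c a M b k s τ B : ℝ}
    (G₀ : Geo θ₀ c a M b k s τ B) : ∃ R₀ m₀, 1 ≤ R₀ ∧ 0 < m₀ ∧ ∀ R ≥ R₀, ∀ u v Ω₁ Ω₂ m θ p, 0 < m → m ≤ m₀ →
      θ₀ ≤ θ → 0 < p → p < a → 16 * M * θ ≤ p ^ 2 → Win θ c p R 𝒯 u v Ω₁ Ω₂ → UpRay (m / R) R Ω₁ →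
      RightRay (m / R) R Ω₂ → CutLow m R Ω₁ → RightRay (m / R) R (refl1 ⁻¹' Ω₂) → False := by
  have hB := G₀.B0
  have hM := G₀.M0
  have ha := G₀.a0
  have hb := G₀.b0
  have hθ₀ : 0 < θ₀ := by linarith [G₀.τθ, G₀.τ0]
  have hs := G₀.s0
  obtain ⟨R₀, m₀, hR₀, hm₀, key⟩ := exists_fen h𝒯 hθ₀ ha hb (by linarith : 0 < B + 1)
  refine ⟨max R₀ (a + B + 1), min m₀ (min (s / 2) (1 / (B + 1))), le_max_of_le_left hR₀, by positivity, ?_⟩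
  intro R hR u v Ω₁ Ω₂ m θ p hm hmm hθ hp hpa hpp W hU hRt hC1 hRl
  have hR1 := (le_max_left _ _).trans hR
  have hR2 := (le_max_right _ _).trans hR
  have hm1 : m ≤ m₀ := hmm.trans (min_le_left _ _)
  have hm2 : m ≤ s / 2 := hmm.trans ((min_le_right _ _).trans (min_le_left _ _))
  have hm3 : m ≤ 1 / (B + 1) := hmm.trans ((min_le_right _ _).trans (min_le_right _ _))
  rw [le_div_iff₀ (by linarith)] at hm3
  have G := G₀.mono hθ
  have hs1 := G.s1
  have hR11 : 1 ≤ R := hR₀.trans hR1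
  have hmR : m / R ≤ m := div_le_self hm.le (by linarith)
  have hU' := hU.mono hmR le_rfl
  have hRt' := hRt.mono hmR le_rfl
  have hRl' := hRl.mono hmR le_rfl
  have F := (key R hR1 u v Ω₁ Ω₂ m hm hm1 W.core W.bu W.bv hU hRt
    (.of_rays hR11 hm.le hRt hRl)).mono hθ
  have F' := (key R hR1 _ _ _ _ m hm hm1 W.core.refl1 W.bu.refl1 W.bv.refl1 hU.refl1 hRl
    (.of_rays hR11 hm.le hRl (by rwa [refl1_preimage_preimage]))).mono hθ
  have hcR : c ≤ R := G.c1.trans hR11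
  have hb1 := G.b1
  have hθp : 0 < θ := hθ₀.trans_le hθ
  set P := setW θ a M b k s τ B (-a) u with hP
  set Q := setV θ a M b k fun Y => v Y.swap with hQ
  have hpath : ∀ p₀, |p₀| = p → ∃ z, JoinedIn P (p₀, 0) z ∧ z.2 = b := by
    intro p₀ hp₀
    have hp₀a : p₀ ∈ Ioo (-a) a := by
      rw [mem_Ioo, ← abs_lt, hp₀]; exact hpa
    obtain ⟨z, hz, hze⟩ := W.exists_path G (p₀ := p₀) (l₁ := -a) hp₀ hpp le_rfl hp₀a (by linarith)
      (by linarith) (by linarith) hcR (by linarith) (by linarith) hRt' hC1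
    refine ⟨z, hz, hze.resolve_left fun h => ?_⟩
    obtain ⟨h1, h2, h3⟩ := Win.setW_lt G le_rfl hz.target_mem
    have h4 := hz.target_mem.1.2
    have := W.refl1.blocked G (m := m) (by linarith) (by linarith) hcR hRl' (x := refl1 z)
      (by simp [h]) (by rw [abs_le]; constructor <;> simp <;> linarith [h4.1, h4.2])
    rw [refl1_refl1] at this
    linarith
  obtain ⟨w, hw, hwe⟩ := W.swapCoord.exists_pathV G hp hpa hpp (m := m) (by linarith) (by linarith) hcR hU'.swap
  have avP := fun x hx => W.avoid G (l₁ := -a) le_rfl F.axis (x := x) hx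
  have fenP : ∀ x y : Pl, -a ≤ x.1 → x.1 ≤ a → -B ≤ x.2 → x.2 ≤ b → -b ≤ y.1 → y.1 ≤ b →
      x.1 = M * y.1 → y.2 = M * max x.2 0 → M * y.1 ^ 2 + M * (max x.2 0) ^ 2 - θ ≤ u x + v y := by
    have main : ∀ u v : Pl → ℝ, Fen θ a b (B + 1) u v → ∀ x y : Pl, x.1 ≤ a → -B ≤ x.2 → x.2 ≤ b →
        y.1 ≤ b → x.1 = M * y.1 → y.2 = M * max x.2 0 → 0 ≤ y.1 →
        M * y.1 ^ 2 + M * (max x.2 0) ^ 2 - θ ≤ u x + v y := by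
      intro u v F x y b2 b3 b4 d4 h1 h2 hy
      rcases le_total 0 x.2 with hx2 | hx2
      · have := F.right x y (by rw [h1]; positivity) b2 hx2 b4 (by rw [abs_of_nonneg hy]; exact d4)
          (by rw [h2]; positivity)
        simp only [dot] at this
        rw [max_eq_left hx2] at h2 ⊢
        rw [h1, h2] at this
        linarith
      · have hy0 : y.2 = 0 := by rw [h2, max_eq_right hx2, mul_zero]
        have := F.bottom x y hy0 hy d4 (by rw [abs_le]; constructor <;> linarith)
        simp only [dot] at this
        rw [max_eq_right hx2]
        rw [hy0, h1] at this
        linarith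
    intro x y b1 b2 b3 b4 d3 d4 h1 h2
    rcases le_total 0 y.1 with hy | hy
    · exact main u v F x y b2 b3 b4 d4 h1 h2 hy
    · have := main _ _ F' (refl1 x) (refl1 y) (by simp; linarith) b3 b4 (by simp; linarith) (by simp [h1])
        h2 (by simpa using hy)
      simpa [refl1_refl1] using this
  have avQ : ∀ y ∈ Q, y.1 = 0 → p < M * |y.2| := by
    intro y hy hy1
    obtain ⟨a2, -, -⟩ := Win.setV_lt G hy
    obtain ⟨⟨⟨d1, d2⟩, d3, d4⟩, -⟩ := hy
    by_contra! hcon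
    have h1 := W.uin (M * y.2) (by rwa [abs_mul, abs_of_pos hM])
    have h2 : M * y.2 ^ 2 - θ ≤ u (M * y.2, 0) + v y.swap := by
      have haM : M * |y.2| ≤ a := by linarith
      rw [← abs_of_pos hM, ← abs_mul, abs_le] at haM
      have := fenP (M * y.2, 0) y.swap haM.1 haM.2 (by simpa using hB.le) (by simpa using hb.le) d3 d4 rfl
        (by simp [hy1])
      simpa using this
    have h3 : 0 ≤ M * y.2 ^ 2 := by positivity
    rw [hy1] at a2
    norm_num at a2
    linarith
  have hdisj : ∀ x ∈ P, ∀ y ∈ Q, x.1 = M * y.2 → y.1 = M * max x.2 0 → False := by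
    intro x hx y hy h1 h2
    obtain ⟨a1, -, -⟩ := Win.setW_lt G le_rfl hx
    obtain ⟨a2, -, -⟩ := Win.setV_lt G hy
    obtain ⟨⟨⟨b1, b2⟩, b3, b4⟩, -⟩ := hx
    obtain ⟨⟨⟨d1, d2⟩, d3, d4⟩, -⟩ := hy
    have := fenP x y.swap b1 b2 b3 b4 d3 d4 h1 h2
    have q1 : x.1 ^ 2 / M = M * y.2 ^ 2 := by rw [h1]; field_simp
    have q2 : y.1 ^ 2 / M = M * (max x.2 0) ^ 2 := by rw [h2]; field_simp
    rw [q1] at a1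
    rw [q2] at a2
    simp only [Prod.fst_swap] at this
    linarith
  have final : ∀ σ : ℝ, |σ| = 1 → (σ * (M * w.2) = M * b ∨ (w.1 = 0 ∧ p < σ * (M * w.2))) → False := by
    intro σ hσ hend
    have hσ2 : σ * σ = 1 := by rw [← abs_mul_abs_self, hσ]; norm_num
    have hσ0 : σ ≠ 0 := by rintro rfl; simp at hσ
    obtain ⟨z, hz, hze⟩ := hpath (σ * p) (by rw [abs_mul, hσ, one_mul, abs_of_pos hp])
    set φ : Pl → Pl := fun x => (σ * x.1, max x.2 0)
    set ψ : Pl → Pl := fun y => (σ * (M * y.2), y.1 / M)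
    have hφz := hz.map (f := φ) (by fun_prop)
    have hψw := hw.map (f := ψ) (by fun_prop)
    have e1 : φ (σ * p, 0) = (p, 0) := by simp [φ, ← mul_assoc, hσ2]
    have e2 : ψ (p, 0) = (0, p / M) := by simp [ψ]
    rw [e1] at hφz
    rw [e2] at hψw
    have hab : ∀ t r : ℝ, |t| ≤ r → -r ≤ σ * t ∧ σ * t ≤ r := by
      intro t r h; rw [← abs_le, abs_mul, hσ, one_mul]; exact h
    have haMb := G.aMb
    refine cross_of_alternating (P := φ '' P) (Q := ψ '' Q) (a := a) (b := b) (R := M * b) ?_ hp (div_pos hp hM) G.aMb ?_ ?_ ?_ hφz hψw ?_ ?_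
    · rw [Set.disjoint_left]
      rintro _ ⟨x, hx, rfl⟩ ⟨y, hy, hxy⟩
      obtain ⟨h1, h2⟩ := Prod.ext_iff.1 hxy
      simp only [φ, ψ] at h1 h2
      exact hdisj x hx y hy (mul_left_cancel₀ hσ0 h1).symm (by rw [← h2]; field_simp)
    · rintro _ ⟨x, hx, rfl⟩
      obtain ⟨⟨⟨b1, b2⟩, b3, b4⟩, -⟩ := hx
      obtain ⟨h1, h2⟩ := hab x.1 a (abs_le.2 ⟨b1, b2⟩)
      exact ⟨by simp only [φ]; linarith, h2, le_max_right _ _, max_le b4 hb.le⟩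
    · rintro _ ⟨y, hy, rfl⟩
      obtain ⟨⟨⟨d1, d2⟩, d3, d4⟩, -⟩ := hy
      obtain ⟨h1, h2⟩ := hab (M * y.2) (M * b) (by
        rw [abs_mul, abs_of_pos hM]; exact mul_le_mul_of_nonneg_left (abs_le.2 ⟨d3, d4⟩) hM.le)
      refine ⟨h1, h2, div_nonneg d1 hM.le, ?_⟩
      simp only [ψ]
      rw [div_lt_iff₀ hM]
      linarith
    · rintro _ ⟨x, hx, rfl⟩ h
      exact avP x hx ((mul_eq_zero.1 h).resolve_left hσ0)
    · left; simp only [φ]; rw [hze, max_eq_left hb.le]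
    · rcases hend with h | ⟨h, h'⟩
      · exact Or.inl h
      · exact Or.inr ⟨by simp only [ψ]; rw [h, zero_div], h'⟩
  rcases hwe with h | h | h
  · have := avQ w hw.target_mem h
    rcases le_total 0 w.2 with h0 | h0
    · rw [abs_of_nonneg h0] at this
      exact final 1 (by simp) (Or.inr ⟨h, by linarith⟩)
    · rw [abs_of_nonpos h0] at this
      exact final (-1) (by simp) (Or.inr ⟨h, by linarith⟩)
  · exact final (-1) (by simp) (Or.inl (by rw [h]; ring))
  · exact final 1 (by simp) (Or.inl (by rw [h]; ring))

/-- A domain on the right of the vertical axis is incompatible with a second domain reaching to the left. -/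
theorem false_of_cutLeft {𝒯 : ℝ → ℝ} (h𝒯 : ∀ ρ, 1 ≤ 𝒯 ρ) : ∃ R₀ m₀, 1 ≤ R₀ ∧ 0 < m₀ ∧ ∀ R ≥ R₀,
    ∀ u v Ω₁ Ω₂ m, 0 < m → m ≤ m₀ → Core dot u v Ω₁ Ω₂ → BddBox 𝒯 R u → BddBox 𝒯 R v →
      CutLeft m R Ω₁ → RightRay (m / R) R (refl1 ⁻¹' Ω₂) → False := by
  set Z := 2 * 𝒯 1 / 1 + 1 with hZ
  have h1 := h𝒯 1
  have h2 := h𝒯 Z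
  refine ⟨max Z (𝒯 Z), min (1 / 8) (1 / (4 * 𝒯 Z)), le_max_of_le_right h2, by positivity, ?_⟩
  intro R hR u v Ω₁ Ω₂ m hm hmm H bu bv hC hr
  have hR1 := (le_max_left _ _).trans hR
  have hR2 := (le_max_right _ _).trans hR
  have hm1 := hmm.trans (min_le_left _ _)
  have hm2 := hmm.trans (min_le_right _ _)
  rw [le_div_iff₀ (by linarith)] at hm2
  have hmR : m / R ≤ m := div_le_self hm.le (by linarith)
  obtain ⟨x, hx, hx1, hx2, hx3⟩ := H.refl1.exists_far bu.refl1 bv.refl1 h𝒯 one_pos (by linarith) hR1 (m := m)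
    (by linarith) (by linarith) (hr.mono hmR le_rfl)
  rw [closure_refl1_preimage] at hx
  have := hC (refl1 x) hx (by simp; linarith) (by simp; linarith)
  simp at this
  linarith

/-- In the frame `e, f`, the set `Ω` contains a square of half-side `r` centred on the axis of `e`. -/
def Spread (e f : R2) (r Λ : ℝ) (Ω : Set R2) : Prop :=
  ∃ α, |α| ≤ Λ ∧ ∀ s t : ℝ, |s| ≤ r → |t| ≤ r → (α + s) • e + t • f ∈ Ω

/-- In the frame `e, f`, the set `Ω` reaches height `r` and does not go below `-m` near `0`. -/
def Lifted (e f : R2) (r Λ m : ℝ) (Ω : Set R2) : Prop :=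
  ∃ a ∈ closure Ω, |⟪a, e⟫| ≤ Λ ∧ r ≤ ⟪a, f⟫ ∧
    ∀ z ∈ closure Ω, |⟪z, e⟫| ≤ 1 → |⟪z, f⟫| ≤ 1 → -m ≤ ⟪z, f⟫

theorem Spread.smul_left {e f : R2} {r Λ σ : ℝ} {Ω : Set R2} (h : Spread e f r Λ Ω) (hσ : |σ| = 1) :
    Spread (σ • e) f r Λ Ω := by
  obtain ⟨α, hα, hs⟩ := h
  have h2 : σ * σ = 1 := by rw [← abs_mul_abs_self, hσ]; norm_num
  refine ⟨σ * α, by rwa [abs_mul, hσ, one_mul], fun s t h1 h3 => ?_⟩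
  have := hs (σ * s) t (by rwa [abs_mul, hσ, one_mul]) h3
  convert this using 2
  rw [smul_smul]; congr 1; linear_combination α * h2

theorem Spread.smul_right {e f : R2} {r Λ σ : ℝ} {Ω : Set R2} (h : Spread e f r Λ Ω) (hσ : |σ| = 1) :
    Spread e (σ • f) r Λ Ω := by
  obtain ⟨α, hα, hs⟩ := h
  refine ⟨α, hα, fun s t h1 h3 => ?_⟩
  have := hs s (t * σ) h1 (by rwa [abs_mul, hσ, mul_one])
  rwa [smul_smul]

theorem Spread.mono {e f : R2} {r r' Λ : ℝ} {Ω : Set R2} (h : Spread e f r Λ Ω) (hr : r' ≤ r) :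
    Spread e f r' Λ Ω := by
  obtain ⟨α, hα, hs⟩ := h
  exact ⟨α, hα, fun s t h1 h3 => hs s t (h1.trans hr) (h3.trans hr)⟩

theorem Lifted.smul_left {e f : R2} {r Λ m σ : ℝ} {Ω : Set R2} (h : Lifted e f r Λ m Ω) (hσ : |σ| = 1) :
    Lifted (σ • e) f r Λ m Ω := by
  have key : ∀ z, |⟪z, σ • e⟫| = |⟪z, e⟫| := fun z => by
    rw [inner_smul_right, abs_mul, hσ, one_mul]
  simpa only [Lifted, key] using h

theorem mem_closure_fr_preimage {e f : R2} {A B : ℝ} (he : ‖e‖ = 1) (hf : ‖f‖ = 1)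
    (hef : ⟪e, f⟫ = 0) (hA : 0 < A) (hB : 0 < B) {Ω : Set R2} {X : Pl} :
    X ∈ closure (fr e f A B ⁻¹' Ω) ↔ fr e f A B X ∈ closure Ω := by
  obtain ⟨T, hT, -⟩ := exists_fr_equiv he hf hef hA hB
  have e1 : fr e f A B = T.toHomeomorph := funext fun X => (hT X).symm
  rw [e1, ← Homeomorph.preimage_closure]
  rfl

theorem fr_swap (e f : R2) (A B : ℝ) (X : Pl) : fr e f A B X = fr f e B A X.swap := by
  simp [fr, add_comm]

theorem fr_neg_left (e f : R2) (A B : ℝ) (X : Pl) : fr (-e) f A B X = fr e f A B (refl1 X) := by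
  simp [fr]

section
variable {e f : R2} {L l R Λ r m : ℝ} {Ω : Set R2}

theorem upRay_of_mem (he : ‖e‖ = 1) (hf : ‖f‖ = 1) (hef : ⟪e, f⟫ = 0) (hL : 0 < L) (hl : 0 < l)
    (hΩ : Convex ℝ Ω) (h0 : 0 ∈ closure Ω) (hr : 0 < r) (hlR : l * R ≤ r) {a : R2} (ha : a ∈ closure Ω)
    (ha1 : |⟪a, e⟫| ≤ Λ) (ha2 : r ≤ ⟪a, f⟫) : UpRay (Λ * l / (r * L)) R (fr e f L l ⁻¹' Ω) := by
  have hp : 0 < ⟪a, f⟫ := hr.trans_le ha2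
  have hΛ : 0 ≤ Λ := (abs_nonneg _).trans ha1
  refine ⟨⟪a, e⟫ * l / (⟪a, f⟫ * L), ?_, ?_⟩
  · rw [abs_div, abs_mul, abs_mul, abs_of_pos hl, abs_of_pos hp, abs_of_pos hL]
    gcongr
  · rintro s ⟨hs0, hsR⟩
    rw [mem_closure_fr_preimage he hf hef hL hl]
    have e1 : fr e f L l (⟪a, e⟫ * l / (⟪a, f⟫ * L) * s, s) = (l * s / ⟪a, f⟫) • a := by
      have hp' := hp.ne'
      have e2 := frame_expansion he hf hef a
      generalize (⟪a, e⟫ : ℝ) = q at e2 ⊢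
      generalize (⟪a, f⟫ : ℝ) = p at e2 hp' ⊢
      rw [e2]
      simp only [fr, smul_add, smul_smul]
      congr 2 <;> field_simp
    rw [e1]
    refine hΩ.closure.smul_mem_of_zero_mem h0 ha ⟨by positivity, ?_⟩
    rw [div_le_one hp]
    have : l * s ≤ l * R := by gcongr
    linarith

theorem Spread.upRay (he : ‖e‖ = 1) (hf : ‖f‖ = 1) (hef : ⟪e, f⟫ = 0) (hL : 0 < L) (hl : 0 < l)
    (hΩ : Convex ℝ Ω) (h0 : 0 ∈ closure Ω) (hr : 0 < r) (hlR : l * R ≤ r) (h : Spread e f r Λ Ω) :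
    UpRay (Λ * l / (r * L)) R (fr e f L l ⁻¹' Ω) := by
  obtain ⟨α, hα, hs⟩ := h
  have hfe : ⟪f, e⟫ = 0 := by rw [real_inner_comm]; exact hef
  have := hs 0 r (by simpa using hr.le) (abs_of_pos hr).le
  refine upRay_of_mem he hf hef hL hl hΩ h0 hr hlR (subset_closure this) ?_ ?_
  · simpa [inner_add_left, inner_smul_left, he, hfe] using hα
  · simp [inner_add_left, inner_smul_left, hf, hef]

theorem Lifted.upRay (he : ‖e‖ = 1) (hf : ‖f‖ = 1) (hef : ⟪e, f⟫ = 0) (hL : 0 < L) (hl : 0 < l)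
    (hΩ : Convex ℝ Ω) (h0 : 0 ∈ closure Ω) (hr : 0 < r) (hlR : l * R ≤ r) (h : Lifted e f r Λ m Ω) :
    UpRay (Λ * l / (r * L)) R (fr e f L l ⁻¹' Ω) := by
  obtain ⟨a, ha, ha1, ha2, -⟩ := h
  exact upRay_of_mem he hf hef hL hl hΩ h0 hr hlR ha ha1 ha2

theorem Lifted.cutLow (he : ‖e‖ = 1) (hf : ‖f‖ = 1) (hef : ⟪e, f⟫ = 0) (hL : 0 < L) (hl : 0 < l)
    (hlL : l ≤ L) (hLR : L * R ≤ 1) (h : Lifted e f r Λ (m * l) Ω) : CutLow m R (fr e f L l ⁻¹' Ω) := by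
  obtain ⟨-, -, -, -, h⟩ := h
  intro X hX h1 h2
  have hR : 0 ≤ R := (abs_nonneg _).trans h1
  rw [mem_closure_fr_preimage he hf hef hL hl] at hX
  have := h _ hX
    (by rw [inner_fr_left he hef, abs_mul, abs_of_pos hL]
        exact (mul_le_mul_of_nonneg_left h1 hL.le).trans hLR)
    (by rw [inner_fr_right hf hef, abs_mul, abs_of_pos hl]
        exact (mul_le_mul hlL h2 (abs_nonneg _) hL.le).trans hLR)
  rw [inner_fr_right hf hef] at this
  have h3 : l * (-m) ≤ l * X.2 := by linarith
  exact le_of_mul_le_mul_left h3 hl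

/-- A set spread around a point of the positive axis of `e`, with `0` not interior, lies almost to the right. -/
theorem cutLeft_of_square (he : ‖e‖ = 1) (hf : ‖f‖ = 1) (hef : ⟪e, f⟫ = 0) (hL : 0 < L) (hl : 0 < l)
    (hΩ : Convex ℝ Ω) (h0 : 0 ∉ interior Ω) (hr : 0 < r) (hm : 0 ≤ m) {α : ℝ} (hα : 0 < α) (hαΛ : α ≤ Λ)
    (hs : ∀ s t : ℝ, |s| ≤ r → |t| ≤ r → (α + s) • e + t • f ∈ Ω) (hmR : Λ * l * R ≤ m * (r * L)) :
    CutLeft m R (fr e f L l ⁻¹' Ω) := by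
  intro X hX h1 h2
  rw [mem_closure_fr_preimage he hf hef hL hl] at hX
  by_contra! hcon
  have hX1 : X.1 < 0 := by linarith
  apply h0
  set t := α / (-(L * X.1)) with ht
  have hLX : 0 < -(L * X.1) := by nlinarith
  have ht0 : 0 < t := by positivity
  have htX : t * (L * X.1) = -α := by
    have hne : X.1 ≠ 0 := hX1.ne
    rw [ht]; field_simp
  have hw : -(t • fr e f L l X) ∈ interior Ω := by
    rw [mem_interior_iff_mem_nhds, Metric.mem_nhds_iff]
    have hlt : |t * (l * X.2)| < r := by
      rw [abs_mul, abs_mul, abs_of_pos ht0, abs_of_pos hl, ht, div_mul_eq_mul_div, div_lt_iff₀ hLX]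
      have a1 : α * (l * |X.2|) ≤ Λ * (l * R) := by gcongr; exact hα.le.trans hαΛ
      have a2 : m * (r * L) < -X.1 * (r * L) := by gcongr; linarith
      linarith
    refine ⟨min r (r - |t * (l * X.2)|), lt_min hr (by linarith), fun x hx => ?_⟩
    rw [mem_ball, dist_eq_norm] at hx
    have hx1 := hx.trans_le (min_le_left _ _)
    have hx2 := hx.trans_le (min_le_right _ _)
    set y := x - -(t • fr e f L l X) with hy
    have b1 : |⟪y, e⟫| ≤ ‖y‖ := by simpa [he] using abs_real_inner_le_norm y e
    have b2 : |⟪y, f⟫| ≤ ‖y‖ := by simpa [hf] using abs_real_inner_le_norm y f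
    have := hs ⟪y, e⟫ (⟪y, f⟫ - t * (l * X.2)) (by linarith) ((abs_sub _ _).trans (by linarith))
    convert this using 1
    have ex : x = y - t • fr e f L l X := by rw [hy]; abel
    conv_lhs => rw [ex, frame_expansion he hf hef y, fr]
    rw [← neg_eq_iff_eq_neg.2 htX]
    module
  have := hΩ.combo_interior_closure_mem_interior hw hX (a := 1 / (1 + t)) (b := t / (1 + t)) (by positivity)
    (by positivity) (by field_simp)
  convert this using 1
  rw [smul_neg, smul_smul, eq_comm, one_div_mul_eq_div]
  abel

end

/-- The pair `u, v` normalized in the frame `e, f` with half-lengths `L, l` is a window. -/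
def WinAt (θ c p R : ℝ) (𝒯 : ℝ → ℝ) (u v : R2 → ℝ) (Ω₁ Ω₂ : Set R2) (e f : R2) (L l : ℝ) : Prop :=
  Win θ c p R 𝒯 (fun X => u (fr e f L l X) / (L * l)) (fun Y => v (fr e f l L Y) / (L * l))
    (fr e f L l ⁻¹' Ω₁) (fr e f l L ⁻¹' Ω₂)

/-- Either `Ω` is lifted in one of the two directions `± f`, or it is spread along `e`. -/
def Alt (e f : R2) (r Λ m : ℝ) (Ω : Set R2) : Prop :=
  (∃ σ : ℝ, |σ| = 1 ∧ Lifted e (σ • f) r Λ m Ω) ∨ Spread e f r Λ Ω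

section
variable {θ c p R L l : ℝ} {𝒯 : ℝ → ℝ} {u v : R2 → ℝ} {Ω₁ Ω₂ Ω : Set R2} {e f : R2}

theorem swap_preimage_fr : Prod.swap ⁻¹' (fr f e L l ⁻¹' Ω) = fr e f l L ⁻¹' Ω := by
  ext X; simp only [mem_preimage]; rw [fr_swap e f]

theorem refl1_preimage_fr : refl1 ⁻¹' (fr e f L l ⁻¹' Ω) = fr (-e) f L l ⁻¹' Ω := by
  ext X; simp only [mem_preimage]; rw [fr_neg_left]

theorem WinAt.swap (W : WinAt θ c p R 𝒯 u v Ω₁ Ω₂ e f L l) : WinAt θ c p R 𝒯 v u Ω₂ Ω₁ f e L l := by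
  have := Win.swapCoord W
  rw [swap_preimage_fr, swap_preimage_fr] at this
  unfold WinAt
  convert this using 2
  · rw [fr_swap]
  · rw [fr_swap]

theorem WinAt.neg_left (W : WinAt θ c p R 𝒯 u v Ω₁ Ω₂ e f L l) :
    WinAt θ c p R 𝒯 u v Ω₁ Ω₂ (-e) f L l := by
  have := Win.refl1 W
  rw [refl1_preimage_fr, refl1_preimage_fr] at this
  unfold WinAt
  convert this using 2
  · rw [fr_neg_left]
  · rw [fr_neg_left]

theorem WinAt.smul_left (W : WinAt θ c p R 𝒯 u v Ω₁ Ω₂ e f L l) {σ : ℝ} (hσ : |σ| = 1) :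
    WinAt θ c p R 𝒯 u v Ω₁ Ω₂ (σ • e) f L l := by
  rcases (abs_eq zero_le_one).1 hσ with rfl | rfl
  · simpa using W
  · simpa using W.neg_left

theorem WinAt.smul_right (W : WinAt θ c p R 𝒯 u v Ω₁ Ω₂ e f L l) {σ : ℝ} (hσ : |σ| = 1) :
    WinAt θ c p R 𝒯 u v Ω₁ Ω₂ e (σ • f) L l := (W.swap.smul_left hσ).swap

end

theorem mem_interior_of_square {e f P : R2} {r : ℝ} {Ω : Set R2} (he : ‖e‖ = 1) (hf : ‖f‖ = 1)
    (hef : ⟪e, f⟫ = 0) (hr : 0 < r) (hs : ∀ s t : ℝ, |s| ≤ r → |t| ≤ r → P + (s • e + t • f) ∈ Ω) :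
    P ∈ interior Ω := by
  rw [mem_interior_iff_mem_nhds, Metric.mem_nhds_iff]
  refine ⟨r, hr, fun x hx => ?_⟩
  rw [mem_ball, dist_eq_norm] at hx
  have b1 : |⟪x - P, e⟫| ≤ ‖x - P‖ := by simpa [he] using abs_real_inner_le_norm (x - P) e
  have b2 : |⟪x - P, f⟫| ≤ ‖x - P‖ := by simpa [hf] using abs_real_inner_le_norm (x - P) f
  have := hs _ _ (b1.trans hx.le) (b2.trans hx.le)
  rwa [← frame_expansion he hf hef, add_sub_cancel] at this

/-- At a window, the two domains cannot both be lifted or spread. -/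
theorem false_of_alt_alt {𝒯 : ℝ → ℝ} (h𝒯 : ∀ ρ, 1 ≤ 𝒯 ρ) {θ₀ c a M b k s τ B : ℝ}
    (G₀ : Geo θ₀ c a M b k s τ B) : ∃ R m, 1 ≤ R ∧ 0 < m ∧ m ≤ 1 ∧
      ∀ (u v : R2 → ℝ) (Ω₁ Ω₂ : Set R2) (e f : R2) (L l r Λ θ p : ℝ), ‖e‖ = 1 → ‖f‖ = 1 → ⟪e, f⟫ = 0 →
        0 < l → l ≤ L → 0 < r → r ≤ 1 → L * R ≤ r → Λ * l * R ≤ m * (r * L) →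
        θ₀ ≤ θ → 0 < p → p < a → 16 * M * θ ≤ p ^ 2 → Core (fun x y : R2 => ⟪x, y⟫) u v Ω₁ Ω₂ →
        WinAt θ c p R 𝒯 u v Ω₁ Ω₂ e f L l → Alt e f r Λ (m * l) Ω₁ → Alt f e r Λ (m * l) Ω₂ → False := by
  obtain ⟨R₁, m₁, hR₁, hm₁, H₁⟩ := false_of_cut_cut h𝒯 G₀
  obtain ⟨R₂, m₂, hR₂, hm₂, H₂⟩ := false_of_cut_spread h𝒯 G₀
  obtain ⟨R₃, m₃, hR₃, hm₃, H₃⟩ := false_of_cutLeft h𝒯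
  set R := max R₁ (max R₂ R₃) with hR
  set m := min (min 1 m₁) (min m₂ m₃) with hm
  have hm0 : 0 < m := by positivity
  have hRa : R₁ ≤ R := le_max_left _ _
  have hRb : R₂ ≤ R := (le_max_left _ _).trans (le_max_right _ _)
  have hRc : R₃ ≤ R := (le_max_right _ _).trans (le_max_right _ _)
  have hma : m ≤ m₁ := (min_le_left _ _).trans (min_le_right _ _)
  have hmb : m ≤ m₂ := (min_le_right _ _).trans (min_le_left _ _)
  have hmc : m ≤ m₃ := (min_le_right _ _).trans (min_le_right _ _)
  clear_value R m
  have hR0 : 0 < R := by linarith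
  have ray : ∀ {Λ r L l : ℝ}, 0 < r → 0 < L → Λ * l * R ≤ m * (r * L) → Λ * l / (r * L) ≤ m / R := by
    intro Λ r L l h1 h2 h3
    rw [div_le_div_iff₀ (by positivity) hR0]; linarith
  have mixed : ∀ (u v : R2 → ℝ) (Ω₁ Ω₂ : Set R2) (e f : R2) (L l r Λ θ p : ℝ), ‖e‖ = 1 → ‖f‖ = 1 →
        ⟪e, f⟫ = 0 → 0 < l → l ≤ L → 0 < r → r ≤ 1 → L * R ≤ r → Λ * l * R ≤ m * (r * L) →
        θ₀ ≤ θ → 0 < p → p < a → 16 * M * θ ≤ p ^ 2 → Core (fun x y : R2 => ⟪x, y⟫) u v Ω₁ Ω₂ →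
        WinAt θ c p R 𝒯 u v Ω₁ Ω₂ e f L l → (∃ σ : ℝ, |σ| = 1 ∧ Lifted e (σ • f) r Λ (m * l) Ω₁) →
        Spread f e r Λ Ω₂ → False := by
    rintro u v Ω₁ Ω₂ e f L l r Λ θ p he hf hef hl hlL hr hr1 hLR hmR hθ hp hpa hMp H W ⟨σ, hσ, h1⟩ h2
    have hL := hl.trans_le hlL
    have hlR : l * R ≤ r := (by gcongr : l * R ≤ L * R).trans hLR
    have W' := W.smul_right hσ
    have h2' := h2.smul_left hσ
    have hf' : ‖σ • f‖ = 1 := by rw [norm_smul, Real.norm_eq_abs, hσ, hf, one_mul]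
    have hef' : ⟪e, σ • f⟫ = 0 := by rw [inner_smul_right, hef, mul_zero]
    have hfe' : ⟪σ • f, e⟫ = 0 := by rw [real_inner_comm, hef']
    generalize σ • f = f' at *
    have h3 := h2'.smul_right (σ := -1) (by norm_num)
    rw [neg_one_smul] at h3
    have r1 := (h1.upRay he hf' hef' hL hl H.o1 H.z1 hr hlR).mono (ray hr hL hmR) le_rfl
    have r2 := (h2'.upRay hf' he hfe' hL hl H.o2 H.z2 hr hlR).mono (ray hr hL hmR) le_rfl
    have r3 := (h3.upRay hf' (by rwa [norm_neg]) (by rw [inner_neg_right, hfe', neg_zero]) hL hl H.o2 H.z2 hr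
      hlR).mono (ray hr hL hmR) le_rfl
    have r2' := r2.swap
    have r3' := r3.swap
    rw [swap_preimage_fr] at r2' r3'
    rw [← refl1_preimage_fr] at r3'
    exact H₂ R hRb _ _ _ _ m θ p hm0 hmb hθ hp hpa hMp W' r1 r2'
      (h1.cutLow he hf' hef' hL hl hlL (hLR.trans hr1)) r3'
  refine ⟨R, m, hR₁.trans hRa, hm0, hm ▸ (min_le_left _ _).trans (min_le_left _ _), ?_⟩
  rintro u v Ω₁ Ω₂ e f L l r Λ θ p he hf hef hl hlL hr hr1 hLR hmR hθ hp hpa hMp H W A₁ A₂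
  have hfe : ⟪f, e⟫ = 0 := by rw [real_inner_comm, hef]
  have hL := hl.trans_le hlL
  have hlR : l * R ≤ r := (by gcongr : l * R ≤ L * R).trans hLR
  rcases A₁ with h1 | h1 <;> rcases A₂ with h2 | h2
  · obtain ⟨σ, hσ, h1⟩ := h1
    obtain ⟨σ', hσ', h2⟩ := h2
    have W' := (W.smul_right hσ).smul_left hσ'
    have h1' := h1.smul_left hσ'
    have h2' := h2.smul_left hσ
    have hf' : ‖σ • f‖ = 1 := by rw [norm_smul, Real.norm_eq_abs, hσ, hf, one_mul]
    have he' : ‖σ' • e‖ = 1 := by rw [norm_smul, Real.norm_eq_abs, hσ', he, one_mul]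
    have hef' : ⟪σ' • e, σ • f⟫ = 0 := by rw [inner_smul_right, real_inner_smul_left, hef]; simp
    have hfe' : ⟪σ • f, σ' • e⟫ = 0 := by rw [real_inner_comm, hef']
    have r1 := (h1'.upRay he' hf' hef' hL hl H.o1 H.z1 hr hlR).mono (ray hr hL hmR) le_rfl
    have r2 := ((h2'.upRay hf' he' hfe' hL hl H.o2 H.z2 hr hlR).mono (ray hr hL hmR) le_rfl).swap
    have c2 := (h2'.cutLow hf' he' hfe' hL hl hlL (hLR.trans hr1)).swap
    rw [swap_preimage_fr] at r2 c2
    exact H₁ R hRa _ _ _ _ m θ p hm0 hma hθ hp hpa hMp W' r1 r2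
      (h1'.cutLow he' hf' hef' hL hl hlL (hLR.trans hr1)) c2
  · exact mixed u v Ω₁ Ω₂ e f L l r Λ θ p he hf hef hl hlL hr hr1 hLR hmR hθ hp hpa hMp H W h1 h2
  · exact mixed v u Ω₂ Ω₁ f e L l r Λ θ p hf he hfe hl hlL hr hr1 hLR hmR hθ hp hpa hMp
      (H.swap fun x y => real_inner_comm y x) W.swap h2 h1
  · have main : ∀ e' : R2, ‖e'‖ = 1 → ⟪e', f⟫ = 0 → WinAt θ c p R 𝒯 u v Ω₁ Ω₂ e' f L l →
        Spread f (-e') r Λ Ω₂ → ∀ α, 0 < α → α ≤ Λ →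
        (∀ s t : ℝ, |s| ≤ r → |t| ≤ r → (α + s) • e' + t • f ∈ Ω₁) → False := by
      intro e' he' hef' W' h3 α hα hαΛ hs
      have hfe' : ⟪f, e'⟫ = 0 := by rw [real_inner_comm, hef']
      have r3 := ((h3.upRay hf (by rwa [norm_neg]) (by rw [inner_neg_right, hfe', neg_zero]) hL hl H.o2 H.z2
        hr hlR).mono (ray hr hL hmR) le_rfl).swap
      rw [swap_preimage_fr, ← refl1_preimage_fr] at r3
      exact H₃ R hRc _ _ _ _ m hm0 hmc W'.core W'.bu W'.bv
        (cutLeft_of_square he' hf hef' hL hl H.o1 H.n1 hr hm0.le hα hαΛ hs hmR) r3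
    obtain ⟨α, hα, hs⟩ := h1
    rcases lt_trichotomy α 0 with h | rfl | h
    · refine main (-e) (by rwa [norm_neg]) (by rw [inner_neg_left, hef, neg_zero]) W.neg_left (by rwa [neg_neg])
        (-α) (by linarith) ((neg_le_abs α).trans hα) fun s t h3 h4 => ?_
      have := hs (-s) t (by rwa [abs_neg]) h4
      convert this using 2
      module
    · exact H.n1 (mem_interior_of_square he hf hef hr (by simpa using hs))
    · refine main e he hef W ?_ α h ((le_abs_self α).trans hα) hs
      simpa using h2.smul_right (σ := -1) (by norm_num)

theorem Lifted.mono {e f : R2} {r r' Λ m : ℝ} {Ω : Set R2} (h : Lifted e f r Λ m Ω) (hr : r' ≤ r) :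
    Lifted e f r' Λ m Ω := by
  obtain ⟨a, ha, h1, h2, h3⟩ := h
  exact ⟨a, ha, h1, hr.trans h2, h3⟩

theorem spread_or_lifted_of_pos {e f : R2} (he : ‖e‖ = 1) (hf : ‖f‖ = 1) (hef : ⟪e, f⟫ = 0) {Ω : Set R2}
    (hΩ : Convex ℝ Ω) {r Λ m a₁ a₂ : ℝ} (hr : 0 < r) (hΛ : 1 ≤ Λ) (hm : 0 < m) (h1 : |a₁| ≤ Λ)
    (h2 : a₂ ≤ Λ) (h3 : r / 2 ≤ a₂)
    (hs : ∀ s t : ℝ, |s| ≤ r → |t| ≤ r → (a₁ + s) • e + (a₂ + t) • f ∈ Ω) :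
    Spread e f (m * r / (2 * (Λ + 1))) Λ Ω ∨ Lifted e f (r / 2) Λ m Ω := by
  have hfe : ⟪f, e⟫ = 0 := by rw [real_inner_comm, hef]
  rw [or_iff_not_imp_right]
  intro hL
  have ha : a₁ • e + a₂ • f ∈ Ω := by simpa using hs 0 0 (by simpa using hr.le) (by simpa using hr.le)
  have hz : ∃ z ∈ closure Ω, |⟪z, e⟫| ≤ 1 ∧ |⟪z, f⟫| ≤ 1 ∧ ⟪z, f⟫ < -m := by
    by_contra! hcon
    refine hL ⟨_, subset_closure ha, ?_, ?_, hcon⟩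
    · simpa [inner_add_left, inner_smul_left, he, hfe] using h1
    · simpa [inner_add_left, inner_smul_left, hf, hef] using h3
  obtain ⟨z, hz, z1, z2, z3⟩ := hz
  have ez := frame_expansion he hf hef z
  generalize (⟪z, e⟫ : ℝ) = q at *
  generalize (⟪z, f⟫ : ℝ) = w at *
  have hw := neg_le_of_abs_le z2
  have hd : 0 < a₂ - w := by linarith
  obtain ⟨lam, hlam⟩ : ∃ lam, lam = -w / (a₂ - w) := ⟨_, rfl⟩
  have hlam0 : 0 < lam := by rw [hlam]; apply div_pos <;> linarith
  have hlam1 : lam ≤ 1 := by rw [hlam, div_le_one hd]; linarith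
  have hzero : lam * a₂ + (1 - lam) * w = 0 := by rw [hlam]; field_simp; ring
  have hge : m / (Λ + 1) ≤ lam := by
    rw [hlam, div_le_div_iff₀ (by linarith) hd]
    have : m * (a₂ - w) ≤ -w * (a₂ - w) := by gcongr; linarith
    nlinarith
  refine ⟨lam * a₁ + (1 - lam) * q, ?_, fun s t hs1 ht1 => ?_⟩
  · refine (abs_add_le _ _).trans ?_
    rw [abs_mul, abs_mul, abs_of_pos hlam0, abs_of_nonneg (by linarith : 0 ≤ 1 - lam)]
    have b1 : lam * |a₁| ≤ lam * Λ := by gcongr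
    have b2 : (1 - lam) * |q| ≤ (1 - lam) * Λ := by gcongr; linarith
    linarith
  · have hrad : m * r / (2 * (Λ + 1)) ≤ lam * (r / 2) := by
      calc m * r / (2 * (Λ + 1)) = m / (Λ + 1) * (r / 2) := by field_simp
        _ ≤ _ := by gcongr
    have key : ∀ x, |x| ≤ m * r / (2 * (Λ + 1)) → |x / lam| ≤ r / 2 := fun x hx => by
      rw [abs_div, abs_of_pos hlam0, div_le_iff₀ hlam0]; linarith
    have hI : (a₁ + s / lam) • e + (a₂ + t / lam) • f ∈ interior Ω := by
      refine mem_interior_of_square he hf hef (half_pos hr) fun s' t' hs' ht' => ?_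
      have := hs (s / lam + s') (t / lam + t') ((abs_add_le _ _).trans (by linarith [key s hs1]))
        ((abs_add_le _ _).trans (by linarith [key t ht1]))
      convert this using 1
      module
    have := interior_subset (hΩ.combo_interior_closure_mem_interior hI hz hlam0
      (by linarith : 0 ≤ 1 - lam) (by ring))
    convert this using 1
    rw [ez]
    simp only [smul_add, smul_smul]
    have e1 : lam * (a₁ + s / lam) = lam * a₁ + s := by field_simp
    have e2 : lam * (a₂ + t / lam) = t - (1 - lam) * w := by
      have : lam * (a₂ + t / lam) = lam * a₂ + t := by field_simp
      linarith
    rw [e1, e2]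
    module

/-- A convex set containing a square is either spread along `e` or lifted in a direction `± f`. -/
theorem spread_or_lifted {e f : R2} (he : ‖e‖ = 1) (hf : ‖f‖ = 1) (hef : ⟪e, f⟫ = 0) {Ω : Set R2}
    (hΩ : Convex ℝ Ω) {r Λ m a₁ a₂ : ℝ} (hr : 0 < r) (hΛ : 1 ≤ Λ) (hm : 0 < m) (hm1 : m ≤ 1)
    (h1 : |a₁| ≤ Λ) (h2 : |a₂| ≤ Λ)
    (hs : ∀ s t : ℝ, |s| ≤ r → |t| ≤ r → (a₁ + s) • e + (a₂ + t) • f ∈ Ω) :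
    Spread e f (m * r / (2 * (Λ + 1))) Λ Ω ∨ ∃ σ : ℝ, |σ| = 1 ∧ Lifted e (σ • f) (r / 2) Λ m Ω := by
  rcases le_total (r / 2) |a₂| with h | h
  · have key : ∀ σ : ℝ, |σ| = 1 → σ * a₂ = |a₂| →
        Spread e f (m * r / (2 * (Λ + 1))) Λ Ω ∨ ∃ σ : ℝ, |σ| = 1 ∧ Lifted e (σ • f) (r / 2) Λ m Ω := by
      intro σ hσ hσa
      have hσ2 : σ * σ = 1 := by rw [← abs_mul_abs_self, hσ]; norm_num
      have := spread_or_lifted_of_pos he (f := σ • f) (by rw [norm_smul, Real.norm_eq_abs, hσ, hf, one_mul])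
        (by rw [inner_smul_right, hef, mul_zero]) hΩ hr hΛ hm h1 h2 h (fun s t hs1 ht1 => by
          have := hs s (σ * t) hs1 (by rwa [abs_mul, hσ, one_mul])
          convert this using 2
          rw [smul_smul, ← hσa]; congr 1; linear_combination a₂ * hσ2)
      rcases this with h | h
      · left
        simpa [smul_smul, hσ2] using h.smul_right hσ
      · exact Or.inr ⟨σ, hσ, h⟩
    rcases le_total 0 a₂ with h0 | h0
    · exact key 1 (by norm_num) (by rw [abs_of_nonneg h0, one_mul])
    · exact key (-1) (by norm_num) (by rw [abs_of_nonpos h0]; ring)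
  · left
    have hrad : m * r / (2 * (Λ + 1)) ≤ r / 2 := by
      rw [div_le_div_iff₀ (by linarith) two_pos]
      nlinarith
    refine ⟨a₁, h1, fun s t hs1 ht1 => ?_⟩
    have := hs s (t - a₂) (by linarith) ((abs_sub _ _).trans (by linarith))
    simpa using this

theorem inner_eq_frame {e f : R2} (he : ‖e‖ = 1) (hf : ‖f‖ = 1) (hef : ⟪e, f⟫ = 0) (x y : R2) :
    ⟪x, y⟫ = ⟪x, e⟫ * ⟪e, y⟫ + ⟪x, f⟫ * ⟪f, y⟫ := by
  conv_lhs => rw [frame_expansion he hf hef x, inner_add_left, real_inner_smul_left, real_inner_smul_left]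

theorem abs_inner_cross {e f e' f' : R2} (he : ‖e‖ = 1) (hf : ‖f‖ = 1) (hef : ⟪e, f⟫ = 0)
    (he' : ‖e'‖ = 1) (hf' : ‖f'‖ = 1) (hef' : ⟪e', f'⟫ = 0) : |⟪f, e'⟫| = |⟪e, f'⟫| := by
  have h1 := inner_eq_frame he hf hef e' e'
  have h2 := inner_eq_frame he' hf' hef' e e
  rw [real_inner_self_eq_norm_sq, he', real_inner_comm e e', real_inner_comm f e'] at h1
  rw [real_inner_self_eq_norm_sq, he, real_inner_comm e e', real_inner_comm e f'] at h2
  rw [← sq_eq_sq_iff_abs_eq_abs]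
  linarith

/-- Comparison of the gauges of two orthonormal frames making a small angle. -/
theorem gauge2_le_of_tilt {e f e' f' : R2} (he : ‖e‖ = 1) (hf : ‖f‖ = 1) (hef : ⟪e, f⟫ = 0)
    (he' : ‖e'‖ = 1) (hf' : ‖f'‖ = 1) (hef' : ⟪e', f'⟫ = 0) {C L l : ℝ} (hC : 0 ≤ C) (hl : 0 < l)
    (hlL : l ≤ L) (ht : |⟪e, f'⟫| ≤ C * (l / L)) (x : R2) :
    gauge2 e' f' L l x ≤ (1 + C) * gauge2 e f L l x := by
  have hL := hl.trans_le hlL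
  have ht' : |⟪f, e'⟫| ≤ C * (l / L) := by rwa [abs_inner_cross he hf hef he' hf' hef']
  have n1 : |⟪e, e'⟫| ≤ 1 := by simpa [he, he'] using abs_real_inner_le_norm e e'
  have n2 : |⟪f, f'⟫| ≤ 1 := by simpa [hf, hf'] using abs_real_inner_le_norm f f'
  have k1 : |⟪x, e'⟫| ≤ |⟪x, e⟫| + |⟪x, f⟫| * (C * (l / L)) := by
    rw [inner_eq_frame he hf hef x e']
    refine (abs_add_le _ _).trans ?_
    rw [abs_mul, abs_mul]
    gcongr
    exact mul_le_of_le_one_right (abs_nonneg _) n1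
  have k2 : |⟪x, f'⟫| ≤ |⟪x, e⟫| * (C * (l / L)) + |⟪x, f⟫| := by
    rw [inner_eq_frame he hf hef x f']
    refine (abs_add_le _ _).trans ?_
    rw [abs_mul, abs_mul]
    gcongr
    exact mul_le_of_le_one_right (abs_nonneg _) n2
  have k3 : l / L / L ≤ 1 / l := by
    rw [div_div, div_le_div_iff₀ (by positivity) hl]; nlinarith
  unfold gauge2
  calc |⟪x, e'⟫| / L + |⟪x, f'⟫| / l
      ≤ (|⟪x, e⟫| + |⟪x, f⟫| * (C * (l / L))) / L + (|⟪x, e⟫| * (C * (l / L)) + |⟪x, f⟫|) / l := by gcongr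
    _ = (1 + C) * (|⟪x, e⟫| / L) + |⟪x, f⟫| / l + |⟪x, f⟫| * C * (l / L / L) := by field_simp; ring
    _ ≤ (1 + C) * (|⟪x, e⟫| / L) + |⟪x, f⟫| / l + |⟪x, f⟫| * C * (1 / l) := by gcongr
    _ = _ := by ring

section
variable {δ : ℝ} {u v : R2 → ℝ} {Ω₁ Ω₂ : Set R2} {L l : ℝ → ℝ} {e f : ℝ → R2}

/-- In the frame `e', f'` the domain contains a square of half-side `δ / 4`. -/
theorem Fam.exists_square (F : Fam δ u v Ω₁ Ω₂ L l e f) {e' f' : R2} (he' : ‖e'‖ = 1) (hf' : ‖f'‖ = 1)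
    (hef' : ⟪e', f'⟫ = 0) : ∃ a₁ a₂ : ℝ, |a₁| ≤ 2 / δ ∧ |a₂| ≤ 2 / δ ∧
      ∀ s t : ℝ, |s| ≤ δ / 4 → |t| ≤ δ / 4 → (a₁ + s) • e' + (a₂ + t) • f' ∈ Ω₁ := by
  have h1 : (1 : ℝ) ∈ Ioc (0 : ℝ) 1 := by simp
  have hδ := F.pos
  obtain ⟨c, hc, hs⟩ := (F.s1 1 h1).e2
  rw [F.L1, F.l1] at hc hs
  have he := F.ne 1 h1
  have hf := F.nf 1 h1
  have hef := F.ef 1 h1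
  have hnorm : ‖c‖ ≤ 2 / δ := by
    refine le_trans ?_ hc
    simp only [gauge2, div_one]
    conv_lhs => rw [frame_expansion he hf hef c]
    refine (norm_add_le _ _).trans ?_
    rw [norm_smul, norm_smul, he, hf, mul_one, mul_one, Real.norm_eq_abs, Real.norm_eq_abs]
  have b1 : |⟪c, e'⟫| ≤ ‖c‖ := by simpa [he'] using abs_real_inner_le_norm c e'
  have b2 : |⟪c, f'⟫| ≤ ‖c‖ := by simpa [hf'] using abs_real_inner_le_norm c f'
  refine ⟨⟪c, e'⟫, ⟪c, f'⟫, b1.trans hnorm, b2.trans hnorm, fun s t hs1 ht1 => ?_⟩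
  have hz := (hs ((s / δ) • e' + (t / δ) • f') ?_).1
  · convert hz using 1
    conv_rhs => rw [frame_expansion he' hf' hef' c]
    simp only [smul_add, smul_smul]
    rw [mul_div_cancel₀ _ hδ.ne', mul_div_cancel₀ _ hδ.ne']
    module
  · have key : ∀ w : R2, ‖w‖ = 1 → |⟪(s / δ) • e' + (t / δ) • f', w⟫| ≤ 1 / 2 := by
      intro w hw
      have b3 := abs_real_inner_le_norm ((s / δ) • e' + (t / δ) • f') w
      rw [hw, mul_one] at b3
      refine b3.trans ((norm_add_le _ _).trans ?_)
      rw [norm_smul, norm_smul, he', hf', mul_one, mul_one, Real.norm_eq_abs, Real.norm_eq_abs, abs_div, abs_div,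
        abs_of_pos hδ, ← add_div, div_le_iff₀ hδ]
      linarith
    simp only [gauge2, div_one]
    linarith [key _ he, key _ hf]

/-- Bounds for `u` in a frame tilted by a small angle from the frames at the heights `h` and `h'`. -/
theorem Fam.half_win (F : Fam δ u v Ω₁ Ω₂ L l e f) {e' f' : R2} (he' : ‖e'‖ = 1) (hf' : ‖f'‖ = 1)
    (hef' : ⟪e', f'⟫ = 0) {h h' C : ℝ} (hh : h ∈ Ioc (0 : ℝ) 1) (hh' : h' ∈ Ioc (0 : ℝ) 1) (hC : 0 ≤ C)
    (ht : |⟪e', f h⟫| ≤ C * (l h / L h)) (ht' : |⟪e', f h'⟫| ≤ C * (l h' / L h')) :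
    (∀ X : Pl, |X.1| ≤ δ / (8 * (1 + C)) → |X.2| ≤ δ / (8 * (1 + C)) → u (fr e' f' (L h) (l h) X) ≤ 8 * h) ∧
    (∀ s, |s| ≤ δ * L h' / (4 * (1 + C) * L h) → u (fr e' f' (L h) (l h) (s, 0)) ≤ 8 * h') ∧
    ∀ lam σ ρ, 0 < σ → h ≤ σ → lam * (8 * (1 + C) * ρ) ≤ δ → 0 ≤ lam →
      (∀ x, gauge2 (e (h / σ)) (f (h / σ)) (L (h / σ)) (l (h / σ)) x ≤
        lam * gauge2 (e h) (f h) (L h) (l h) x) →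
      ∀ X : Pl, |X.1| ≤ ρ → |X.2| ≤ ρ → u (fr e' f' (L h) (l h) X) ≤ 8 * (h / σ) := by
  have hl := F.lpos h hh
  have hL := F.Lpos hh
  have hl' := F.lpos h' hh'
  have hL' := F.Lpos hh'
  have hδ := F.pos
  have g1 := gauge2_le_of_tilt he' hf' hef' (F.ne h hh) (F.nf h hh) (F.ef h hh) hC hl (F.lL h hh) ht
  have g2 := gauge2_le_of_tilt he' hf' hef' (F.ne h' hh') (F.nf h' hh') (F.ef h' hh') hC hl' (F.lL h' hh') ht'
  have g3 : ∀ (X : Pl) (ρ : ℝ), |X.1| ≤ ρ → |X.2| ≤ ρ →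
      gauge2 (e h) (f h) (L h) (l h) (fr e' f' (L h) (l h) X) ≤ (1 + C) * (2 * ρ) := by
    intro X ρ h1 h2
    refine (g1 _).trans ?_
    rw [gauge2_fr he' hf' hef' hL hl]
    gcongr
    linarith
  refine ⟨fun X h1 h2 => (F.s1 h hh).e1 _ ((g3 X _ h1 h2).trans (le_of_eq ?_)), fun s hs => ?_, ?_⟩
  · field_simp; ring
  · refine (F.s1 h' hh').e1 _ ((g2 _).trans ?_)
    rw [gauge2, inner_fr_left he' hef', inner_fr_right hf' hef']
    simp only [mul_zero, abs_zero, zero_div, add_zero]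
    rw [abs_mul, abs_of_pos hL]
    calc (1 + C) * (L h * |s| / L h') ≤ (1 + C) * (L h * (δ * L h' / (4 * (1 + C) * L h)) / L h') := by gcongr
      _ = δ / 4 := by field_simp
  · intro lam σ ρ hσ hhσ hlam hlam0 hst X h1 h2
    have hσh : h / σ ∈ Ioc (0 : ℝ) 1 := ⟨div_pos hh.1 hσ, (div_le_one hσ).2 hhσ⟩
    refine (F.s1 _ hσh).e1 _ ((hst _).trans ?_)
    have := mul_le_mul_of_nonneg_left (g3 X ρ h1 h2) hlam0
    linarith

end

theorem Fam.exists_strict_seq {δ : ℝ} (hδ : 0 < δ) {lam : ℕ → ℝ} (hlam : ∀ n, 0 < lam n) :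
    ∃ σ : ℕ → ℝ, (∀ n, 0 < σ n) ∧ (∀ n, σ n ≤ 1) ∧ Antitone σ ∧
      ∀ (n : ℕ) (u v : R2 → ℝ) (Ω₁ Ω₂ : Set R2) (L l : ℝ → ℝ) (e f : ℝ → R2),
        Fam δ u v Ω₁ Ω₂ L l e f → ∀ h ∈ Ioc (0 : ℝ) 1, h ≤ σ n → ∀ x,
          gauge2 (e (h / σ n)) (f (h / σ n)) (L (h / σ n)) (l (h / σ n)) x ≤
            lam n * gauge2 (e h) (f h) (L h) (l h) x := by
  choose σ' h0 h1 H using fun n => Fam.strict hδ (hlam n)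
  set σ : ℕ → ℝ := fun n => Nat.rec (σ' 0) (fun n s => min s (σ' (n + 1))) n with hσ
  have hsucc : ∀ n, σ (n + 1) = min (σ n) (σ' (n + 1)) := fun n => rfl
  have hpos : ∀ n, 0 < σ n := by
    intro n
    induction n with
    | zero => exact h0 0
    | succ n ih => rw [hsucc]; exact lt_min ih (h0 _)
  have hle : ∀ n, σ n ≤ σ' n := by
    intro n
    cases n with
    | zero => exact le_rfl
    | succ n => rw [hsucc]; exact min_le_right _ _
  refine ⟨σ, hpos, fun n => (hle n).trans (h1 n), antitone_nat_of_succ_le fun n => ?_, ?_⟩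
  · rw [hsucc]; exact min_le_left _ _
  · intro n u v Ω₁ Ω₂ L l e f F h hh hhσ
    have ht : h / σ n ∈ Ioc (0 : ℝ) 1 := ⟨div_pos hh.1 (hpos n), (div_le_one (hpos n)).2 hhσ⟩
    refine H n u v Ω₁ Ω₂ L l e f F _ ht h hh ?_
    calc h = σ n * (h / σ n) := by have := (hpos n).ne'; field_simp
      _ ≤ _ := by gcongr; exacts [ht.1.le, hle n]

section
variable {δ : ℝ} {u v : R2 → ℝ} {Ω₁ Ω₂ : Set R2} {L l : ℝ → ℝ} {e f : ℝ → R2}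

/-- Two heights at which the frames are close to `e', f'` produce a window. -/
theorem Fam.winAt (F : Fam δ u v Ω₁ Ω₂ L l e f) {e' f' : R2} (he' : ‖e'‖ = 1) (hf' : ‖f'‖ = 1)
    (hef' : ⟪e', f'⟫ = 0) {h h' C : ℝ} (hh : h ∈ Ioc (0 : ℝ) 1) (hh' : h' ∈ Ioc (0 : ℝ) 1) (hC : 0 ≤ C)
    (ht : |⟪e', f h⟫| ≤ C * (l h / L h)) (ht' : |⟪e', f h'⟫| ≤ C * (l h' / L h'))
    {σ : ℕ → ℝ} (hσ0 : ∀ n, 0 < σ n) (hσ : Antitone σ)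
    (hst : ∀ (n : ℕ) (u v : R2 → ℝ) (Ω₁ Ω₂ : Set R2) (L l : ℝ → ℝ) (e f : ℝ → R2),
        Fam δ u v Ω₁ Ω₂ L l e f → ∀ h ∈ Ioc (0 : ℝ) 1, h ≤ σ n → ∀ x,
          gauge2 (e (h / σ n)) (f (h / σ n)) (L (h / σ n)) (l (h / σ n)) x ≤
            δ / (8 * (1 + C) * (n + 1)) * gauge2 (e h) (f h) (L h) (l h) x)
    {R p : ℝ} (hR : h ≤ σ ⌈R⌉₊) (hp : p ≤ δ * L h' / (4 * (1 + C) * L h)) :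
    WinAt (8 * h' / h) (δ / (8 * (1 + C))) p R (fun ρ => 8 / σ ⌈ρ⌉₊) u v Ω₁ Ω₂ e' f' (L h) (l h) := by
  have hδ := F.pos
  have hfe' : ⟪f', e'⟫ = 0 := by rw [real_inner_comm, hef']
  have h0 := hh.1
  obtain ⟨a1, a2, a3⟩ := F.half_win he' hf' hef' hh hh' hC ht ht'
  obtain ⟨b1, b2, b3⟩ := F.swap.half_win hf' he' hfe' hh hh' hC
    (by rwa [abs_inner_cross he' hf' hef' (F.ne h hh) (F.nf h hh) (F.ef h hh)])
    (by rwa [abs_inner_cross he' hf' hef' (F.ne h' hh') (F.nf h' hh') (F.ef h' hh')])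
  have box : ∀ ρ : ℝ, ρ ≤ R → h ≤ σ ⌈ρ⌉₊ ∧ δ / (8 * (1 + C) * (⌈ρ⌉₊ + 1)) * (8 * (1 + C) * ρ) ≤ δ := by
    intro ρ hρ
    refine ⟨hR.trans (hσ (Nat.ceil_mono hρ)), ?_⟩
    have := Nat.le_ceil ρ
    rw [div_mul_eq_mul_div, div_le_iff₀ (by positivity)]
    have : δ * (8 * (1 + C) * ρ) ≤ δ * (8 * (1 + C) * (⌈ρ⌉₊ + 1)) := by gcongr; linarith
    exact this
  have scale : ∀ ρ : ℝ, 8 / σ ⌈ρ⌉₊ * h = 8 * (h / σ ⌈ρ⌉₊) := fun ρ => by ring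
  unfold WinAt
  rw [F.Ll h hh]
  constructor
  · have := F.core.normalize he' hf' hef' (F.Lpos hh) (F.lpos h hh)
    rwa [F.Ll h hh] at this
  · intro ρ hρ X h1 h2
    rw [div_le_iff₀ h0, scale]
    exact a3 _ _ ρ (hσ0 _) (box ρ hρ).1 (box ρ hρ).2 (by positivity)
      (hst _ u v Ω₁ Ω₂ L l e f F h hh (box ρ hρ).1) X h1 h2
  · intro ρ hρ X h1 h2
    rw [div_le_iff₀ h0, scale, fr_swap]
    exact b3 _ _ ρ (hσ0 _) (box ρ hρ).1 (box ρ hρ).2 (by positivity)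
      (hst _ v u Ω₂ Ω₁ L l f e F.swap h hh (box ρ hρ).1) X.swap h2 h1
  · intro X h1 h2
    rw [div_le_iff₀ h0]
    exact a1 X h1 h2
  · intro X h1 h2
    rw [div_le_iff₀ h0, fr_swap]
    exact b1 X.swap h2 h1
  · intro s hs
    rw [div_le_div_iff_of_pos_right h0]
    exact a2 s (hs.trans hp)
  · intro s hs
    rw [div_le_div_iff_of_pos_right h0, fr_swap]
    exact b2 s (hs.trans hp)

theorem Fam.inner_div_le (F : Fam δ u v Ω₁ Ω₂ L l e f) {h h' : ℝ} (hh : h ∈ Ioc (0 : ℝ) 1)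
    (hh' : h' ∈ Ioc (0 : ℝ) 1) :
    1 / L h' ≤ 64 / δ ^ 2 * (1 + h / h') / L h ∧
      |⟪e h, f h'⟫| / l h' ≤ 64 / δ ^ 2 * (1 + h / h') / L h := by
  have hL := F.Lpos hh
  have hL' := F.Lpos hh'
  have hl' := F.lpos h' hh'
  have hn := F.ne h hh
  have hE := F.engulf hh hh' (e h)
  have e1 : gauge2 (e h) (f h) (L h) (l h) (e h) = 1 / L h := by
    rw [gauge2, F.ef h hh, real_inner_self_eq_norm_sq, hn]; simp
  rw [e1, mul_one_div] at hE
  refine ⟨le_trans ?_ hE, le_trans ?_ hE⟩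
  · rw [gauge2]
    have h1 : |⟪e h, f h'⟫| / L h' ≤ |⟪e h, f h'⟫| / l h' := by gcongr; exact F.lL h' hh'
    have h2 : 1 ≤ |⟪e h, e h'⟫| + |⟪e h, f h'⟫| := by
      have := frame_expansion (F.ne h' hh') (F.nf h' hh') (F.ef h' hh') (e h)
      have h3 := norm_add_le (⟪e h, e h'⟫ • e h') (⟪e h, f h'⟫ • f h')
      rwa [← this, norm_smul, norm_smul, hn, F.ne h' hh', F.nf h' hh', mul_one, mul_one] at h3
    have h4 : 1 / L h' ≤ (|⟪e h, e h'⟫| + |⟪e h, f h'⟫|) / L h' := by gcongr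
    rw [add_div] at h4
    linarith
  · rw [gauge2]
    have : 0 ≤ |⟪e h, e h'⟫| / L h' := by positivity
    linarith

theorem Fam.L_le (F : Fam δ u v Ω₁ Ω₂ L l e f) {h h' : ℝ} (hh : h ∈ Ioc (0 : ℝ) 1)
    (hh' : h' ∈ Ioc (0 : ℝ) 1) : L h ≤ 64 / δ ^ 2 * (1 + h / h') * L h' := by
  have := (F.inner_div_le hh hh').1
  rwa [div_le_div_iff₀ (F.Lpos hh') (F.Lpos hh), one_mul] at this

theorem Fam.abs_inner_le (F : Fam δ u v Ω₁ Ω₂ L l e f) {h h' : ℝ} (hh : h ∈ Ioc (0 : ℝ) 1)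
    (hh' : h' ∈ Ioc (0 : ℝ) 1) : |⟪e h, f h'⟫| ≤ 64 / δ ^ 2 * (1 + h / h') * (l h' / L h) := by
  have := (F.inner_div_le hh hh').2
  rw [div_le_iff₀ (F.lpos h' hh')] at this
  linarith [show 64 / δ ^ 2 * (1 + h / h') / L h * l h' = 64 / δ ^ 2 * (1 + h / h') * (l h' / L h) by ring]

end

/-- Selection of two records at bounded distance in a sequence with bounded increments growing linearly. -/
theorem exists_two_records {c a Δ : ℝ} (hc : 0 < c) (ha : 0 < a) (hΔ : 0 < Δ) : ∃ N : ℕ, ∀ X : ℝ, 0 ≤ X →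
    ∃ K : ℕ, ∀ n ≥ K, ∀ b : ℕ → ℝ, b 0 = 0 → (∀ k < n, |b (k + 1) - b k| ≤ c) →
      (∀ k, 1 ≤ k → k ≤ n → a * k ≤ b k) →
      ∃ k k', k < k' ∧ k' ≤ K ∧ k' ≤ k + N ∧ (∀ j, k ≤ j → j ≤ n → b k ≤ b j) ∧
        (∀ j, k' ≤ j → j ≤ n → b k' ≤ b j) ∧ Δ ≤ b k' - b k ∧ X ≤ b k ∧ X ≤ c * k ∧
        Δ ≤ c * (k' - k) := by
  set N := ⌈(1 + Δ + c) / a⌉₊ with hN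
  have hNle : 1 + Δ + c ≤ N * a := by rw [← div_le_iff₀ ha]; exact Nat.le_ceil _
  refine ⟨N, fun X hX => ?_⟩
  set m := ⌈X + c⌉₊ with hm
  have hmle : X + c ≤ m := Nat.le_ceil _
  set Y : ℕ → ℝ := fun i => X + c + i * (Δ + c) with hY
  have hYmono : ∀ i ≤ m, Y i ≤ Y m := by
    intro i hi
    have : (i : ℝ) ≤ m := by exact_mod_cast hi
    simp only [hY]; gcongr
  have hY0 : ∀ i, X + c ≤ Y i := fun i => by
    have : (0 : ℝ) ≤ i * (Δ + c) := by positivity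
    simp only [hY]; linarith
  set K := ⌈Y m / a⌉₊ + 1 with hK
  refine ⟨K, fun n hn b b0 hb hab => ?_⟩
  classical
  set κ : ℕ → ℕ := fun i => Nat.findGreatest (fun j => b j ≤ Y i) n with hκ
  have hκb : ∀ i, b (κ i) ≤ Y i := fun i =>
    Nat.findGreatest_spec (P := fun j => b j ≤ Y i) (Nat.zero_le n) (by rw [b0]; linarith [hY0 i])
  have hκn : ∀ i, κ i ≤ n := fun i => Nat.findGreatest_le n
  have hκgt : ∀ i j, κ i < j → j ≤ n → Y i < b j := fun i j h1 h2 => by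
    have := Nat.findGreatest_is_greatest (P := fun j => b j ≤ Y i) h1 h2
    exact not_le.1 this
  have hκY : ∀ i, a * κ i ≤ Y i := fun i => by
    rcases Nat.eq_zero_or_pos (κ i) with h | h
    · rw [h]; simp; linarith [hY0 i]
    · exact (hab _ h (hκn i)).trans (hκb i)
  have hκK : ∀ i ≤ m, κ i < K := fun i hi => by
    have h1 : (κ i : ℝ) ≤ Y m / a := by
      rw [le_div_iff₀ ha]; linarith [hκY i, hYmono i hi]
    have h2 : (κ i : ℝ) ≤ ⌈Y m / a⌉₊ := h1.trans (Nat.le_ceil _)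
    have h3 : κ i ≤ ⌈Y m / a⌉₊ := by exact_mod_cast h2
    omega
  have hlow : ∀ i ≤ m, Y i - c < b (κ i) := fun i hi => by
    have h1 := hκK i hi
    have h2 := hκgt i (κ i + 1) (Nat.lt_succ_self _) (by omega)
    have h3 := (abs_le.1 (hb (κ i) (by omega))).2
    linarith
  have hrec : ∀ i j, κ i ≤ j → j ≤ n → b (κ i) ≤ b j := fun i j h1 h2 => by
    rcases h1.eq_or_lt with h | h
    · rw [h]
    · exact (hκb i).trans (hκgt i j h h2).le
  have hinc : ∀ k d, k + d ≤ n → b (k + d) - b k ≤ c * d := by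
    intro k d
    induction d with
    | zero => intro _; simp
    | succ d ih =>
      intro h
      have h1 := ih (by omega)
      have h2 := (abs_le.1 (hb (k + d) (by omega))).2
      push_cast
      rw [← add_assoc]
      linarith
  have hgap : ∃ i < m, κ (i + 1) ≤ κ i + N := by
    by_contra! hcon
    have key : ∀ i ≤ m, i * (N + 1) ≤ κ i := by
      intro i
      induction i with
      | zero => intro _; simp
      | succ i ih =>
        intro hi
        have h1 := ih (by omega)
        have h2 := hcon i (by omega)
        have h3 : (i + 1) * (N + 1) = i * (N + 1) + (N + 1) := by ring
        omega
    have h1 : ((m * (N + 1) : ℕ) : ℝ) ≤ κ m := by exact_mod_cast key m le_rfl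
    push_cast at h1
    have h2 := hκY m
    have h3 : a * (m * (N + 1)) ≤ a * κ m := by gcongr
    have hmpos : (0 : ℝ) < m := by linarith
    have h4 : (m : ℝ) * (1 + Δ + c) ≤ m * (N * a) := by gcongr
    have h5 : Y m = X + c + m * (Δ + c) := rfl
    have h6 : 0 < m * a := by positivity
    linarith [show a * (m * (N + 1)) = m * (N * a) + m * a by ring,
      show (m : ℝ) * (1 + Δ + c) = m + m * (Δ + c) by ring]
  obtain ⟨i, hi, hgi⟩ := hgap
  have hΔi : Δ ≤ b (κ (i + 1)) - b (κ i) := by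
    have h1 := hlow (i + 1) (by omega)
    have h2 := hκb i
    have h3 : Y (i + 1) = Y i + (Δ + c) := by simp only [hY]; push_cast; ring
    linarith
  have hXi : X ≤ b (κ i) := by linarith [hlow i hi.le, hY0 i]
  have hlt : κ i < κ (i + 1) := by
    by_contra! h
    linarith [hrec (i + 1) (κ i) h (hκn i)]
  have hnn := hκn (i + 1)
  refine ⟨κ i, κ (i + 1), hlt, (hκK (i + 1) hi).le, hgi, hrec i, hrec (i + 1), hΔi, hXi, ?_, ?_⟩
  · have := hinc 0 (κ i) (by simpa using hκn i)
    rw [zero_add, b0] at this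
    linarith
  · obtain ⟨d, hd⟩ := Nat.exists_eq_add_of_lt hlt
    have h2 := hinc (κ i) (d + 1) (by omega)
    rw [show κ i + (d + 1) = κ (i + 1) by omega] at h2
    have h3 : ((κ (i + 1) : ℕ) : ℝ) = κ i + (d + 1) := by rw [hd]; push_cast; ring
    rw [h3]; push_cast at h2
    linarith

theorem abs_inner_le_one {x y : R2} (hx : ‖x‖ = 1) (hy : ‖y‖ = 1) : |⟪x, y⟫| ≤ 1 := by
  simpa [hx, hy] using abs_real_inner_le_norm x y

theorem half_pow_mem (k : ℕ) : (1 / 2 : ℝ) ^ k ∈ Ioc (0 : ℝ) 1 :=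
  ⟨by positivity, pow_le_one₀ (by norm_num) (by norm_num)⟩

section
variable {δ : ℝ} {u v : R2 → ℝ} {Ω₁ Ω₂ : Set R2} {L l : ℝ → ℝ} {e f : ℝ → R2}

theorem Fam.L_succ_le (F : Fam δ u v Ω₁ Ω₂ L l e f) (k : ℕ) :
    L ((1 / 2) ^ (k + 1)) ≤ 192 / δ ^ 2 * L ((1 / 2) ^ k) := by
  have hδ := F.pos
  have hL := F.Lpos (half_pow_mem k)
  refine (F.L_le (half_pow_mem (k + 1)) (half_pow_mem k)).trans ?_
  have : (1 / 2 : ℝ) ^ (k + 1) / (1 / 2) ^ k = 1 / 2 := by rw [pow_succ]; field_simp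
  rw [this]
  gcongr
  rw [div_mul_eq_mul_div]
  gcongr
  norm_num

theorem Fam.L_le_succ (F : Fam δ u v Ω₁ Ω₂ L l e f) (k : ℕ) :
    L ((1 / 2) ^ k) ≤ 192 / δ ^ 2 * L ((1 / 2) ^ (k + 1)) := by
  have hδ := F.pos
  refine (F.L_le (half_pow_mem k) (half_pow_mem (k + 1))).trans (le_of_eq ?_)
  have : (1 / 2 : ℝ) ^ k / (1 / 2) ^ (k + 1) = 2 := by rw [pow_succ]; field_simp
  rw [this]
  ring

theorem Fam.tilt_le (F : Fam δ u v Ω₁ Ω₂ L l e f) {q : ℝ} (hq0 : 0 < q) (hq1 : q < 1) {k n : ℕ} (hkn : k ≤ n)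
    (hrec : ∀ d, k + d ≤ n → l ((1 / 2) ^ (k + d)) / L ((1 / 2) ^ (k + d)) ≤
      q ^ d * (l ((1 / 2) ^ k) / L ((1 / 2) ^ k))) :
    |⟪e ((1 / 2) ^ n), f ((1 / 2) ^ k)⟫| ≤
      (192 / δ ^ 2) ^ 2 / (1 - q) * (l ((1 / 2) ^ k) / L ((1 / 2) ^ k)) := by
  have hδ := F.pos
  set C := 192 / δ ^ 2 with hC
  have hC0 : 0 < C := by positivity
  set w := l ((1 / 2) ^ k) / L ((1 / 2) ^ k) with hw
  have hw0 : 0 < w := div_pos (F.lpos _ (half_pow_mem k)) (F.Lpos (half_pow_mem k))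
  have hq : 0 < 1 - q := by linarith
  have step : ∀ j, |⟪e ((1 / 2) ^ (j + 1)), f ((1 / 2) ^ j)⟫| ≤
      C ^ 2 * (l ((1 / 2) ^ j) / L ((1 / 2) ^ j)) := by
    intro j
    have hL := F.Lpos (half_pow_mem j)
    have hL' := F.Lpos (half_pow_mem (j + 1))
    have hl := F.lpos _ (half_pow_mem j)
    refine (F.abs_inner_le (half_pow_mem (j + 1)) (half_pow_mem j)).trans ?_
    have h1 : (1 / 2 : ℝ) ^ (j + 1) / (1 / 2) ^ j = 1 / 2 := by rw [pow_succ]; field_simp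
    have h2 : 64 / δ ^ 2 * (1 + 1 / 2) ≤ C := by
      rw [hC, div_mul_eq_mul_div]; gcongr; norm_num
    have h3 : l ((1 / 2) ^ j) / L ((1 / 2) ^ (j + 1)) ≤ C * (l ((1 / 2) ^ j) / L ((1 / 2) ^ j)) := by
      rw [← mul_div_assoc, div_le_div_iff₀ hL' hL]
      have := mul_le_mul_of_nonneg_left (F.L_le_succ j) hl.le
      linarith
    rw [h1, pow_two C, mul_assoc C]
    exact mul_le_mul h2 h3 (by positivity) hC0.le
  have main : ∀ i d, k + d + i = n →
      |⟪e ((1 / 2) ^ n), f ((1 / 2) ^ (k + d))⟫| ≤ C ^ 2 / (1 - q) * w * q ^ d := by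
    intro i
    induction i with
    | zero =>
      intro d hd
      rw [add_zero] at hd
      rw [hd, F.ef _ (half_pow_mem n), abs_zero]
      positivity
    | succ i ih =>
      intro d hd
      have h1 := ih (d + 1) (by omega)
      have h2 := step (k + d)
      have h3 := hrec d (by omega)
      have m1 := half_pow_mem (k + d + 1)
      rw [← add_assoc] at h1
      rw [inner_eq_frame (F.ne _ m1) (F.nf _ m1) (F.ef _ m1)]
      have n1 : |⟪e ((1 / 2) ^ n), e ((1 / 2) ^ (k + d + 1))⟫| ≤ 1 :=
        abs_inner_le_one (F.ne _ (half_pow_mem n)) (F.ne _ m1)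
      have n2 : |⟪f ((1 / 2) ^ (k + d + 1)), f ((1 / 2) ^ (k + d))⟫| ≤ 1 :=
        abs_inner_le_one (F.nf _ m1) (F.nf _ (half_pow_mem (k + d)))
      refine (abs_add_le _ _).trans ?_
      rw [abs_mul, abs_mul]
      have p1 := mul_le_of_le_one_left (abs_nonneg (⟪e ((1 / 2) ^ (k + d + 1)), f ((1 / 2) ^ (k + d))⟫)) n1
      have p2 := mul_le_of_le_one_right (abs_nonneg (⟪e ((1 / 2) ^ n), f ((1 / 2) ^ (k + d + 1))⟫)) n2
      have p3 : C ^ 2 * (l ((1 / 2) ^ (k + d)) / L ((1 / 2) ^ (k + d))) ≤ C ^ 2 * (q ^ d * w) := by gcongr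
      have p4 : C ^ 2 / (1 - q) * w * q ^ d = C ^ 2 * (q ^ d * w) + C ^ 2 / (1 - q) * w * q ^ (d + 1) := by
        rw [pow_succ]; field_simp; ring
      linarith
  have := main (n - k) 0 (by omega)
  simpa using this

end

theorem exists_geo {c : ℝ} (hc0 : 0 < c) (hc1 : c ≤ 1) : ∃ a M b : ℝ, 0 < a ∧ 0 < M ∧
    ∀ θ : ℝ, 0 < θ → ∃ k s τ B, Geo θ c a M b k s τ B := by
  obtain ⟨a, ha⟩ : ∃ a, a = 11 / c := ⟨_, rfl⟩
  have ha0 : 0 < a := by rw [ha]; positivity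
  have hM0 : 0 < 16 * (a + 1) ^ 2 := by positivity
  refine ⟨a, 16 * (a + 1) ^ 2, 1 / (8 * (a + 1)), ha0, hM0, fun θ hθ => ?_⟩
  generalize hM : 16 * (a + 1) ^ 2 = M at hM0 ⊢
  have hτ0 : 0 < min 1 (θ / 3) := by positivity
  have hτθ : 3 * min 1 (θ / 3) ≤ θ := by linarith [min_le_right 1 (θ / 3)]
  have hτ1 : min 1 (θ / 3) ≤ 1 := min_le_left _ _
  generalize min 1 (θ / 3) = τ at *
  have h1 : 1 ≤ 1 / τ := by rw [le_div_iff₀ hτ0]; linarith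
  have hs1 : min 1 (τ / (3 * M)) ≤ 1 := min_le_left _ _
  refine ⟨1 + τ, min 1 (τ / (3 * M)), τ, 1 / τ, ?_⟩
  constructor
  · exact hc0
  · exact hc1
  · rw [ha]; field_simp; norm_num
  · exact ha0
  · exact hM0
  · positivity
  · rw [div_le_one (by positivity)]; linarith
  · rw [← hM]
    have : 16 * (a + 1) ^ 2 * (1 / (8 * (a + 1))) ^ 2 = 1 / 4 := by field_simp; norm_num
    rw [this]; norm_num
  · rw [← hM]
    have : 16 * (a + 1) ^ 2 * (1 / (8 * (a + 1))) = 2 * (a + 1) := by field_simp; norm_num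
    rw [this]; linarith
  · rw [div_le_iff₀ hM0, ← hM]; nlinarith
  · linarith
  · linarith
  · positivity
  · exact hs1
  · have := min_le_right 1 (τ / (3 * M))
    rwa [le_div_iff₀ (by positivity), mul_comm] at this
  · exact hτ0
  · exact hτ1
  · exact hτθ
  · positivity
  · linarith
  · rw [mul_one_div_cancel hτ0.ne']

section
variable {δ : ℝ} {u v : R2 → ℝ} {Ω₁ Ω₂ : Set R2} {L l : ℝ → ℝ} {e f : ℝ → R2}

theorem Fam.ecc_eq (F : Fam δ u v Ω₁ Ω₂ L l e f) {h : ℝ} (hh : h ∈ Ioc (0 : ℝ) 1) :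
    L h / l h = L h ^ 2 / h := by
  have := F.lpos h hh
  have := F.Lpos hh
  rw [div_eq_div_iff (by positivity) hh.1.ne']
  linear_combination -L h * F.Ll h hh

theorem Fam.ecc_pos (F : Fam δ u v Ω₁ Ω₂ L l e f) {h : ℝ} (hh : h ∈ Ioc (0 : ℝ) 1) : 0 < L h / l h :=
  div_pos (F.Lpos hh) (F.lpos h hh)

theorem Fam.abs_log_ecc_sub_le (F : Fam δ u v Ω₁ Ω₂ L l e f) (k : ℕ) :
    |Real.log (L ((1 / 2) ^ (k + 1)) / l ((1 / 2) ^ (k + 1))) - Real.log (L ((1 / 2) ^ k) / l ((1 / 2) ^ k))| ≤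
      Real.log (2 * (192 / δ ^ 2) ^ 2) := by
  have hδ := F.pos
  have m1 := half_pow_mem k
  have m2 := half_pow_mem (k + 1)
  have p1 := F.ecc_pos m1
  have p2 := F.ecc_pos m2
  have hL := F.Lpos m1
  have hL' := F.Lpos m2
  have hC : 0 < 192 / δ ^ 2 := by positivity
  have i1 := F.L_succ_le k
  have i2 := F.L_le_succ k
  have e1 := F.ecc_eq m1
  have e2 := F.ecc_eq m2
  generalize 192 / δ ^ 2 = C at *
  have j1 : L ((1 / 2) ^ (k + 1)) ^ 2 ≤ C ^ 2 * L ((1 / 2) ^ k) ^ 2 := by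
    rw [← mul_pow]; gcongr
  have j2 : L ((1 / 2) ^ k) ^ 2 ≤ C ^ 2 * L ((1 / 2) ^ (k + 1)) ^ 2 := by
    rw [← mul_pow]; gcongr
  have e3 : L ((1 / 2) ^ (k + 1)) ^ 2 / (1 / 2) ^ (k + 1) = 2 * L ((1 / 2) ^ (k + 1)) ^ 2 / (1 / 2) ^ k := by
    rw [pow_succ (1 / 2 : ℝ)]; field_simp
  have d1 : L ((1 / 2) ^ (k + 1)) / l ((1 / 2) ^ (k + 1)) ≤ 2 * C ^ 2 * (L ((1 / 2) ^ k) / l ((1 / 2) ^ k)) := by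
    rw [e1, e2, e3, ← mul_div_assoc]
    gcongr ?_ / _
    linarith
  have d2 : L ((1 / 2) ^ k) / l ((1 / 2) ^ k) ≤ 2 * C ^ 2 * (L ((1 / 2) ^ (k + 1)) / l ((1 / 2) ^ (k + 1))) := by
    rw [e1, e2, e3, ← mul_div_assoc]
    gcongr ?_ / _
    have : 0 < C ^ 2 * L ((1 / 2) ^ (k + 1)) ^ 2 := by positivity
    linarith
  have t1 := Real.log_le_log p2 d1
  have t2 := Real.log_le_log p1 d2
  rw [Real.log_mul (by positivity) p1.ne'] at t1
  rw [Real.log_mul (by positivity) p2.ne'] at t2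
  rw [abs_le]
  constructor <;> linarith

theorem Fam.inv_ecc_le_of_log (F : Fam δ u v Ω₁ Ω₂ L l e f) {q : ℝ} (hq : 0 < q) {k d : ℕ}
    (h : Real.log (L ((1 / 2) ^ k) / l ((1 / 2) ^ k)) + k * Real.log q ≤
      Real.log (L ((1 / 2) ^ (k + d)) / l ((1 / 2) ^ (k + d))) + (k + d : ℕ) * Real.log q) :
    l ((1 / 2) ^ (k + d)) / L ((1 / 2) ^ (k + d)) ≤ q ^ d * (l ((1 / 2) ^ k) / L ((1 / 2) ^ k)) := by
  have p1 := F.ecc_pos (half_pow_mem k)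
  have p2 := F.ecc_pos (half_pow_mem (k + d))
  rw [← inv_div (L ((1 / 2) ^ (k + d))), ← inv_div (L ((1 / 2) ^ k))]
  generalize L ((1 / 2) ^ k) / l ((1 / 2) ^ k) = x at *
  generalize L ((1 / 2) ^ (k + d)) / l ((1 / 2) ^ (k + d)) = y at *
  have h1 : Real.log x ≤ Real.log (y * q ^ d) := by
    rw [Real.log_mul p2.ne' (by positivity), Real.log_pow]
    push_cast at h
    linarith
  have h2 := (Real.log_le_log_iff p1 (by positivity)).1 h1
  rw [← div_eq_mul_inv, le_div_iff₀ p1, inv_mul_le_iff₀ p2]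
  exact h2

end

set_option maxHeartbeats 2000000 in
/-- If the eccentricity grows on all dyadic scales, there is a height with `l` bounded below at which the
two domains cannot both be lifted or spread. -/
theorem exists_window {δ ε : ℝ} (hδ : 0 < δ) (hδ1 : δ ≤ 1) (hε : 0 < ε) : ∃ m : ℝ, 0 < m ∧ m ≤ 1 ∧
    ∀ r : ℝ, 0 < r → r ≤ 1 → ∃ (K : ℕ) (ρ : ℝ), 0 < ρ ∧ ∀ n ≥ K,
      ∀ (u v : R2 → ℝ) (Ω₁ Ω₂ : Set R2) (L l : ℝ → ℝ) (e f : ℝ → R2), Fam δ u v Ω₁ Ω₂ L l e f →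
        (∀ k : ℕ, 1 ≤ k → k ≤ n → ((1 / 2 : ℝ) ^ k) ^ (-ε) < L ((1 / 2) ^ k) / l ((1 / 2) ^ k)) →
        ∃ ℓ, ρ ≤ ℓ ∧ ℓ ≤ 1 ∧ (Alt (e ((1 / 2) ^ n)) (f ((1 / 2) ^ n)) r (2 / δ) (m * ℓ) Ω₁ →
          Alt (f ((1 / 2) ^ n)) (e ((1 / 2) ^ n)) r (2 / δ) (m * ℓ) Ω₂ → False) := by
  have hlog2 : 0 < Real.log 2 := Real.log_pos one_lt_two
  obtain ⟨q, hq0, hq1, hlogq⟩ : ∃ q : ℝ, 0 < q ∧ q < 1 ∧ Real.log q = -(ε / 2 * Real.log 2) := by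
    refine ⟨Real.exp (-(ε / 2 * Real.log 2)), Real.exp_pos _, ?_, Real.log_exp _⟩
    rw [Real.exp_lt_one_iff]
    have : 0 < ε / 2 * Real.log 2 := by positivity
    linarith
  set a₀ := ε / 2 * Real.log 2 with ha₀
  have ha₀pos : 0 < a₀ := by positivity
  have hC3 : 192 ≤ 192 / δ ^ 2 := by
    rw [le_div_iff₀ (by positivity)]; nlinarith
  obtain ⟨C, hC⟩ : ∃ C, C = (192 / δ ^ 2) ^ 2 / (1 - q) := ⟨_, rfl⟩
  have hC0 : 0 ≤ C := by
    have : 0 < 1 - q := by linarith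
    rw [hC]; positivity
  set cc := Real.log (2 * (192 / δ ^ 2) ^ 2) + a₀ with hcc
  have hcc0 : 0 < cc := by
    have : 0 ≤ Real.log (2 * (192 / δ ^ 2) ^ 2) := Real.log_nonneg (by nlinarith)
    linarith
  set c := δ / (8 * (1 + C)) with hc
  have hc0 : 0 < c := by positivity
  have hc1 : c ≤ 1 := by rw [hc, div_le_one (by positivity)]; linarith
  obtain ⟨a, M, b, ha, hM, hgeo⟩ := exists_geo hc0 hc1
  set d := δ / (4 * (1 + C)) with hd
  have hd0 : 0 < d := by positivity
  obtain ⟨D, hD⟩ := exists_pow_lt_of_lt_one (show 0 < a ^ 2 / (512 * M) by positivity) (by norm_num : (1 / 2 : ℝ) < 1)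
  set Δ := max 1 (max (cc * D) (Real.log (128 * M / d ^ 2))) with hΔ
  have hΔ0 : 0 < Δ := lt_of_lt_of_le one_pos (le_max_left _ _)
  have hΔ1 : cc * D ≤ Δ := (le_max_left _ _).trans (le_max_right _ _)
  have hΔ2 : Real.log (128 * M / d ^ 2) ≤ Δ := (le_max_right _ _).trans (le_max_right _ _)
  clear_value Δ
  obtain ⟨N, hN⟩ := exists_two_records hcc0 ha₀pos hΔ0
  obtain ⟨k₀, s₀, τ₀, B₀, G⟩ := hgeo (8 * (1 / 2) ^ N) (by positivity)
  obtain ⟨σ, hσ0, hσ1, hσ, hst⟩ := Fam.exists_strict_seq hδ (lam := fun n => δ / (8 * (1 + C) * (n + 1)))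
    fun n => by positivity
  have h𝒯 : ∀ ρ : ℝ, 1 ≤ (fun ρ : ℝ => 8 / σ ⌈ρ⌉₊) ρ := fun ρ => by
    have h1 := hσ0 ⌈ρ⌉₊
    have h2 := hσ1 ⌈ρ⌉₊
    simp only
    rw [le_div_iff₀ h1]; linarith
  obtain ⟨R, m, hR, hm, hm1, HW⟩ := false_of_alt_alt h𝒯 G
  refine ⟨m, hm, hm1, fun r hr hr1 => ?_⟩
  have hR0 : 0 < R := by linarith
  obtain ⟨σ₁, hσ₁, hσ₁1, hst₁⟩ := Fam.strict hδ (lam := r / R) (by positivity)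
  obtain ⟨K₁, hK₁⟩ := exists_pow_lt_of_lt_one (lt_min hσ₁ (hσ0 ⌈R⌉₊)) (by norm_num : (1 / 2 : ℝ) < 1)
  set X := max (cc * K₁) (Real.log (2 / δ * R / (m * r))) with hX
  have hX0 : 0 ≤ X := le_max_of_le_left (by positivity)
  obtain ⟨K, hK⟩ := hN X hX0
  refine ⟨K, (1 / 2) ^ K * δ ^ 2 / 128, by positivity, ?_⟩
  intro n hn u v Ω₁ Ω₂ L l e f F hecc
  obtain ⟨k, k', hkk, hk'K, hk'N, rec, rec', hΔb, hXb, hXk, hΔk⟩ := hK n hn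
    (fun k => Real.log (L ((1 / 2) ^ k) / l ((1 / 2) ^ k)) + k * Real.log q)
    (by simp [F.L1, F.l1])
    (by
      intro k hk
      have h1 := F.abs_log_ecc_sub_le k
      rw [abs_le] at h1 ⊢
      push_cast
      rw [hlogq]
      constructor <;> linarith)
    (by
      intro k hk1 hkn
      have h1 := Real.log_le_log (by positivity) (hecc k hk1 hkn).le
      have h2 : Real.log (((1 / 2 : ℝ) ^ k) ^ (-ε)) = ε * (k * Real.log 2) := by
        rw [Real.log_rpow (by positivity), Real.log_pow, one_div, Real.log_inv]; ring
      rw [h2] at h1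
      rw [hlogq]
      have h3 : a₀ * k + k * a₀ = ε * (k * Real.log 2) := by rw [ha₀]; ring
      linarith)
  have mk := half_pow_mem k
  have mk' := half_pow_mem k'
  have mn := half_pow_mem n
  have t1 := F.tilt_le hq0 hq1 (show k ≤ n by omega) fun d hd' =>
    F.inv_ecc_le_of_log hq0 (rec (k + d) (by omega) hd')
  have t2 := F.tilt_le hq0 hq1 (show k' ≤ n by omega) fun d hd' =>
    F.inv_ecc_le_of_log hq0 (rec' (k' + d) (by omega) hd')
  rw [← hC] at t1 t2
  have hratio : (1 / 2 : ℝ) ^ k' / (1 / 2) ^ k = (1 / 2) ^ (k' - k) := by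
    rw [pow_sub₀ _ (by norm_num) hkk.le, div_eq_mul_inv]
  have hkk1 : K₁ ≤ k := by
    have : cc * K₁ ≤ cc * k := (le_max_left _ _).trans hXk
    exact_mod_cast le_of_mul_le_mul_left this hcc0
  have hDk : D ≤ k' - k := by
    have h1 : cc * D ≤ cc * (k' - k) := hΔ1.trans hΔk
    have h2 := le_of_mul_le_mul_left h1 hcc0
    rw [← Nat.cast_sub hkk.le] at h2
    exact_mod_cast h2
  have hsmall : (1 / 2 : ℝ) ^ k ≤ (1 / 2) ^ K₁ := pow_le_pow_of_le_one (by norm_num) (by norm_num) hkk1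
  have hsmall1 := (hsmall.trans hK₁.le).trans (min_le_left _ _)
  have hsmall2 := (hsmall.trans hK₁.le).trans (min_le_right _ _)
  have hlk := F.lpos _ mk
  have hLk := F.Lpos mk
  have hLk' := F.Lpos mk'
  have hL128 : L ((1 / 2) ^ k) ≤ 128 / δ ^ 2 := by
    have h1 := F.L_le mk (show (1 : ℝ) ∈ Ioc (0 : ℝ) 1 by simp)
    rw [F.L1, mul_one, div_one] at h1
    refine h1.trans ?_
    rw [div_mul_eq_mul_div]
    gcongr
    linarith [mk.2]
  have hll : l ((1 / 2) ^ k) ≤ 1 := by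
    have h1 := F.lL _ mk
    have h2 := F.Ll _ mk
    by_contra! h3
    nlinarith [mk.2]
  have hlow : (1 / 2) ^ K * δ ^ 2 / 128 ≤ l ((1 / 2) ^ k) := by
    have h2 := F.Ll _ mk
    have h3 : (1 / 2 : ℝ) ^ K ≤ (1 / 2) ^ k := pow_le_pow_of_le_one (by norm_num) (by norm_num) (by omega)
    rw [div_le_iff₀ (by norm_num)]
    rw [le_div_iff₀ (by positivity)] at hL128
    have h4 : L ((1 / 2) ^ k) * δ ^ 2 * l ((1 / 2) ^ k) ≤ 128 * l ((1 / 2) ^ k) := by gcongr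
    have h5 : (1 / 2) ^ K * δ ^ 2 ≤ (1 / 2) ^ k * δ ^ 2 := by gcongr
    have h6 : L ((1 / 2) ^ k) * δ ^ 2 * l ((1 / 2) ^ k) = (1 / 2) ^ k * δ ^ 2 := by
      rw [mul_right_comm, h2]
    linarith
  have hLR : L ((1 / 2) ^ k) * R ≤ r := by
    have m1 : (1 : ℝ) ∈ Ioc (0 : ℝ) 1 := by simp
    have h1 := hst₁ u v Ω₁ Ω₂ L l e f F 1 m1 _ mk (by simpa using hsmall1) (e ((1 / 2) ^ k))
    have e1 : gauge2 (e ((1 / 2) ^ k)) (f ((1 / 2) ^ k)) (L ((1 / 2) ^ k)) (l ((1 / 2) ^ k)) (e ((1 / 2) ^ k)) =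
        1 / L ((1 / 2) ^ k) := by
      rw [gauge2, F.ef _ mk, real_inner_self_eq_norm_sq, F.ne _ mk]; simp
    have e2 : 1 ≤ gauge2 (e 1) (f 1) (L 1) (l 1) (e ((1 / 2) ^ k)) := by
      rw [F.L1, F.l1, gauge2, div_one, div_one]
      have h2 := frame_expansion (F.ne 1 m1) (F.nf 1 m1) (F.ef 1 m1) (e ((1 / 2) ^ k))
      have h3 := norm_add_le (⟪e ((1 / 2) ^ k), e 1⟫ • e 1) (⟪e ((1 / 2) ^ k), f 1⟫ • f 1)
      rwa [← h2, norm_smul, norm_smul, F.ne _ mk, F.ne 1 m1, F.nf 1 m1, mul_one, mul_one] at h3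
    rw [e1] at h1
    have h4 := e2.trans h1
    rwa [div_mul_div_comm, mul_one, le_div_iff₀ (by positivity), one_mul, mul_comm] at h4
  have hlogq0 : Real.log q < 0 := by rw [hlogq]; linarith
  have hηk : 2 / δ * R / (m * r) ≤ L ((1 / 2) ^ k) / l ((1 / 2) ^ k) := by
    rw [← Real.log_le_log_iff (by positivity) (by positivity)]
    have h1 := (le_max_right _ _).trans hXb
    have h2 : (k : ℝ) * Real.log q ≤ 0 := mul_nonpos_of_nonneg_of_nonpos (by positivity) hlogq0.le
    linarith
  have hmR : 2 / δ * l ((1 / 2) ^ k) * R ≤ m * (r * L ((1 / 2) ^ k)) := by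
    rw [div_le_div_iff₀ (by positivity) hlk] at hηk
    linarith
  have hecck := F.ecc_pos mk
  have hecck' := F.ecc_pos mk'
  have hKK : 128 * M / d ^ 2 * (L ((1 / 2) ^ k) / l ((1 / 2) ^ k)) ≤ L ((1 / 2) ^ k') / l ((1 / 2) ^ k') := by
    rw [← Real.log_le_log_iff (by positivity) hecck', Real.log_mul (by positivity) hecck.ne']
    have h2 : ((k' : ℝ) - k) * Real.log q ≤ 0 := by
      refine mul_nonpos_of_nonneg_of_nonpos ?_ hlogq0.le
      rw [sub_nonneg]; exact_mod_cast hkk.le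
    linarith
  obtain ⟨p, hp⟩ : ∃ p, p = min (δ * L ((1 / 2) ^ k') / (4 * (1 + C) * L ((1 / 2) ^ k))) (a / 2) := ⟨_, rfl⟩
  have hp0 : 0 < p := by rw [hp]; positivity
  have hpa : p < a := by rw [hp]; exact (min_le_right _ _).trans_lt (by linarith)
  have hMp : 16 * M * (8 * (1 / 2) ^ k' / (1 / 2) ^ k) ≤ p ^ 2 := by
    rw [mul_div_assoc, hratio]
    rcases min_choice (δ * L ((1 / 2) ^ k') / (4 * (1 + C) * L ((1 / 2) ^ k))) (a / 2) with h | h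
    · rw [hp, h, ← hratio]
      rw [F.ecc_eq mk, F.ecc_eq mk', le_div_iff₀ mk'.1] at hKK
      have e1 : (δ * L ((1 / 2) ^ k') / (4 * (1 + C) * L ((1 / 2) ^ k))) ^ 2 =
          d ^ 2 * (L ((1 / 2) ^ k') ^ 2 / L ((1 / 2) ^ k) ^ 2) := by rw [hd]; field_simp
      have h0 := mk.1
      rw [e1]
      calc 16 * M * (8 * ((1 / 2) ^ k' / (1 / 2) ^ k))
          = d ^ 2 * (128 * M / d ^ 2 * (L ((1 / 2) ^ k) ^ 2 / (1 / 2) ^ k) * (1 / 2) ^ k' /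
              L ((1 / 2) ^ k) ^ 2) := by field_simp; ring
        _ ≤ _ := by gcongr
    · rw [hp, h]
      have h1 : (1 / 2 : ℝ) ^ (k' - k) ≤ (1 / 2) ^ D := pow_le_pow_of_le_one (by norm_num) (by norm_num) hDk
      have h2 := h1.trans hD.le
      rw [le_div_iff₀ (by positivity)] at h2
      linarith
  have hθ : 8 * (1 / 2 : ℝ) ^ N ≤ 8 * (1 / 2) ^ k' / (1 / 2) ^ k := by
    rw [mul_div_assoc, hratio]
    have : (1 / 2 : ℝ) ^ N ≤ (1 / 2) ^ (k' - k) := pow_le_pow_of_le_one (by norm_num) (by norm_num) (by omega)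
    linarith
  have W := F.winAt (F.ne _ mn) (F.nf _ mn) (F.ef _ mn) mk mk' hC0 t1 t2 hσ0 hσ hst hsmall2
    (p := p) (by rw [hp]; exact min_le_left _ _)
  exact ⟨l ((1 / 2) ^ k), hlow, hll, HW u v Ω₁ Ω₂ _ _ _ _ r _ _ p (F.ne _ mn) (F.nf _ mn) (F.ef _ mn) hlk
    (F.lL _ mk) hr hr1 hLR hmR hθ hp0 hpa hMp F.core W⟩

/-- Upgrading a lifted alternative to a spread one: if `Ω` is not lifted at the parameters `(r, m')`, it is
spread with the radius attached to any `m ≤ m'`. -/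
theorem spread_of_not_lifted {e f : R2} (he : ‖e‖ = 1) (hf : ‖f‖ = 1) (hef : ⟪e, f⟫ = 0) {Ω : Set R2}
    (hΩ : Convex ℝ Ω) {r r₀ s Λ m m' a₁ a₂ : ℝ} (hr₀ : 0 < r₀) (hr : r ≤ r₀ / 2) (hΛ : 1 ≤ Λ) (hm : 0 < m)
    (hmm : m ≤ m') (hm1 : m' ≤ 1) (h1 : |a₁| ≤ Λ) (h2 : |a₂| ≤ Λ)
    (hs : ∀ s t : ℝ, |s| ≤ r₀ → |t| ≤ r₀ → (a₁ + s) • e + (a₂ + t) • f ∈ Ω)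
    (hsr : s ≤ m * r₀ / (2 * (Λ + 1))) (hn : ¬ Alt e f r Λ m' Ω) : Spread e f s Λ Ω := by
  rcases spread_or_lifted he hf hef hΩ hr₀ hΛ (hm.trans_le hmm) hm1 h1 h2 hs with h | ⟨σ, hσ, h⟩
  · refine h.mono (hsr.trans ?_)
    gcongr
  · exact absurd (Or.inl ⟨σ, hσ, h.mono hr⟩) hn

/-- given `δ̄ > 0` and `ε > 0` there is `h₀ > 0`, depending only on `ε` and
`δ̄`, such that every pair `(u, v) ∈ S(δ̄)` has some `h ∈ [h₀, 1/2]` with `η_u(h) ≤ h^{-ε}`. -/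
theorem stmt_16 :
    ∀ δb : ℝ, 0 < δb → ∀ ε : ℝ, 0 < ε →
      ∃ h₀ : ℝ, 0 < h₀ ∧ h₀ ≤ 1 / 2 ∧
        ∀ (u v : R2 → ℝ) (Ω₁ Ω₂ : Set R2) (L l : ℝ → ℝ) (e f : ℝ → R2),
          InSFamily δb u v Ω₁ Ω₂ L l e f →
          ∃ h : ℝ, h₀ ≤ h ∧ h ≤ 1 / 2 ∧ L h / l h ≤ h ^ (-ε) := by
  intro δ hδ ε hε
  by_cases hδ1 : δ ≤ 1
  swap
  · exact ⟨1 / 2, by norm_num, le_rfl, fun u v Ω₁ Ω₂ L l e f H => absurd (H.toFam hδ).le_one hδ1⟩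
  obtain ⟨m, hm, hm1, W⟩ := exists_window hδ hδ1 hε
  have hΛ : 1 ≤ 2 / δ := by rw [le_div_iff₀ hδ]; linarith
  have hr₀ : 0 < δ / 4 := by positivity
  obtain ⟨K₁, ρ₁, hρ₁, W₁⟩ := W (δ / 4 / 2) (by positivity) (by linarith)
  obtain ⟨r₂, hr₂⟩ : ∃ r₂, r₂ = min (δ / 4 / 2) (m * ρ₁ * (δ / 4) / (2 * (2 / δ + 1))) := ⟨_, rfl⟩
  have hr₂0 : 0 < r₂ := by rw [hr₂]; positivity
  have hr₂1 : r₂ ≤ δ / 4 / 2 := hr₂ ▸ min_le_left _ _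
  have hr₂2 : r₂ ≤ m * ρ₁ * (δ / 4) / (2 * (2 / δ + 1)) := hr₂ ▸ min_le_right _ _
  obtain ⟨K₂, ρ₂, hρ₂, W₂⟩ := W r₂ hr₂0 (by linarith)
  obtain ⟨r₃, hr₃⟩ : ∃ r₃, r₃ = min r₂ (m * ρ₂ * (δ / 4) / (2 * (2 / δ + 1))) := ⟨_, rfl⟩
  have hr₃0 : 0 < r₃ := by rw [hr₃]; positivity
  have hr₃1 : r₃ ≤ r₂ := hr₃ ▸ min_le_left _ _
  have hr₃2 : r₃ ≤ m * ρ₂ * (δ / 4) / (2 * (2 / δ + 1)) := hr₃ ▸ min_le_right _ _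
  obtain ⟨K₃, ρ₃, hρ₃, W₃⟩ := W r₃ hr₃0 (by linarith)
  obtain ⟨n, hn⟩ : ∃ n, n = K₁ + K₂ + K₃ + 1 := ⟨_, rfl⟩
  have hle : ∀ {j : ℕ}, 1 ≤ j → (1 / 2 : ℝ) ^ j ≤ 1 / 2 := fun hj =>
    (pow_le_pow_of_le_one (by norm_num) (by norm_num) hj).trans_eq (pow_one _)
  refine ⟨(1 / 2) ^ n, by positivity, hle (by omega), fun u v Ω₁ Ω₂ L l e f H => ?_⟩
  by_contra! hcon
  have F := H.toFam hδ
  have hecc : ∀ k : ℕ, 1 ≤ k → k ≤ n → ((1 / 2 : ℝ) ^ k) ^ (-ε) < L ((1 / 2) ^ k) / l ((1 / 2) ^ k) :=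
    fun k h1 h2 => hcon _ (pow_le_pow_of_le_one (by norm_num) (by norm_num) h2) (hle h1)
  have mn := half_pow_mem n
  have he := F.ne _ mn
  have hf := F.nf _ mn
  have hef := F.ef _ mn
  have hfe : ⟪f ((1 / 2) ^ n), e ((1 / 2) ^ n)⟫ = 0 := by rw [real_inner_comm, hef]
  obtain ⟨a₁, a₂, ha₁, ha₂, hs⟩ := F.exists_square he hf hef
  obtain ⟨b₁, b₂, hb₁, hb₂, ht⟩ := F.swap.exists_square hf he hfe
  obtain ⟨ℓ₁, hℓ₁, hℓ₁1, V₁⟩ := W₁ n (by omega) u v Ω₁ Ω₂ L l e f F hecc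
  obtain ⟨ℓ₂, hℓ₂, hℓ₂1, V₂⟩ := W₂ n (by omega) u v Ω₁ Ω₂ L l e f F hecc
  obtain ⟨ℓ₃, hℓ₃, hℓ₃1, V₃⟩ := W₃ n (by omega) u v Ω₁ Ω₂ L l e f F hecc
  have hmρ : ∀ {ρ ℓ}, ρ ≤ ℓ → m * ρ ≤ m * ℓ := fun h => mul_le_mul_of_nonneg_left h hm.le
  have hmℓ : ∀ {ℓ}, ℓ ≤ 1 → m * ℓ ≤ 1 := fun h => (mul_le_of_le_one_right hm.le h).trans hm1
  have S₁ : ∀ {s r ρ ℓ : ℝ}, r ≤ δ / 4 / 2 → 0 < ρ → ρ ≤ ℓ → ℓ ≤ 1 →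
      s ≤ m * ρ * (δ / 4) / (2 * (2 / δ + 1)) →
      ¬ Alt (e ((1 / 2) ^ n)) (f ((1 / 2) ^ n)) r (2 / δ) (m * ℓ) Ω₁ →
      Spread (e ((1 / 2) ^ n)) (f ((1 / 2) ^ n)) s (2 / δ) Ω₁ := fun h1 h2 h3 h4 h5 h6 =>
    spread_of_not_lifted he hf hef F.core.o1 hr₀ h1 hΛ (mul_pos hm h2) (hmρ h3) (hmℓ h4) ha₁ ha₂ hs h5 h6
  have S₂ : ∀ {s r ρ ℓ : ℝ}, r ≤ δ / 4 / 2 → 0 < ρ → ρ ≤ ℓ → ℓ ≤ 1 →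
      s ≤ m * ρ * (δ / 4) / (2 * (2 / δ + 1)) →
      ¬ Alt (f ((1 / 2) ^ n)) (e ((1 / 2) ^ n)) r (2 / δ) (m * ℓ) Ω₂ →
      Spread (f ((1 / 2) ^ n)) (e ((1 / 2) ^ n)) s (2 / δ) Ω₂ := fun h1 h2 h3 h4 h5 h6 =>
    spread_of_not_lifted hf he hfe F.core.o2 hr₀ h1 hΛ (mul_pos hm h2) (hmρ h3) (hmℓ h4) hb₁ hb₂ ht h5 h6
  by_cases A₁ : Alt (e ((1 / 2) ^ n)) (f ((1 / 2) ^ n)) (δ / 4 / 2) (2 / δ) (m * ℓ₁) Ω₁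
  · have P₂ := S₂ le_rfl hρ₁ hℓ₁ hℓ₁1 hr₂2 (V₁ A₁)
    have P₁ := S₁ hr₂1 hρ₂ hℓ₂ hℓ₂1 hr₃2 fun h => V₂ h (Or.inr P₂)
    exact V₃ (Or.inr P₁) (Or.inr (P₂.mono hr₃1))
  · have P₁ := S₁ le_rfl hρ₁ hℓ₁ hℓ₁1 hr₂2 A₁
    have P₂ := S₂ hr₂1 hρ₂ hℓ₂ hℓ₂1 hr₃2 (V₂ (Or.inr P₁))
    exact V₃ (Or.inr (P₁.mono hr₃1)) (Or.inr P₂)
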